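/- arXiv:2211.16156 — 3 statements merged into one kernel-verified Lean document; each statement's English description precedes it below -/
import Mathlib

section
/- Let A and B be independent uniformly random n-sided dice in the balanced sequences model. Then the probability that A ties with B tends to 0 as n tends to infinity. -/
open Finset

def dieFinset (n : ℕ) : Finset (Fin n → ℕ) :=
  (Fintype.piFinset fun _ : Fin n => Finset.Icc 1 n).filter
    fun A => ∑ i, A i = n * (n + 1) / 2

def beats {n : ℕ} (A B : Fin n → ℕ) : Prop :=
  ((Finset.univ : Finset (Fin n × Fin n)).filter fun p => B p.2 < A p.1).card >
    ((Finset.univ : Finset (Fin n × Fin n)).filter fun p => A p.1 < B p.2).card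

def ties {n : ℕ} (A B : Fin n → ℕ) : Prop :=
  ((Finset.univ : Finset (Fin n × Fin n)).filter fun p => B p.2 < A p.1).card =
    ((Finset.univ : Finset (Fin n × Fin n)).filter fun p => A p.1 < B p.2).card

instance {n : ℕ} (A B : Fin n → ℕ) : Decidable (beats A B) := by unfold beats; infer_instance
instance {n : ℕ} (A B : Fin n → ℕ) : Decidable (ties A B) := by unfold ties; infer_instance

noncomputable def fA {n : ℕ} (A : Fin n → ℕ) (j : ℕ) : ℝ :=
  ((Finset.univ.filter fun i => A i < j).card : ℝ) +
    (1 / 2) * ((Finset.univ.filter fun i => A i = j).card : ℝ)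

noncomputable def gA {n : ℕ} (A : Fin n → ℕ) (j : ℕ) : ℝ := fA A j - j + 1 / 2

noncomputable def e (x : ℝ) : ℂ := Complex.exp (2 * Real.pi * Complex.I * x)

noncomputable def fhat (n : ℕ) (A : Fin n → ℕ) (α β : ℝ) : ℂ :=
  (n : ℂ)⁻¹ * ∑ j ∈ Finset.Icc 1 n, e (α * gA A j + β * ((j : ℝ) - (n + 1) / 2))


def oddS (L : ℕ) {t : ℕ} (A : Fin t → ℕ) : Finset ℕ :=
  (range L).filter fun l => Odd ((Finset.univ.filter fun i => (A i - 1) / 4 = l).card)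

lemma sum_cons_pi (t : ℕ) (S : Finset ℕ) (F : (Fin (t+1) → ℕ) → ℝ) :
    ∑ A ∈ Fintype.piFinset (fun _ : Fin (t+1) => S), F A =
      ∑ A ∈ Fintype.piFinset (fun _ : Fin t => S), ∑ x ∈ S, F (Fin.cons x A) := by
  rw [← Finset.sum_product']
  symm
  refine Finset.sum_nbij' (fun p => Fin.cons p.2 p.1) (fun A => (fun i => A i.succ, A 0)) ?_ ?_ ?_ ?_ ?_
  · rintro ⟨A, x⟩ h
    simp only [mem_product, Fintype.mem_piFinset] at h ⊢
    intro i
    refine Fin.cases ?_ (fun j => ?_) i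
    · simpa using h.2
    · simpa using h.1 j
  · intro A h
    simp only [mem_product, Fintype.mem_piFinset] at h ⊢
    exact ⟨fun i => h _, h _⟩
  · rintro ⟨A, x⟩ h
    simp
  · intro A h
    ext i
    refine Fin.cases ?_ (fun j => ?_) i <;> simp
  · rintro ⟨A, x⟩ h
    rfl

lemma oddS_cons (L : ℕ) {t : ℕ} (A : Fin t → ℕ) (x : ℕ) :
    (oddS L A).card ≤ (oddS L (Fin.cons x A : Fin (t+1) → ℕ)).card + 1 ∧
    ((x-1)/4 ∉ oddS L A → (oddS L A).card ≤ (oddS L (Fin.cons x A : Fin (t+1) → ℕ)).card) ∧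
    ((x-1)/4 < L → (x-1)/4 ∉ oddS L A →
      (oddS L A).card + 1 ≤ (oddS L (Fin.cons x A : Fin (t+1) → ℕ)).card) := by
  have key : ∀ l, (Finset.univ.filter fun i => ((Fin.cons x A : Fin (t+1) → ℕ) i - 1) / 4 = l).card
      = (if (x-1)/4 = l then 1 else 0) + (Finset.univ.filter fun i => (A i - 1) / 4 = l).card := by
    intro l
    simp only [Finset.card_filter]
    rw [Fin.sum_univ_succ]
    simp
  have mem : ∀ l, l ≠ (x-1)/4 → (l ∈ oddS L (Fin.cons x A : Fin (t+1) → ℕ) ↔ l ∈ oddS L A) := by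
    intro l hl
    unfold oddS
    rw [mem_filter, mem_filter, key l, if_neg (Ne.symm hl), zero_add]
  have h1 : (oddS L A).erase ((x-1)/4) ⊆ oddS L (Fin.cons x A : Fin (t+1) → ℕ) := by
    intro l hl
    rw [mem_erase] at hl
    exact (mem l hl.1).2 hl.2
  refine ⟨?_, ?_, ?_⟩
  · have := card_le_card h1
    have := Finset.pred_card_le_card_erase (s := oddS L A) (a := (x-1)/4)
    omega
  · intro h
    rw [erase_eq_of_notMem h] at h1
    exact card_le_card h1
  · intro hL h
    rw [← card_insert_of_notMem h]
    apply card_le_card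
    intro l hl
    rw [mem_insert] at hl
    rcases hl with rfl | hl
    · unfold oddS at h ⊢
      rw [mem_filter] at h ⊢
      rw [key, if_pos rfl]
      refine ⟨by simpa using hL, ?_⟩
      by_contra h2
      apply h
      refine ⟨by simpa using hL, ?_⟩
      rw [Nat.not_odd_iff_even, add_comm] at h2
      exact Nat.not_even_iff_odd.1 (fun h3 => by
        rw [Nat.even_add] at h2
        simp [h3] at h2)
    · apply h1
      rw [mem_erase]
      exact ⟨fun h' => h (h' ▸ hl), hl⟩

lemma card_super (n : ℕ) (S : Finset ℕ) :
    ((Icc 1 n).filter fun x => (x-1)/4 ∈ S).card ≤ 4 * S.card := by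
  rw [mul_comm]
  calc _ ≤ (S ×ˢ range 4).card := by
        apply Finset.card_le_card_of_injOn (fun x => ((x-1)/4, (x-1)%4))
        · intro x hx
          simp only [coe_filter, Set.mem_ofPred_eq] at hx
          simp only [coe_product, Set.mem_prod, mem_coe, mem_range]
          exact ⟨hx.2, Nat.mod_lt _ (by norm_num)⟩
        · intro x hx y hy h
          simp only [coe_filter, Set.mem_ofPred_eq, mem_Icc] at hx hy
          simp only [Prod.mk.injEq] at h
          omega
    _ = _ := by simp

lemma card_low (n : ℕ) :
    4 * (n/4) ≤ ((Icc 1 n).filter fun x => (x-1)/4 < n/4).card := by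
  calc _ = (Icc 1 (4*(n/4))).card := by simp
    _ ≤ _ := by
      apply card_le_card
      intro x hx
      simp only [mem_filter, mem_Icc] at hx ⊢
      omega

lemma step_bound (n : ℕ) {t : ℕ} (A : Fin t → ℕ) :
    ∑ x ∈ Icc 1 n, (1/2 : ℝ) ^ (oddS (n/4) (Fin.cons x A : Fin (t+1) → ℕ)).card ≤
      (1/2 : ℝ) ^ (oddS (n/4) A).card * (n - 2 * (n/4 : ℕ) + 6 * (oddS (n/4) A).card) := by
  have h : ∀ x ∈ Icc 1 n, (1/2 : ℝ) ^ (oddS (n/4) (Fin.cons x A : Fin (t+1) → ℕ)).card ≤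
     (1/2 : ℝ) ^ (oddS (n/4) A).card * (1 - (1/2) * (if (x-1)/4 < n/4 then 1 else 0)
        + (3/2) * (if (x-1)/4 ∈ oddS (n/4) A then 1 else 0)) := by
    intro x _
    obtain ⟨h1, h2, h3⟩ := oddS_cons (n/4) A x
    set a := (oddS (n/4) A).card
    set b := (oddS (n/4) (Fin.cons x A : Fin (t+1) → ℕ)).card
    have mono : ∀ {p q : ℕ}, p ≤ q → (1/2:ℝ)^q ≤ (1/2)^p := fun hpq =>
      pow_le_pow_of_le_one (by norm_num) (by norm_num) hpq
    by_cases hm : (x-1)/4 ∈ oddS (n/4) A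
    · have hl : (x-1)/4 < n/4 := by
        unfold oddS at hm; simp at hm; exact hm.1
      rw [if_pos hm, if_pos hl]
      have := mono h1
      rw [pow_succ] at this
      linarith
    · by_cases hl : (x-1)/4 < n/4
      · rw [if_neg hm, if_pos hl]
        have := mono (h3 hl hm)
        rw [pow_succ] at this
        linarith
      · rw [if_neg hm, if_neg hl]
        have := mono (h2 hm)
        linarith
  refine (sum_le_sum h).trans ?_
  rw [← mul_sum]
  apply mul_le_mul_of_nonneg_left _ (by positivity)
  rw [sum_add_distrib, sum_sub_distrib, ← mul_sum, ← mul_sum, sum_boole, sum_boole]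
  have h1 := card_low n
  have h2 := card_super n (oddS (n/4) A)
  have h1' := (Nat.cast_le (α := ℝ)).2 h1
  have h2' := (Nat.cast_le (α := ℝ)).2 h2
  simp only [sum_const, Nat.card_Icc, nsmul_eq_mul, mul_one, Nat.add_sub_cancel]
  rw [Nat.cast_mul] at h1' h2'
  simp only [Nat.cast_ofNat] at h1' h2'
  linarith

lemma phi_bound (n : ℕ) (hn : 6 ≤ n) (t : ℕ) :
    ∑ A ∈ Fintype.piFinset (fun _ : Fin t => Icc 1 n), (1/2 : ℝ) ^ (oddS (n/4) A).card ≤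
      (n:ℝ)^t * ((7/8)^t + 16 * (1/4)^(n/48)) := by
  induction t with
  | zero =>
    simp only [pow_zero, one_mul]
    have : ∀ A ∈ Fintype.piFinset (fun _ : Fin 0 => Icc 1 n), (1/2 : ℝ) ^ (oddS (n/4) A).card ≤ 1 :=
      fun A _ => pow_le_one₀ (by norm_num) (by norm_num)
    refine (sum_le_sum this).trans ?_
    simp
  | succ t ih =>
    rw [sum_cons_pi]
    have h : ∀ A ∈ Fintype.piFinset (fun _ : Fin t => Icc 1 n),
        ∑ x ∈ Icc 1 n, (1/2 : ℝ) ^ (oddS (n/4) (Fin.cons x A : Fin (t+1) → ℕ)).card ≤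
        (7/8) * n * (1/2 : ℝ) ^ (oddS (n/4) A).card + 2 * n * (1/4)^(n/48) := by
      intro A _
      refine (step_bound n A).trans ?_
      have hq : ((n/4 : ℕ) : ℝ) * 4 ≥ n - 3 := by
        have : n ≤ (n/4)*4 + 3 := by omega
        have : (n:ℝ) ≤ (n/4 : ℕ)*4 + 3 := by exact_mod_cast this
        linarith
      have hq2 : ((n/4 : ℕ) : ℝ) * 4 ≤ n := by
        have : (n/4)*4 ≤ n := by omega
        exact_mod_cast this
      have hn' : (6:ℝ) ≤ n := by exact_mod_cast hn
      have hO : (oddS (n/4) A).card ≤ n/4 := by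
        unfold oddS
        exact (card_filter_le _ _).trans (by simp)
      by_cases hc : 6 * (oddS (n/4) A).card ≤ n/4
      · have hc' : 6 * ((oddS (n/4) A).card : ℝ) ≤ (n/4 : ℕ) := by exact_mod_cast hc
        have h1 : (n:ℝ) - 2 * (n/4 : ℕ) + 6 * (oddS (n/4) A).card ≤ 7/8 * n := by linarith
        have h2 : (0:ℝ) ≤ 2 * n * (1/4)^(n/48) := by positivity
        have h3 := mul_le_mul_of_nonneg_left h1 (show (0:ℝ) ≤ (1/2 : ℝ) ^ (oddS (n/4) A).card by positivity)
        linarith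
      · have hO' : ((oddS (n/4) A).card : ℝ) ≤ (n/4 : ℕ) := by exact_mod_cast hO
        have h1 : (n:ℝ) - 2 * (n/4 : ℕ) + 6 * (oddS (n/4) A).card ≤ 2 * n := by linarith
        have h2 : (0:ℝ) ≤ 7/8 * n * (1/2 : ℝ) ^ (oddS (n/4) A).card := by positivity
        have h4 : (1/2 : ℝ) ^ (oddS (n/4) A).card ≤ (1/4)^(n/48) := by
          rw [show (1/4:ℝ) = (1/2)^2 by norm_num, ← pow_mul]
          exact pow_le_pow_of_le_one (by norm_num) (by norm_num) (by omega)
        have h3 := mul_le_mul_of_nonneg_left h1 (show (0:ℝ) ≤ (1/2 : ℝ) ^ (oddS (n/4) A).card by positivity)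
        have h5 := mul_le_mul_of_nonneg_left h4 (show (0:ℝ) ≤ 2 * n by positivity)
        linarith
    refine (sum_le_sum h).trans ?_
    rw [sum_add_distrib, ← mul_sum, sum_const, Fintype.card_piFinset_const]
    have := mul_le_mul_of_nonneg_left ih (show (0:ℝ) ≤ 7/8 * n by positivity)
    simp only [Nat.card_Icc, Nat.add_sub_cancel, nsmul_eq_mul] at *
    refine (add_le_add_left this _).trans (le_of_eq ?_)
    push_cast
    ring

lemma bad_bound (n : ℕ) (hn : 6 ≤ n) :
    (((Fintype.piFinset (fun _ : Fin n => Icc 1 n)).filter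
      fun A => (oddS (n/4) A).card < n/48).card : ℝ) ≤ 17 * (n:ℝ)^n * (1/2)^(n/48) := by
  have h1 : (((Fintype.piFinset (fun _ : Fin n => Icc 1 n)).filter
      fun A => (oddS (n/4) A).card < n/48).card : ℝ) * (1/2)^(n/48) ≤
      (n:ℝ)^n * ((7/8)^n + 16 * (1/4)^(n/48)) := by
    refine le_trans ?_ (phi_bound n hn n)
    rw [← nsmul_eq_mul, ← sum_const]
    refine le_trans (sum_le_sum (g := fun A => (1/2 : ℝ) ^ (oddS (n/4) A).card) ?_)
      (sum_le_sum_of_subset_of_nonneg (filter_subset _ _) (fun _ _ _ => by positivity))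
    intro A hA
    rw [mem_filter] at hA
    exact pow_le_pow_of_le_one (by norm_num) (by norm_num) hA.2.le
  have h2 : (7/8:ℝ)^n ≤ (1/4)^(n/48) := by
    calc (7/8:ℝ)^n ≤ (7/8)^(48*(n/48)) := pow_le_pow_of_le_one (by norm_num) (by norm_num) (by omega)
      _ = ((7/8)^48)^(n/48) := pow_mul _ _ _
      _ ≤ _ := pow_le_pow_left₀ (by norm_num) (by norm_num) _
  have h3 : (1/4:ℝ)^(n/48) = (1/2)^(n/48) * (1/2)^(n/48) := by rw [← mul_pow]; norm_num
  have hp : (0:ℝ) < (1/2)^(n/48) := by positivity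
  refine le_of_mul_le_mul_right ?_ hp
  refine h1.trans ?_
  have := mul_le_mul_of_nonneg_left h2 (show (0:ℝ) ≤ (n:ℝ)^n by positivity)
  rw [mul_add, h3] at *
  linarith

lemma choose_half_sq (m : ℕ) : (m+1) * (m.choose (m/2))^2 ≤ 4^m := by
  have even : ∀ j : ℕ, (2*j+1) * (Nat.centralBinom j)^2 ≤ 16^j := by
    intro j
    induction j with
    | zero => simp
    | succ j ih =>
      have h := Nat.succ_mul_centralBinom_succ j
      have h2 : (j+1)^2 * ((2*(j+1)+1) * (Nat.centralBinom (j+1))^2) ≤ (j+1)^2 * 16^(j+1) := by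
        calc (j+1)^2 * ((2*(j+1)+1) * (Nat.centralBinom (j+1))^2)
            = (2*j+3) * ((j+1) * Nat.centralBinom (j+1))^2 := by ring
          _ = 4 * ((2*j+3) * (2*j+1)) * ((2*j+1) * (Nat.centralBinom j)^2) := by rw [h]; ring
          _ ≤ 4 * ((2*j+3) * (2*j+1)) * 16^j := Nat.mul_le_mul_left _ ih
          _ ≤ (16 * (j+1)^2) * 16^j := Nat.mul_le_mul_right _ (by nlinarith)
          _ = _ := by ring
      exact Nat.le_of_mul_le_mul_left h2 (by positivity)
  rcases Nat.even_or_odd' m with ⟨j, rfl | rfl⟩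
  · have := even j
    rw [Nat.centralBinom] at this
    rw [Nat.mul_div_cancel_left _ (by norm_num), pow_mul]
    exact this
  · have h1 := even (j+1)
    have h2 : Nat.centralBinom (j+1) = 2 * (2*j+1).choose j := by
      rw [Nat.centralBinom, show 2*(j+1) = (2*j+1)+1 by ring, Nat.choose_succ_succ,
        Nat.choose_symm_half]; ring
    rw [h2] at h1
    rw [show (2*j+1)/2 = j by omega]
    have h3 : (16:ℕ)^(j+1) = 4 * 4^(2*j+1) := by
      rw [show (16:ℕ) = 4^2 by norm_num, ← pow_mul, ← pow_succ']; ring_nf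
    rw [h3] at h1
    nlinarith [Nat.zero_le (((2*j+1).choose j)^2)]

lemma lo_all {α : Type*} [Fintype α] [DecidableEq α] (d : α → ℤ) (hd : ∀ a, d a ≠ 0) (c : ℤ) :
    ((Finset.univ : Finset (Finset α)).filter fun s => ∑ a ∈ s, d a = c).card ≤
      (Fintype.card α).choose (Fintype.card α / 2) := by
  set N : Finset α := Finset.univ.filter fun a => d a < 0 with hN
  have hinj : Function.Injective (fun s : Finset α => symmDiff s N) := symmDiff_left_injective N
  rw [← card_image_of_injective _ hinj]
  apply IsAntichain.sperner
  have val : ∀ s : Finset α, ∑ a ∈ symmDiff s N, |d a| = ∑ a ∈ s, d a - ∑ a ∈ N, d a := by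
    intro s
    have e1 : ∀ s : Finset α, ∑ a ∈ s, d a = ∑ a, if a ∈ s then d a else 0 := by
      intro s; simp
    have e2 : ∀ s : Finset α, ∑ a ∈ s, |d a| = ∑ a, if a ∈ s then |d a| else 0 := by
      intro s; simp
    rw [e2, e1 s, e1 N, ← sum_sub_distrib]
    apply sum_congr rfl
    intro a _
    simp only [mem_symmDiff]
    by_cases h : d a < 0
    · have : a ∈ N := by simp [hN, h]
      by_cases hs : a ∈ s <;> simp [this, hs, abs_of_neg h]
    · have : a ∉ N := by simp [hN, h]
      by_cases hs : a ∈ s <;> simp [this, hs, abs_of_nonneg (not_lt.1 h)]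
  intro x hx y hy hxy hle
  simp only [coe_image, Set.mem_image, coe_filter, mem_univ, true_and, Set.mem_ofPred_eq] at hx hy
  obtain ⟨s, hs, rfl⟩ := hx
  obtain ⟨t, ht, rfl⟩ := hy
  have h1 := val s
  have h2 := val t
  rw [hs] at h1
  rw [ht, ← h1] at h2
  obtain ⟨a, ha, ha'⟩ := Finset.exists_of_ssubset (Finset.ssubset_iff_subset_ne.2 ⟨hle, hxy⟩)
  have := Finset.sum_lt_sum_of_subset (f := fun a => |d a|) hle ha ha' (abs_pos.2 (hd a)) (fun j _ _ => abs_nonneg _)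
  omega

lemma lo_some {k : ℕ} (d : Fin k → ℤ) (c : ℤ) (g : Finset (Fin k)) (hd : ∀ a ∈ g, d a ≠ 0) :
    ((Finset.univ : Finset (Finset (Fin k))).filter fun s => ∑ a ∈ s, d a = c).card ≤
      g.card.choose (g.card / 2) * 2^(k - g.card) := by
  have h := Finset.card_le_mul_card_image (f := fun s : Finset (Fin k) => s \ g)
    ((Finset.univ : Finset (Finset (Fin k))).filter fun s => ∑ a ∈ s, d a = c)
    (g.card.choose (g.card / 2)) ?_
  · refine h.trans (Nat.mul_le_mul_left _ ?_)
    calc _ ≤ (gᶜ).powerset.card := by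
          apply card_le_card
          intro s hs
          rw [mem_image] at hs
          obtain ⟨t, _, rfl⟩ := hs
          rw [mem_powerset]
          intro a ha
          simp at ha ⊢
          exact ha.2
      _ = _ := by rw [card_powerset, card_compl, Fintype.card_fin]
  · intro b _
    have h2 := lo_all (α := g) (fun a => d a) (fun a => hd a a.2) (c - ∑ a ∈ b, d a)
    rw [Fintype.card_coe] at h2
    refine le_trans ?_ h2
    apply Finset.card_le_card_of_injOn (fun s => s.subtype (· ∈ g))
    · intro s hs
      simp only [coe_filter, mem_filter, mem_univ, true_and, Set.mem_ofPred_eq] at hs ⊢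
      rw [← hs.1, ← hs.2]
      rw [Finset.sum_subtype_eq_sum_filter, ← sum_sdiff (filter_subset (· ∈ g) s)]
      have : s \ filter (· ∈ g) s = s \ g := by ext a; simp; tauto
      rw [this]; ring
    · intro s hs t ht hst
      simp only [coe_filter, mem_filter, mem_univ, true_and, Set.mem_ofPred_eq] at hs ht
      ext a
      by_cases ha : a ∈ g
      · have := Finset.ext_iff.1 hst ⟨a, ha⟩
        simpa using this
      · have := Finset.ext_iff.1 (hs.2.trans ht.2.symm) a
        simpa [ha] using this

/-- flip the slots in `s` by `T`. -/
def flipS {β : Type*} {k : ℕ} (T : β → β) (s : Finset (Fin k)) (P : Fin k → β) : Fin k → β :=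
  fun i => if i ∈ s then T (P i) else P i

lemma slots_sq {m : ℕ} (M k : ℕ) (hM : M ≤ m) (hk : m ≤ k) :
    ((m.choose (m/2) * 2^(k-m) : ℕ) : ℝ) ≤ 2^k * (1 / Real.sqrt (M+1)) := by
  have h := choose_half_sq m
  have h' : ((m:ℝ)+1) * ((m.choose (m/2) : ℕ) : ℝ)^2 ≤ 4^m := by exact_mod_cast h
  have h1 : Real.sqrt (M+1) * ((m.choose (m/2) : ℕ) : ℝ) ≤ 2^m := by
    apply (pow_le_pow_iff_left₀ (by positivity) (by positivity) (two_ne_zero)).1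
    rw [mul_pow, Real.sq_sqrt (by positivity), ← pow_mul, mul_comm m 2, pow_mul]
    norm_num
    refine le_trans ?_ h'
    have : (M:ℝ) ≤ m := by exact_mod_cast hM
    gcongr
  rw [mul_one_div, le_div_iff₀ (by positivity)]
  push_cast
  calc _ = (Real.sqrt (M+1) * ((m.choose (m/2) : ℕ) : ℝ)) * 2^(k-m) := by ring
    _ ≤ 2^m * 2^(k-m) := by gcongr
    _ = 2^k := by rw [← pow_add]; congr 1; omega

lemma slots_lo {β : Type*} [DecidableEq β] (Q : Finset β) (T : β → β) (hT : ∀ p ∈ Q, T p ∈ Q)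
    (hTT : ∀ p, T (T p) = p) (w : β → ℕ) (hw : ∀ p, w (T p) = w p) (f : β → ℤ)
    (k M N : ℕ) (c : ℤ) :
    (((Fintype.piFinset fun _ : Fin k => Q).filter
        fun P => ∑ i, w (P i) = N ∧ ∑ i, f (P i) = c).card : ℝ) ≤
      (1 / Real.sqrt (M+1)) *
        ((Fintype.piFinset fun _ : Fin k => Q).filter fun P => ∑ i, w (P i) = N).card +
      ((Fintype.piFinset fun _ : Fin k => Q).filter
        fun P => (Finset.univ.filter fun i => f (T (P i)) ≠ f (P i)).card < M ∧
          ∑ i, w (P i) = N).card := by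
  set E := (Fintype.piFinset fun _ : Fin k => Q).filter fun P => ∑ i, w (P i) = N with hE
  have hflip : ∀ s P, P ∈ E → flipS T s P ∈ E := by
    intro s P hP
    rw [hE, mem_filter, Fintype.mem_piFinset] at hP ⊢
    refine ⟨fun i => ?_, ?_⟩
    · unfold flipS; split_ifs
      · exact hT _ (hP.1 i)
      · exact hP.1 i
    · rw [← hP.2]
      apply sum_congr rfl
      intro i _
      unfold flipS; split_ifs
      · exact hw _
      · rfl
  have hff : ∀ s (P : Fin k → β), flipS T s (flipS T s P) = P := by
    intro s P
    funext i
    by_cases h : i ∈ s <;> simp [flipS, h, hTT]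
  have hperm : ∀ s : Finset (Fin k), ∑ P ∈ E, (if ∑ i, f (P i) = c then (1:ℝ) else 0) =
      ∑ P ∈ E, (if ∑ i, f (flipS T s P i) = c then (1:ℝ) else 0) := by
    intro s
    refine sum_nbij' (flipS T s) (flipS T s) (hflip s) (hflip s) (fun P _ => hff s P)
      (fun P _ => hff s P) ?_
    intro P _
    rw [hff]
  have hcount : ∀ P : Fin k → β,
      ∑ s : Finset (Fin k), (if ∑ i, f (flipS T s P i) = c then (1:ℝ) else 0) ≤
        2^k * (1 / Real.sqrt (M+1)) +
          2^k * (if (Finset.univ.filter fun i => f (T (P i)) ≠ f (P i)).card < M then 1 else 0) := by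
    intro P
    split_ifs with hlt
    · have : ∀ s ∈ (Finset.univ : Finset (Finset (Fin k))),
        (if ∑ i, f (flipS T s P i) = c then (1:ℝ) else 0) ≤ 1 := by
        intro s _; split_ifs <;> norm_num
      refine (sum_le_sum this).trans ?_
      simp
    · rw [not_lt] at hlt
      have h1 := lo_some (fun i => f (T (P i)) - f (P i)) (c - ∑ i, f (P i))
        (Finset.univ.filter fun i => f (T (P i)) ≠ f (P i))
        (by intro a ha; simp only [mem_filter, mem_univ, true_and] at ha; exact sub_ne_zero.2 ha)
      have h2 := slots_sq M k hlt ((card_filter_le _ _).trans (by simp))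
      rw [sum_boole, mul_zero, add_zero]
      refine le_trans ?_ ((Nat.cast_le (α := ℝ)).2 h1 |>.trans h2)
      rw [Nat.cast_le]
      apply card_le_card
      intro s hs
      simp only [mem_filter, mem_univ, true_and] at hs ⊢
      rw [← hs, ← sum_sub_distrib]
      have : ∀ t : Fin k → ℤ, ∑ a ∈ s, t a = ∑ a, if a ∈ s then t a else 0 := by
        intro t; simp
      rw [this]
      apply sum_congr rfl
      intro i _
      by_cases h : i ∈ s <;> simp [flipS, h]
  have e1 : (((Fintype.piFinset fun _ : Fin k => Q).filter
        fun P => ∑ i, w (P i) = N ∧ ∑ i, f (P i) = c).card : ℝ) =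
      ∑ P ∈ E, (if ∑ i, f (P i) = c then (1:ℝ) else 0) := by
    rw [sum_boole, hE, filter_filter]
  have e2 : (((Fintype.piFinset fun _ : Fin k => Q).filter
        fun P => (Finset.univ.filter fun i => f (T (P i)) ≠ f (P i)).card < M ∧
          ∑ i, w (P i) = N).card : ℝ) =
      ∑ P ∈ E, (if (Finset.univ.filter fun i => f (T (P i)) ≠ f (P i)).card < M then (1:ℝ) else 0) := by
    rw [sum_boole, hE, filter_filter]
    simp only [and_comm]
  rw [e1, e2]
  have h2k : (0:ℝ) < 2^k := by positivity
  refine le_of_mul_le_mul_left ?_ h2k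
  calc (2:ℝ)^k * ∑ P ∈ E, (if ∑ i, f (P i) = c then (1:ℝ) else 0)
      = ∑ s : Finset (Fin k), ∑ P ∈ E, (if ∑ i, f (P i) = c then (1:ℝ) else 0) := by
        rw [sum_const]; simp
    _ = ∑ s : Finset (Fin k), ∑ P ∈ E, (if ∑ i, f (flipS T s P i) = c then (1:ℝ) else 0) :=
        sum_congr rfl fun s _ => hperm s
    _ = ∑ P ∈ E, ∑ s : Finset (Fin k), (if ∑ i, f (flipS T s P i) = c then (1:ℝ) else 0) :=
        sum_comm
    _ ≤ ∑ P ∈ E, (2^k * (1 / Real.sqrt (M+1)) +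
          2^k * (if (Finset.univ.filter fun i => f (T (P i)) ≠ f (P i)).card < M then 1 else 0)) :=
        sum_le_sum fun P _ => hcount P
    _ = _ := by
        rw [sum_add_distrib, sum_const, ← mul_sum, nsmul_eq_mul]; ring

lemma slots_few {β : Type*} [DecidableEq β] (Q : Finset β) (good : β → Prop) [DecidablePred good]
    (k M : ℕ) :
    (((Fintype.piFinset fun _ : Fin k => Q).filter
        fun P => (Finset.univ.filter fun i => good (P i)).card < M).card : ℝ) ≤
      2^M * (Q.card - (Q.filter good).card / 2 : ℝ)^k := by
  have h1 : ∑ p ∈ Q, (if good p then (1/2:ℝ) else 1) = Q.card - (Q.filter good).card / 2 := by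
    have : ∀ p ∈ Q, (if good p then (1/2:ℝ) else 1) = 1 - (1/2) * (if good p then 1 else 0) := by
      intro p _; split_ifs <;> norm_num
    rw [sum_congr rfl this, sum_sub_distrib, ← mul_sum, sum_boole]
    simp; ring
  have h2 : ∑ P ∈ Fintype.piFinset fun _ : Fin k => Q, ∏ i, (if good (P i) then (1/2:ℝ) else 1)
      = (Q.card - (Q.filter good).card / 2 : ℝ)^k := by
    rw [← Finset.prod_univ_sum (fun _ => Q) (fun _ p => if good p then (1/2:ℝ) else 1), prod_const, h1]
    simp
  rw [← h2, mul_sum]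
  rw [← mul_one (((Finset.card _ : ℕ)) : ℝ), ← nsmul_eq_mul, ← sum_const]
  refine le_trans (sum_le_sum (g := fun P => 2^M * ∏ i, (if good (P i) then (1/2:ℝ) else 1)) ?_)
      (sum_le_sum_of_subset_of_nonneg (filter_subset _ _) (fun _ _ _ => ?_))
  · intro P hP
    rw [mem_filter] at hP
    rw [prod_ite, prod_const, prod_const_one, mul_one]
    calc (1:ℝ) = 2^M * (1/2)^M := by rw [← mul_pow]; norm_num
      _ ≤ _ := by
        apply mul_le_mul_of_nonneg_left _ (by positivity)
        exact pow_le_pow_of_le_one (by norm_num) (by norm_num) hP.2.le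
  · apply mul_nonneg (by positivity)
    apply prod_nonneg
    intro i _
    split_ifs <;> norm_num

def toggle (n : ℕ) (p : ℕ × ℕ) : ℕ × ℕ :=
  if p.1 % 2 = 1 ∧ p.2 % 2 = 0 ∧ p.1 ≤ 2 * (n/2) ∧ p.2 ≤ 2 * (n/2) ∧ 1 ≤ p.2 then (p.1+1, p.2-1)
  else if p.1 % 2 = 0 ∧ p.2 % 2 = 1 ∧ p.1 ≤ 2 * (n/2) ∧ p.2 ≤ 2 * (n/2) ∧ 1 ≤ p.1 then
    (p.1-1, p.2+1)
  else p

lemma toggle_mem (n : ℕ) (p : ℕ × ℕ) (h : p ∈ Icc 1 n ×ˢ Icc 1 n) :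
    toggle n p ∈ Icc 1 n ×ˢ Icc 1 n := by
  obtain ⟨x, y⟩ := p
  simp only [mem_product, mem_Icc, toggle] at h ⊢
  split_ifs <;> simp only <;> omega

lemma toggle_toggle (n : ℕ) (p : ℕ × ℕ) : toggle n (toggle n p) = p := by
  obtain ⟨x, y⟩ := p
  by_cases h1 : x % 2 = 1 ∧ y % 2 = 0 ∧ x ≤ 2 * (n/2) ∧ y ≤ 2 * (n/2) ∧ 1 ≤ y
  · have : toggle n (x, y) = (x+1, y-1) := by simp only [toggle]; rw [if_pos h1]
    rw [this]
    simp only [toggle]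
    rw [if_neg (by omega), if_pos (by omega)]
    ext <;> simp only <;> omega
  · by_cases h2 : x % 2 = 0 ∧ y % 2 = 1 ∧ x ≤ 2 * (n/2) ∧ y ≤ 2 * (n/2) ∧ 1 ≤ x
    · have : toggle n (x, y) = (x-1, y+1) := by simp only [toggle]; rw [if_neg h1, if_pos h2]
      rw [this]
      simp only [toggle]
      rw [if_pos (by omega)]
      ext <;> simp only <;> omega
    · have : toggle n (x, y) = (x, y) := by simp only [toggle]; rw [if_neg h1, if_neg h2]
      rw [this, this]

lemma toggle_sum (n : ℕ) (p : ℕ × ℕ) : (toggle n p).1 + (toggle n p).2 = p.1 + p.2 := by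
  obtain ⟨x, y⟩ := p
  simp only [toggle]
  split_ifs <;> simp only <;> omega

def sc {n : ℕ} (A : Fin n → ℕ) (x : ℕ) : ℤ :=
  ∑ i, ((if A i < x then 1 else 0) - (if x < A i then 1 else 0))

def bc {n : ℕ} (A : Fin n → ℕ) (p : ℕ) : ℤ := ∑ i, if (A i - 1) / 2 = p then 1 else 0

lemma sc_step {n : ℕ} (A : Fin n → ℕ) (hA : ∀ i, 1 ≤ A i) (x : ℕ) (hx : x % 2 = 1) :
    sc A (x+1) - sc A x = bc A ((x-1)/2) := by
  unfold sc bc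
  rw [← sum_sub_distrib]
  apply sum_congr rfl
  intro i _
  have := hA i
  split_ifs <;> omega

lemma ties_iff {n : ℕ} (A B : Fin n → ℕ) : ties A B ↔ ∑ j, sc A (B j) = 0 := by
  unfold ties sc
  have h : ∑ j, ∑ i, (((if A i < B j then 1 else 0) - (if B j < A i then 1 else 0)) : ℤ) =
    (((Finset.univ : Finset (Fin n × Fin n)).filter fun p => A p.1 < B p.2).card : ℤ) -
    ((Finset.univ : Finset (Fin n × Fin n)).filter fun p => B p.2 < A p.1).card := by
    rw [card_filter, card_filter, Fintype.sum_prod_type_right, Fintype.sum_prod_type_right]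
    push_cast
    simp only [sum_sub_distrib]
  rw [h]
  omega

lemma toggle_good (n : ℕ) (A : Fin n → ℕ) (hA : ∀ i, 1 ≤ A i) (x y : ℕ)
    (hx : 1 ≤ x) (hy : 1 ≤ y) (hx' : x ≤ 2 * (n/2)) (hy' : y ≤ 2 * (n/2))
    (hxy : (x + y) % 2 = 1) (hb : bc A ((x-1)/2) ≠ bc A ((y-1)/2)) :
    sc A (toggle n (x,y)).1 + sc A (toggle n (x,y)).2 ≠ sc A x + sc A y := by
  rcases Nat.mod_two_eq_zero_or_one x with h | h
  · have : toggle n (x, y) = (x-1, y+1) := by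
      simp only [toggle]; rw [if_neg (by omega), if_pos (by omega)]
    rw [this]
    have h1 := sc_step A hA (x-1) (by omega)
    have h2 := sc_step A hA y (by omega)
    rw [Nat.sub_add_cancel hx, show (x-1-1)/2 = (x-1)/2 by omega] at h1
    simp only
    intro h3
    apply hb
    linarith
  · have : toggle n (x, y) = (x+1, y-1) := by
      simp only [toggle]; rw [if_pos (by omega)]
    rw [this]
    have h1 := sc_step A hA x (by omega)
    have h2 := sc_step A hA (y-1) (by omega)
    rw [Nat.sub_add_cancel hy, show (y-1-1)/2 = (y-1)/2 by omega] at h2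
    simp only
    intro h3
    apply hb
    linarith

lemma bc_odd {n : ℕ} (A : Fin n → ℕ) (L l : ℕ) (h : l ∈ oddS L A) :
    bc A (2*l) ≠ bc A (2*l+1) := by
  unfold oddS at h
  rw [mem_filter] at h
  have h1 : ((Finset.univ.filter fun i => (A i - 1) / 4 = l).card : ℤ) = bc A (2*l) + bc A (2*l+1) := by
    rw [card_filter]
    push_cast
    unfold bc
    rw [← sum_add_distrib]
    apply sum_congr rfl
    intro i _
    split_ifs <;> omega
  intro h2
  obtain ⟨q, hq⟩ := h.2
  rw [hq, h2] at h1
  omega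

lemma good_count (n : ℕ) (A : Fin n → ℕ) (hA : ∀ i, 1 ≤ A i) :
    4 * (n/4) * (oddS (n/4) A).card ≤
    ((Icc 1 n ×ˢ Icc 1 n).filter fun p : ℕ × ℕ =>
      sc A (toggle n p).1 + sc A (toggle n p).2 ≠ sc A p.1 + sc A p.2).card := by
  have hex : ∀ x l, l ∈ oddS (n/4) A → ∃ y, 1 ≤ y ∧ (y-1)/4 = l ∧ (x+y) % 2 = 1 ∧
      bc A ((x-1)/2) ≠ bc A ((y-1)/2) := by
    intro x l hl
    have h := bc_odd A _ l hl
    by_cases h1 : bc A ((x-1)/2) = bc A (2*l)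
    · rw [← h1] at h
      refine ⟨4*l+4 - (x+1)%2, by omega, by omega, by omega, ?_⟩
      rwa [show (4*l+4 - (x+1)%2 - 1)/2 = 2*l+1 by omega]
    · refine ⟨4*l+2 - (x+1)%2, by omega, by omega, by omega, ?_⟩
      rwa [show (4*l+2 - (x+1)%2 - 1)/2 = 2*l by omega]
  choose! y hy1 hy2 hy3 hy4 using hex
  calc _ = (Icc 1 (4*(n/4)) ×ˢ oddS (n/4) A).card := by simp
    _ ≤ _ := by
      apply Finset.card_le_card_of_injOn (fun p => (p.1, y p.1 p.2))
      · rintro ⟨x, l⟩ h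
        simp only [coe_product, Set.mem_prod, mem_coe, mem_Icc] at h
        have hl : l < n/4 := by
          have := h.2; unfold oddS at this; simp at this; exact this.1
        have a1 := hy1 x l h.2
        have a2 := hy2 x l h.2
        have a3 := hy3 x l h.2
        have a4 := hy4 x l h.2
        simp only [coe_filter, Set.mem_ofPred_eq, mem_product, mem_Icc]
        refine ⟨by omega, ?_⟩
        exact toggle_good n A hA x _ (by omega) a1 (by omega) (by omega) a3 a4
      · rintro ⟨x, l⟩ h ⟨x', l'⟩ h' heq
        simp only [coe_product, Set.mem_prod, mem_coe, mem_Icc] at h h'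
        simp only [Prod.mk.injEq] at heq
        obtain ⟨rfl, h2⟩ := heq
        have a2 := hy2 x l h.2
        have a2' := hy2 x l' h'.2
        rw [h2] at a2
        ext
        · rfl
        · simp only; omega

def mkDie {n k r : ℕ} (ee : (Fin k × Bool) ⊕ Fin r ≃ Fin n) (P : Fin k → ℕ × ℕ) (R : Fin r → ℕ) :
    Fin n → ℕ :=
  fun i => Sum.elim (fun jb : Fin k × Bool => cond jb.2 (P jb.1).1 (P jb.1).2) R (ee.symm i)

lemma sum_mkDie {γ : Type*} [AddCommMonoid γ] {n k r : ℕ} (ee : (Fin k × Bool) ⊕ Fin r ≃ Fin n)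
    (P : Fin k → ℕ × ℕ) (R : Fin r → ℕ) (g : ℕ → γ) :
    ∑ i, g (mkDie ee P R i) = ∑ j, (g (P j).1 + g (P j).2) + ∑ i, g (R i) := by
  rw [← ee.sum_comp]
  simp [mkDie, Fintype.sum_prod_type]

lemma card_split {n k r : ℕ} (ee : (Fin k × Bool) ⊕ Fin r ≃ Fin n) (m : ℕ)
    (pred : (Fin n → ℕ) → Prop) [DecidablePred pred] :
    (((Fintype.piFinset fun _ : Fin n => Icc 1 m).filter pred).card : ℝ) =
    ∑ R ∈ Fintype.piFinset fun _ : Fin r => Icc 1 m,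
      (((Fintype.piFinset fun _ : Fin k => Icc 1 m ×ˢ Icc 1 m).filter
        fun P => pred (mkDie ee P R)).card : ℝ) := by
  simp only [card_filter]
  push_cast
  rw [← sum_product']
  symm
  refine sum_nbij' (fun q => mkDie ee q.2 q.1)
    (fun B => (fun i => B (ee (Sum.inr i)),
      fun j => (B (ee (Sum.inl (j, true))), B (ee (Sum.inl (j, false)))))) ?_ ?_ ?_ ?_ ?_
  · rintro ⟨R, P⟩ h
    simp only [mem_product, Fintype.mem_piFinset] at h ⊢
    intro i
    unfold mkDie
    rcases ee.symm i with ⟨j, b⟩ | j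
    · cases b
      · exact (h.2 j).2
      · exact (h.2 j).1
    · exact h.1 j
  · intro B h
    simp only [mem_product, Fintype.mem_piFinset] at h ⊢
    exact ⟨fun i => h _, fun i => ⟨h _, h _⟩⟩
  · rintro ⟨R, P⟩ h
    simp [mkDie]
  · intro B h
    funext i
    obtain ⟨q, rfl⟩ := ee.surjective i
    rcases q with ⟨j, b⟩ | j
    · cases b <;> simp [mkDie]
    · simp [mkDie]
  · rintro ⟨R, P⟩ h
    rfl

lemma ties_B {n k r : ℕ} (ee : (Fin k × Bool) ⊕ Fin r ≃ Fin n) (A : Fin n → ℕ)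
    (hA : ∀ i, 1 ≤ A i) (M : ℕ) :
    (((dieFinset n).filter fun B => ties A B).card : ℝ) ≤
      (1 / Real.sqrt (M+1)) * (dieFinset n).card +
      (n:ℝ)^r * (2^M * ((n:ℝ)^2 - (4 * (n/4) * (oddS (n/4) A).card : ℕ) / 2)^k) := by
  unfold dieFinset
  rw [filter_filter, card_split ee, card_split ee, mul_sum]
  have hc : (n:ℝ)^r = ((Fintype.piFinset fun _ : Fin r => Icc 1 n).card : ℝ) := by
    rw [Fintype.card_piFinset_const]; simp
  rw [hc, ← nsmul_eq_mul, ← sum_const, ← sum_add_distrib]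
  apply sum_le_sum
  intro R _
  have key := slots_lo (Icc 1 n ×ˢ Icc 1 n) (toggle n) (toggle_mem n) (toggle_toggle n)
    (fun p => p.1 + p.2) (toggle_sum n) (fun p => sc A p.1 + sc A p.2) k M
    (n * (n+1) / 2 - ∑ i, R i) (0 - ∑ i, sc A (R i))
  have few := slots_few (Icc 1 n ×ˢ Icc 1 n)
    (fun p : ℕ × ℕ => sc A (toggle n p).1 + sc A (toggle n p).2 ≠ sc A p.1 + sc A p.2) k M
  have hg := good_count n A hA
  by_cases hR : ∑ i, R i ≤ n * (n+1)/2
  · have s1 : ∀ P : Fin k → ℕ × ℕ, ∑ i, mkDie ee P R i = n*(n+1)/2 ↔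
        ∑ i, ((P i).1 + (P i).2) = n * (n+1) / 2 - ∑ i, R i := by
      intro P
      have := sum_mkDie ee P R (fun x => x)
      rw [this]
      omega
    have s2 : ∀ P : Fin k → ℕ × ℕ, ties A (mkDie ee P R) ↔
        ∑ i, (sc A (P i).1 + sc A (P i).2) = 0 - ∑ i, sc A (R i) := by
      intro P
      rw [ties_iff, sum_mkDie ee P R (sc A)]
      omega
    simp only [s1, s2]
    refine key.trans (add_le_add_right ?_ _)
    refine le_trans ?_ (few.trans ?_)
    · rw [Nat.cast_le]
      apply card_le_card
      intro P hP
      rw [mem_filter] at hP ⊢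
      exact ⟨hP.1, hP.2.1⟩
    · apply mul_le_mul_of_nonneg_left _ (by positivity)
      have hle := card_filter_le (Icc 1 n ×ˢ Icc 1 n) (fun p : ℕ × ℕ =>
        sc A (toggle n p).1 + sc A (toggle n p).2 ≠ sc A p.1 + sc A p.2)
      have hle' := (Nat.cast_le (α := ℝ)).2 hle
      have hg' := (Nat.cast_le (α := ℝ)).2 hg
      have hQ : (((Icc 1 n ×ˢ Icc 1 n).card : ℕ) : ℝ) = (n:ℝ)^2 := by simp; ring
      rw [hQ] at hle' ⊢
      apply pow_le_pow_left₀
      · have : (0:ℝ) ≤ (n:ℝ)^2 := by positivity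
        linarith
      · linarith
  · have : ((Fintype.piFinset fun _ : Fin k => Icc 1 n ×ˢ Icc 1 n).filter fun P =>
        ∑ i, mkDie ee P R i = n*(n+1)/2 ∧ ties A (mkDie ee P R)) = ∅ := by
      apply filter_eq_empty_iff.2
      rintro P _ ⟨h, _⟩
      have := sum_mkDie ee P R (fun x => x)
      rw [this] at h
      omega
    rw [this]
    simp only [card_empty, Nat.cast_zero]
    have hle := card_filter_le (Icc 1 n ×ˢ Icc 1 n) (fun p : ℕ × ℕ =>
        sc A (toggle n p).1 + sc A (toggle n p).2 ≠ sc A p.1 + sc A p.2)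
    have hle' := (Nat.cast_le (α := ℝ)).2 hle
    have hg' := (Nat.cast_le (α := ℝ)).2 hg
    have hQ : (((Icc 1 n ×ˢ Icc 1 n).card : ℕ) : ℝ) = (n:ℝ)^2 := by simp; ring
    rw [hQ] at hle'
    have : (0:ℝ) ≤ (n:ℝ)^2 - (4 * (n/4) * (oddS (n/4) A).card : ℕ) / 2 := by
      have : (0:ℝ) ≤ (n:ℝ)^2 := by positivity
      linarith
    positivity

lemma die_lower {n k r : ℕ} (hn : 1 ≤ n) (hr : r ≤ 1) (hnk : n = 2*k+r)
    (ee : (Fin k × Bool) ⊕ Fin r ≃ Fin n) :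
    n^(2*k) ≤ (k*n+1) * (dieFinset n).card := by
  set U := Fintype.piFinset fun _ : Fin k => Icc 1 n with hU
  have hUc : U.card = n^k := by rw [hU, Fintype.card_piFinset_const]; simp
  have hmap : ∀ u ∈ U, ∑ i, u i ∈ range (k*n+1) := by
    intro u hu
    rw [hU, Fintype.mem_piFinset] at hu
    rw [mem_range, Nat.lt_succ_iff]
    calc ∑ i, u i ≤ ∑ i : Fin k, n := sum_le_sum fun i _ => (mem_Icc.1 (hu i)).2
      _ = k * n := by simp
  have h1 : U.card = ∑ s ∈ range (k*n+1), (U.filter fun u => ∑ i, u i = s).card :=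
    card_eq_sum_card_fiberwise hmap
  have h2 := sq_sum_le_card_mul_sum_sq (s := range (k*n+1))
    (f := fun s => (U.filter fun u => ∑ i, u i = s).card)
  rw [← h1, hUc, card_range, ← pow_mul, mul_comm k 2] at h2
  refine h2.trans (Nat.mul_le_mul_left _ ?_)
  have h3 : ∑ s ∈ range (k*n+1), (U.filter fun u => ∑ i, u i = s).card^2 =
      ((U ×ˢ U).filter fun q => ∑ i, q.1 i = ∑ i, q.2 i).card := by
    rw [card_eq_sum_card_fiberwise (f := fun q : (Fin k → ℕ) × (Fin k → ℕ) => ∑ i, q.1 i)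
      (t := range (k*n+1))]
    · apply sum_congr rfl
      intro s _
      rw [sq, ← card_product]
      congr 1
      ext ⟨u, v⟩
      simp only [mem_product, mem_filter]
      constructor
      · rintro ⟨⟨a, b⟩, c, d⟩
        exact ⟨⟨⟨a, c⟩, b.trans d.symm⟩, b⟩
      · rintro ⟨⟨⟨a, c⟩, b⟩, d⟩
        exact ⟨⟨a, d⟩, c, b ▸ d⟩
    · rintro ⟨u, v⟩ h
      simp only [coe_filter, Set.mem_ofPred_eq, mem_product] at h
      exact hmap u h.1.1
  rw [h3]
  apply Finset.card_le_card_of_injOn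
    (fun q => mkDie ee (fun j => (q.1 j, n + 1 - q.2 j)) (fun _ => (n+1)/2))
  · rintro ⟨u, v⟩ h
    simp only [coe_filter, Set.mem_ofPred_eq, mem_product, hU, Fintype.mem_piFinset, mem_Icc] at h
    obtain ⟨⟨hu, hv⟩, huv⟩ := h
    simp only [dieFinset, coe_filter, Set.mem_ofPred_eq, Fintype.mem_piFinset, mem_Icc]
    constructor
    · intro i
      unfold mkDie
      rcases ee.symm i with ⟨j, b⟩ | j
      · have := hu j
        have := hv j
        cases b <;> simp only [Sum.elim_inl, cond] <;> omega
      · simp only [Sum.elim_inr]; omega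
    · have := sum_mkDie ee (fun j => (u j, n + 1 - v j)) (fun _ => (n+1)/2) (fun x => x)
      rw [this]
      simp only [sum_add_distrib, sum_const, card_univ, Fintype.card_fin, smul_eq_mul]
      have h4 : ∑ j, (n + 1 - v j) + ∑ j, v j = k * (n+1) := by
        rw [← sum_add_distrib]
        rw [sum_congr rfl (g := fun _ => n+1)]
        · simp
        · intro j _
          have := hv j
          omega
      rw [huv, add_comm (∑ i, v i), h4]
      have h5 : n * (n+1) = 2 * (k * (n+1)) + r * (n+1) := by
        nth_rewrite 1 [hnk]; ring
      interval_cases r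
      · omega
      · omega
  · rintro ⟨u, v⟩ h ⟨u', v'⟩ h' heq
    simp only [coe_filter, Set.mem_ofPred_eq, mem_product, hU, Fintype.mem_piFinset, mem_Icc] at h h'
    simp only at heq
    ext j
    · have := congrFun heq (ee (Sum.inl (j, true)))
      simpa [mkDie] using this
    · have := congrFun heq (ee (Sum.inl (j, false)))
      simp [mkDie] at this
      have := h.1.2 j
      have := h'.1.2 j
      simp only
      omega

lemma main_bound (n M : ℕ) (hn : 200 ≤ n) :
    (((dieFinset n ×ˢ dieFinset n).filter fun p => ties p.1 p.2).card : ℝ) /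
          ((dieFinset n).card * (dieFinset n).card) ≤
      1 / Real.sqrt (M+1) + (n:ℝ)^3 * ((17 + 2^M) * (199/200)^(n/48)) := by
  obtain ⟨ee⟩ : Nonempty ((Fin (n/2) × Bool) ⊕ Fin (n%2) ≃ Fin n) := by
    rw [← Fintype.card_eq]
    simp
    omega
  have hlow := die_lower (by omega) (by omega) (by omega) ee
  set d : ℝ := ((dieFinset n).card : ℝ) with hd
  have hn0 : (200:ℝ) ≤ n := by exact_mod_cast hn
  have hpow : (n:ℝ)^n = (n:ℝ)^(n%2) * (n:ℝ)^(2*(n/2)) := by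
    rw [← pow_add]; congr 1; omega
  have hnn : (n:ℝ)^n ≤ n^3 * d := by
    have h1 : (n:ℝ)^(2*(n/2)) ≤ (n:ℝ)^2 * d := by
      have h0 : (n/2)*n+1 ≤ n^2 := by
        have : n/2 * 2 ≤ n := by omega
        nlinarith
      have := hlow.trans (Nat.mul_le_mul_right _ h0)
      rw [hd]; exact_mod_cast this
    have h2 : (n:ℝ)^(n%2) ≤ n := by
      calc (n:ℝ)^(n%2) ≤ (n:ℝ)^1 := pow_le_pow_right₀ (by linarith) (by omega)
        _ = n := pow_one _
    rw [hpow]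
    calc _ ≤ (n:ℝ) * ((n:ℝ)^2 * d) := by gcongr
      _ = _ := by ring
  have hdpos : 0 < d := by
    have : (0:ℝ) < (n:ℝ)^n := by positivity
    by_contra h
    have : (n:ℝ)^3 * d ≤ 0 := mul_nonpos_of_nonneg_of_nonpos (by positivity) (not_lt.1 h)
    linarith
  have hu : (n:ℝ) ≤ 48 * (n/48 : ℕ) + 47 := by
    have : n ≤ 48 * (n/48) + 47 := by omega
    exact_mod_cast this
  have hq : (n:ℝ) ≤ 4 * (n/4 : ℕ) + 3 := by
    have : n ≤ 4 * (n/4) + 3 := by omega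
    exact_mod_cast this
  have mono : ∀ {p q : ℕ}, p ≤ q → (199/200:ℝ)^q ≤ (199/200)^p := fun hpq =>
      pow_le_pow_of_le_one (by norm_num) (by norm_num) hpq
  -- per A bound
  have hA : ∀ A ∈ dieFinset n, (((dieFinset n).filter fun B => ties A B).card : ℝ) ≤
      ((1 / Real.sqrt (M+1)) * d + (n:ℝ)^n * (2^M * (199/200)^(n/48))) +
        d * (if (oddS (n/4) A).card < n/48 then 1 else 0) := by
    intro A hA
    split_ifs with hlt
    · have : (((dieFinset n).filter fun B => ties A B).card : ℝ) ≤ d := by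
        rw [hd, Nat.cast_le]; exact card_filter_le _ _
      have : 0 ≤ (1 / Real.sqrt (M+1)) * d + (n:ℝ)^n * (2^M * (199/200)^(n/48)) := by positivity
      linarith
    · have hA1 : ∀ i, 1 ≤ A i := by
        unfold dieFinset at hA
        rw [mem_filter, Fintype.mem_piFinset] at hA
        exact fun i => (mem_Icc.1 (hA.1 i)).1
      refine (ties_B ee A hA1 M).trans ?_
      rw [mul_zero, add_zero]
      apply add_le_add_right
      rw [hpow, mul_assoc ((n:ℝ)^(n%2)), pow_mul]
      apply mul_le_mul_of_nonneg_left _ (by positivity)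
      rw [mul_left_comm (((n:ℝ)^2)^(n/2))]
      apply mul_le_mul_of_nonneg_left _ (by positivity)
      have hO : ((n/48 : ℕ) : ℝ) ≤ (oddS (n/4) A).card := by exact_mod_cast not_lt.1 hlt
      have hO2 : ((oddS (n/4) A).card : ℝ) ≤ (n/4 : ℕ) := by
        rw [Nat.cast_le]
        unfold oddS
        exact (card_filter_le _ _).trans (by simp)
      have hq2 : 4 * ((n/4 : ℕ) : ℝ) ≤ n := by
        have : 4 * (n/4) ≤ n := by omega
        exact_mod_cast this
      calc _ ≤ ((n:ℝ)^2 * (199/200))^(n/2) := by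
            apply pow_le_pow_left₀
            · push_cast
              nlinarith
            · push_cast
              have h1 : ((n:ℝ) - 3) * (((n:ℝ) - 47)/48) ≤ 4 * ((n/4:ℕ):ℝ) * ((oddS (n/4) A).card : ℝ) := by
                apply mul_le_mul <;> linarith
              nlinarith
        _ = ((n:ℝ)^2)^(n/2) * (199/200)^(n/2) := mul_pow _ _ _
        _ ≤ _ := by
            apply mul_le_mul_of_nonneg_left _ (by positivity)
            exact mono (by omega)
  have hbad := bad_bound n (by omega)
  have htot : (((dieFinset n ×ˢ dieFinset n).filter fun p => ties p.1 p.2).card : ℝ) ≤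
      d * ((1 / Real.sqrt (M+1)) * d + (n:ℝ)^n * (2^M * (199/200)^(n/48))) +
        d * (17 * (n:ℝ)^n * (1/2)^(n/48)) := by
    have : (((dieFinset n ×ˢ dieFinset n).filter fun p => ties p.1 p.2).card : ℝ) =
        ∑ A ∈ dieFinset n, (((dieFinset n).filter fun B => ties A B).card : ℝ) := by
      simp only [card_filter]
      push_cast
      rw [sum_product]
    rw [this]
    refine (sum_le_sum hA).trans ?_
    rw [sum_add_distrib, sum_const, nsmul_eq_mul, ← mul_sum, sum_boole]
    apply add_le_add_right
    apply mul_le_mul_of_nonneg_left _ hdpos.le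
    refine le_trans ?_ hbad
    rw [Nat.cast_le]
    apply card_le_card
    unfold dieFinset
    intro A h
    rw [mem_filter, mem_filter] at h
    rw [mem_filter]
    exact ⟨h.1.1, h.2⟩
  have hhalf : (1/2:ℝ)^(n/48) ≤ (199/200)^(n/48) :=
    pow_le_pow_left₀ (by norm_num) (by norm_num) _
  rw [div_le_iff₀ (by positivity)]
  refine htot.trans ?_
  set ρ : ℝ := (199/200)^(n/48)
  have hρ : 0 ≤ ρ := by positivity
  calc _ ≤ d * ((1 / Real.sqrt (M+1)) * d + (n:ℝ)^n * (2^M * ρ)) + d * (17 * (n:ℝ)^n * ρ) := by gcongr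
    _ = (1 / Real.sqrt (M+1)) * (d * d) + (n:ℝ)^n * (d * ((17 + 2^M) * ρ)) := by ring
    _ ≤ (1 / Real.sqrt (M+1)) * (d * d) + (n^3 * d) * (d * ((17 + 2^M) * ρ)) := by gcongr
    _ = _ := by ring

lemma tail_tendsto (C : ℝ) : Filter.Tendsto
    (fun n : ℕ => (n:ℝ)^3 * (C * (199/200)^(n/48))) Filter.atTop (nhds 0) := by
  have h1 : Filter.Tendsto (fun u : ℕ => ((u:ℝ))^3 * (199/200:ℝ)^u) Filter.atTop (nhds 0) :=
    tendsto_pow_const_mul_const_pow_of_abs_lt_one 3 (by rw [abs_of_pos] <;> norm_num)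
  have h2 : Filter.Tendsto (fun n : ℕ => n/48 + 1) Filter.atTop Filter.atTop := by
    refine Filter.tendsto_atTop_atTop.2 fun b => ⟨48*b, fun a ha => ?_⟩
    omega
  have h3 := (h1.comp h2).const_mul (|C| * 48^3 * (200/199))
  rw [mul_zero] at h3
  refine squeeze_zero_norm (fun n => ?_) h3
  simp only [Function.comp]
  rw [Real.norm_eq_abs, abs_mul, abs_mul, abs_of_nonneg (by positivity : (0:ℝ) ≤ (n:ℝ)^3),
    abs_of_nonneg (by positivity : (0:ℝ) ≤ (199/200:ℝ)^(n/48))]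
  have hu : (n:ℝ) ≤ 48 * (n/48 + 1 : ℕ) := by
    have : n ≤ 48 * (n/48 + 1) := by omega
    exact_mod_cast this
  calc _ ≤ (48 * (n/48 + 1 : ℕ) : ℝ)^3 * (|C| * (199/200)^(n/48)) := by gcongr
    _ = _ := by rw [pow_succ (199/200:ℝ) (n/48)]; ring

/-- the probability that two independent uniformly random n-sided dice
(balanced sequences model) tie tends to 0. -/
theorem ties_probability_tendsto_zero :
    Filter.Tendsto
      (fun n : ℕ =>
        (((dieFinset n ×ˢ dieFinset n).filter fun p => ties p.1 p.2).card : ℝ) /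
          ((dieFinset n).card * (dieFinset n).card))
      Filter.atTop (nhds 0) := by
  rw [Metric.tendsto_atTop]
  intro ε hε
  have hM : Filter.Tendsto (fun M : ℕ => 1 / Real.sqrt ((M:ℝ)+1)) Filter.atTop (nhds 0) := by
    simp only [one_div]
    apply Filter.Tendsto.inv_tendsto_atTop
    exact Real.tendsto_sqrt_atTop.comp
      (Filter.tendsto_atTop_add_const_right _ _ tendsto_natCast_atTop_atTop)
  obtain ⟨M, hM⟩ := (hM.eventually (gt_mem_nhds (half_pos hε))).exists
  obtain ⟨N, hN⟩ := Filter.eventually_atTop.1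
    ((tail_tendsto (17 + 2^M)).eventually (gt_mem_nhds (half_pos hε)))
  refine ⟨max N 200, fun n hn => ?_⟩
  have h1 := main_bound n M (le_trans (le_max_right _ _) hn)
  have h2 := hN n (le_trans (le_max_left _ _) hn)
  rw [Real.dist_eq, sub_zero, abs_of_nonneg (by positivity)]
  linarith
end

section
/- Let A, B and C be independent uniformly random n-sided dice in the balanced sequences model. Then the conditional probability that A beats C, given that A beats B and B beats C, tends to 1/2 as n tends to infinity. -/
open Finset

noncomputable def dX (n : ℕ) (j : ℕ) : ℝ := (j : ℝ) - ((n : ℝ) + 1) / 2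

noncomputable def dAvg (n : ℕ) (θ : ℕ → ℝ) : ℂ :=
  (n : ℂ)⁻¹ * ∑ j ∈ Finset.Icc 1 n, Complex.exp ((θ j : ℂ) * Complex.I)

noncomputable def dPhi (n : ℕ) (h : ℕ → ℝ) (s β : ℝ) : ℂ :=
  dAvg n (fun j => s * h j / √n + β * dX n j)

noncomputable def dQ (n : ℕ) (θ : ℕ → ℝ) : ℝ :=
  ((n : ℝ)^2)⁻¹ * ∑ j ∈ Finset.Icc 1 n, ∑ k ∈ Finset.Icc 1 n, 2 * Real.sin ((θ j - θ k) / 2) ^ 2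

lemma dSum_X (n : ℕ) : ∑ j ∈ Finset.Icc 1 n, dX n j = 0 := by
  have h : ∀ m : ℕ, ∑ j ∈ Finset.Icc 1 m, (j : ℝ) = m * (m + 1) / 2 := by
    intro m
    induction m with
    | zero => simp
    | succ k ih => rw [Finset.sum_Icc_succ_top (by omega), ih]; push_cast; ring
  simp only [dX, Finset.sum_sub_distrib, h]
  simp
  ring

lemma dSum_pow (a : ℝ) : ∀ m : ℕ,
    ∑ j ∈ Finset.Icc 1 m, ((j : ℝ) - a) ^ 2 = m * (m + 1) * (2 * m + 1) / 6 - a * m * (m + 1) + m * a ^ 2 := by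
  intro m
  induction m with
  | zero => simp
  | succ k ih => rw [Finset.sum_Icc_succ_top (by omega), ih]; push_cast; ring

lemma dSum_X2 (n : ℕ) : ∑ j ∈ Finset.Icc 1 n, dX n j ^ 2 = n * ((n : ℝ) ^ 2 - 1) / 12 := by
  simp only [dX, dSum_pow]; ring

lemma dX_abs {n j : ℕ} (hj : j ∈ Finset.Icc 1 n) : |dX n j| ≤ n / 2 := by
  rw [Finset.mem_Icc] at hj
  have h1 : (1 : ℝ) ≤ j := by exact_mod_cast hj.1
  have h2 : (j : ℝ) ≤ n := by exact_mod_cast hj.2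
  rw [abs_le]; unfold dX; constructor <;> linarith

lemma dAvg_normSq (n : ℕ) (hn : 0 < n) (θ : ℕ → ℝ) : ‖dAvg n θ‖ ^ 2 = 1 - dQ n θ := by
  have hn' : (n : ℝ) ≠ 0 := by positivity
  have key : ‖∑ j ∈ Finset.Icc 1 n, Complex.exp ((θ j : ℂ) * Complex.I)‖ ^ 2 =
      ∑ j ∈ Finset.Icc 1 n, ∑ k ∈ Finset.Icc 1 n, Real.cos (θ j - θ k) := by
    rw [← Complex.normSq_eq_norm_sq, Complex.normSq_apply, Complex.re_sum, Complex.im_sum]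
    simp only [Complex.exp_ofReal_mul_I_re, Complex.exp_ofReal_mul_I_im]
    rw [Finset.sum_mul_sum, Finset.sum_mul_sum, ← Finset.sum_add_distrib]
    refine Finset.sum_congr rfl fun j _ => ?_
    rw [← Finset.sum_add_distrib]
    refine Finset.sum_congr rfl fun k _ => ?_
    rw [Real.cos_sub]
  have h2 : ∀ x : ℝ, 2 * Real.sin (x / 2) ^ 2 = 1 - Real.cos x := by
    intro x
    have := Real.cos_two_mul (x / 2)
    have h3 := Real.sin_sq_add_cos_sq (x / 2)
    rw [show 2 * (x / 2) = x by ring] at this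
    linarith
  unfold dAvg dQ
  rw [norm_mul, mul_pow, key]
  simp only [h2, Finset.sum_sub_distrib]
  simp
  field_simp
  ring

lemma dQ_nonneg (n : ℕ) (θ : ℕ → ℝ) : 0 ≤ dQ n θ := by unfold dQ; positivity

lemma dQ_add (n : ℕ) (θ η : ℕ → ℝ) : dQ n θ / 2 - dQ n η ≤ dQ n (fun j => η j + θ j) := by
  have h : ∀ a b : ℝ, Real.sin a ^ 2 ≤ 2 * Real.sin (b + a) ^ 2 + 2 * Real.sin b ^ 2 := by
    intro a b
    have e1 : Real.sin a = Real.sin (b + a) * Real.cos b - Real.cos (b + a) * Real.sin b := by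
      rw [← Real.sin_sub]; ring_nf
    have e2 := Real.cos_sq_le_one b
    have e3 := Real.cos_sq_le_one (b + a)
    rw [e1]
    nlinarith [sq_nonneg (Real.sin (b + a) * Real.cos b + Real.cos (b + a) * Real.sin b),
      mul_nonneg (sq_nonneg (Real.sin (b+a))) (sub_nonneg.2 e2), mul_nonneg (sq_nonneg (Real.sin b)) (sub_nonneg.2 e3)]
  have : dQ n θ ≤ 2 * dQ n (fun j => η j + θ j) + 2 * dQ n η := by
    unfold dQ
    have : ∑ j ∈ Finset.Icc 1 n, ∑ k ∈ Finset.Icc 1 n, 2 * Real.sin ((θ j - θ k) / 2) ^ 2 ≤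
        2 * (∑ j ∈ Finset.Icc 1 n, ∑ k ∈ Finset.Icc 1 n, 2 * Real.sin (((η j + θ j) - (η k + θ k)) / 2) ^ 2) +
        2 * ∑ j ∈ Finset.Icc 1 n, ∑ k ∈ Finset.Icc 1 n, 2 * Real.sin ((η j - η k) / 2) ^ 2 := by
      simp only [Finset.mul_sum, ← Finset.sum_add_distrib]
      refine Finset.sum_le_sum fun j _ => Finset.sum_le_sum fun k _ => ?_
      have := h ((θ j - θ k) / 2) ((η j - η k) / 2)
      rw [show (η j - η k) / 2 + (θ j - θ k) / 2 = ((η j + θ j) - (η k + θ k)) / 2 by ring] at this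
      linarith
    calc _ ≤ _ := mul_le_mul_of_nonneg_left this (by positivity)
      _ = _ := by ring
  linarith

lemma dQ_le (n : ℕ) (η : ℕ → ℝ) : dQ n η ≤ 2 / n * ∑ j ∈ Finset.Icc 1 n, η j ^ 2 := by
  rcases Nat.eq_zero_or_pos n with rfl | hn
  · simp [dQ]
  have hn' : (n : ℝ) ≠ 0 := by positivity
  unfold dQ
  have : ∑ j ∈ Finset.Icc 1 n, ∑ k ∈ Finset.Icc 1 n, 2 * Real.sin ((η j - η k) / 2) ^ 2 ≤
      ∑ j ∈ Finset.Icc 1 n, ∑ k ∈ Finset.Icc 1 n, (η j ^ 2 + η k ^ 2) := by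
    refine Finset.sum_le_sum fun j _ => Finset.sum_le_sum fun k _ => ?_
    have := sq_le_sq.2 (show |Real.sin ((η j - η k) / 2)| ≤ |(η j - η k) / 2| from Real.abs_sin_le_abs)
    nlinarith [sq_nonneg (η j + η k)]
  calc _ ≤ _ := mul_le_mul_of_nonneg_left this (by positivity)
    _ = _ := by
      simp only [Finset.sum_add_distrib, Finset.sum_const, Nat.card_Icc, ← Finset.mul_sum]
      simp [← Finset.mul_sum]
      field_simp
      ring

lemma dQ_two (n : ℕ) (θ : ℕ → ℝ) : dQ n (fun j => 2 * θ j) ≤ 4 * dQ n θ := by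
  unfold dQ
  rw [mul_left_comm]
  refine mul_le_mul_of_nonneg_left ?_ (by positivity)
  simp only [Finset.mul_sum]
  refine Finset.sum_le_sum fun j _ => Finset.sum_le_sum fun k _ => ?_
  rw [show (2 * θ j - 2 * θ k) / 2 = 2 * ((θ j - θ k) / 2) by ring, Real.sin_two_mul]
  have e2 := Real.cos_sq_le_one ((θ j - θ k) / 2)
  nlinarith [mul_nonneg (sq_nonneg (Real.sin ((θ j - θ k) / 2))) (sub_nonneg.2 e2)]

lemma dQ_lin_small (n : ℕ) (hn : 2 ≤ n) (β : ℝ) (hβ : |β| ≤ Real.pi / n) :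
    β ^ 2 * n ^ 2 / 40 ≤ dQ n (fun j => β * dX n j) := by
  have hn0 : (2 : ℝ) ≤ n := by exact_mod_cast hn
  have hpi := Real.pi_pos
  have hpi2 : Real.pi ^ 2 < 10 := by nlinarith [Real.pi_lt_d2]
  have h : ∑ j ∈ Finset.Icc 1 n, ∑ k ∈ Finset.Icc 1 n, (β ^ 2 / 5) * (dX n j - dX n k) ^ 2 ≤
      ∑ j ∈ Finset.Icc 1 n, ∑ k ∈ Finset.Icc 1 n, 2 * Real.sin ((β * dX n j - β * dX n k) / 2) ^ 2 := by
    refine Finset.sum_le_sum fun j hj => Finset.sum_le_sum fun k hk => ?_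
    set y := (β * dX n j - β * dX n k) / 2 with hy
    have hy1 : |y| ≤ Real.pi / 2 := by
      have e1 : |dX n j - dX n k| ≤ n := by
        have := abs_sub (dX n j) (dX n k)
        linarith [dX_abs hj, dX_abs hk]
      rw [hy, ← mul_sub, abs_div, abs_mul]
      have : |β| * |dX n j - dX n k| ≤ Real.pi / n * n :=
        mul_le_mul hβ e1 (abs_nonneg _) (by positivity)
      rw [div_mul_cancel₀ _ (by positivity)] at this
      rw [abs_two]; linarith
    have h2 : 2 / Real.pi * |y| ≤ |Real.sin y| := Real.mul_abs_le_abs_sin hy1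
    have h3 : (2 / Real.pi * |y|) ^ 2 ≤ Real.sin y ^ 2 := by
      rw [← sq_abs (Real.sin y)]; exact pow_le_pow_left₀ (by positivity) h2 2
    rw [mul_pow, sq_abs] at h3
    have h4 : (2/5 : ℝ) ≤ (2 / Real.pi) ^ 2 := by
      rw [div_pow, div_le_div_iff₀ (by norm_num) (by positivity)]; linarith
    have h5 := mul_le_mul_of_nonneg_right h4 (sq_nonneg y)
    have h6 : β ^ 2 / 5 * (dX n j - dX n k) ^ 2 = 4 / 5 * y ^ 2 := by rw [hy]; ring
    linarith
  have h1 : ∑ j ∈ Finset.Icc 1 n, ∑ k ∈ Finset.Icc 1 n, (β ^ 2 / 5) * (dX n j - dX n k) ^ 2 =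
      β ^ 2 / 5 * (n ^ 2 * ((n:ℝ) ^ 2 - 1) / 6) := by
    simp only [← Finset.mul_sum, sub_sq, Finset.sum_sub_distrib, Finset.sum_add_distrib, dSum_X2, dSum_X]
    simp [mul_assoc, ← Finset.mul_sum, ← Finset.sum_mul, dSum_X, dSum_X2]
    ring_nf
    simp
  unfold dQ
  rw [h1] at h
  calc _ ≤ ((n : ℝ)^2)⁻¹ * (β ^ 2 / 5 * (n ^ 2 * ((n:ℝ) ^ 2 - 1) / 6)) := by
        field_simp
        nlinarith [mul_nonneg (sq_nonneg β) (show (0:ℝ) ≤ n^2 - 4 by nlinarith)]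
    _ ≤ _ := mul_le_mul_of_nonneg_left h (by positivity)

lemma dAvg_lin (n : ℕ) (hn : 0 < n) (β : ℝ) (h1 : 2 * Real.pi / n ≤ |β|) (h2 : |β| ≤ Real.pi) :
    ‖dAvg n (fun j => β * dX n j)‖ ≤ 1 / 2 := by
  have hn0 : (0 : ℝ) < n := by exact_mod_cast hn
  have hpi := Real.pi_pos
  have hb : 0 < |β| := lt_of_lt_of_le (by positivity) h1
  set z := Complex.exp ((β : ℂ) * Complex.I) with hz
  have hzn : ‖z‖ = 1 := Complex.norm_exp_ofReal_mul_I β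
  have hz1 : 2 / Real.pi * |β| ≤ ‖z - 1‖ := by
    rw [hz, mul_comm (β : ℂ), Complex.norm_exp_I_mul_ofReal_sub_one]
    have := Real.mul_abs_le_abs_sin (x := β / 2) (by rw [abs_div, abs_two]; linarith)
    rw [abs_div, abs_two] at this
    rw [norm_mul, Real.norm_eq_abs, Real.norm_eq_abs, abs_two]
    linarith
  have hz0 : z ≠ 1 := by
    intro h
    rw [h] at hz1
    simp at hz1
    have : 0 < 2 / Real.pi * |β| := by positivity
    linarith
  have hs : ∑ j ∈ Finset.Icc 1 n, Complex.exp (((β * dX n j : ℝ) : ℂ) * Complex.I) =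
      Complex.exp (((β * (1 - ((n:ℝ)+1)/2) : ℝ) : ℂ) * Complex.I) * ((z ^ n - 1) / (z - 1)) := by
    have hi : Finset.Icc 1 n = Finset.Ico (0 + 1) (n + 1) := by ext; simp [Nat.lt_succ_iff]
    rw [← geom_sum_eq hz0, Finset.mul_sum, Finset.range_eq_Ico, hi,
      ← Finset.sum_Ico_add' (fun j : ℕ => Complex.exp (((β * dX n j : ℝ) : ℂ) * Complex.I)) 0 n 1]
    refine Finset.sum_congr rfl fun j _ => ?_
    rw [hz, ← Complex.exp_nat_mul, ← Complex.exp_add]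
    congr 1
    simp only [dX]
    push_cast
    ring
  unfold dAvg
  rw [hs, norm_mul, norm_mul, Complex.norm_exp_ofReal_mul_I, norm_div, one_mul]
  have h3 : ‖z ^ n - 1‖ ≤ 2 := by
    calc _ ≤ ‖z ^ n‖ + ‖(1:ℂ)‖ := norm_sub_le _ _
      _ = 2 := by rw [norm_pow, hzn]; norm_num
  have h4 : 4 / n ≤ ‖z - 1‖ := by
    refine le_trans ?_ hz1
    calc (4:ℝ) / n = 2 / Real.pi * (2 * Real.pi / n) := by field_simp; norm_num
      _ ≤ _ := by gcongr
  have h5 : ‖z ^ n - 1‖ / ‖z - 1‖ ≤ 2 / (4 / n) := by gcongr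
  have : ‖((n:ℂ))⁻¹‖ = (n:ℝ)⁻¹ := by simp
  rw [this]
  calc _ ≤ (n:ℝ)⁻¹ * (2 / (4 / n)) := by gcongr
    _ = 1 / 2 := by field_simp; norm_num

lemma dQ_lin (n : ℕ) (hn : 4 ≤ n) (β : ℝ) (hβ : |β| ≤ Real.pi) :
    min 1 (β ^ 2 * n ^ 2) / 40 ≤ dQ n (fun j => β * dX n j) := by
  have hn0 : (4 : ℝ) ≤ n := by exact_mod_cast hn
  have hpi := Real.pi_pos
  have big : ∀ γ : ℝ, 2 * Real.pi / n ≤ |γ| → |γ| ≤ Real.pi → 3 / 4 ≤ dQ n (fun j => γ * dX n j) := by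
    intro γ h1 h2
    have e1 := dAvg_lin n (by omega) γ h1 h2
    have e2 := dAvg_normSq n (by omega) (fun j => γ * dX n j)
    have e3 := pow_le_pow_left₀ (norm_nonneg _) e1 2
    rw [e2] at e3
    linarith
  rcases le_total |β| (Real.pi / n) with h | h
  · refine le_trans ?_ (dQ_lin_small n (by omega) β h)
    gcongr
    exact min_le_right _ _
  · have hm : min 1 (β ^ 2 * n ^ 2) ≤ 1 := min_le_left _ _
    rcases le_total |β| (2 * Real.pi / n) with h' | h'
    · have e1 := big (2 * β) (by rw [abs_mul, abs_two, mul_div_assoc]; linarith) (by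
        rw [abs_mul, abs_two]
        have : 2 * Real.pi / n ≤ 2 * Real.pi / 4 := by gcongr
        linarith)
      have e2 := dQ_two n (fun j => β * dX n j)
      have e3 : (fun j => 2 * (β * dX n j)) = (fun j => (2 * β) * dX n j) := by ext; ring
      rw [e3] at e2
      linarith
    · have := big β h' hβ
      linarith

lemma dPhi_bound (n : ℕ) (hn : 4 ≤ n) (h : ℕ → ℝ) (hh : ∑ j ∈ Finset.Icc 1 n, h j ^ 2 = n) (s β : ℝ)
    (hβ : |β| ≤ Real.pi) :
    ‖dPhi n h s β ^ n‖ ≤ Real.exp (s ^ 2) * Real.exp (- (n * min 1 (β ^ 2 * n ^ 2) / 160)) := by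
  have hn0 : (4 : ℝ) ≤ n := by exact_mod_cast hn
  have e1 := dQ_add n (fun j => β * dX n j) (fun j => s * h j / √n)
  have e2 := dQ_le n (fun j => s * h j / √n)
  have e3 := dQ_lin n hn β hβ
  have e4 := dAvg_normSq n (by omega) (fun j => s * h j / √n + β * dX n j)
  have e5 : ∑ j ∈ Finset.Icc 1 n, (s * h j / √n) ^ 2 = s ^ 2 := by
    simp only [div_pow, mul_pow, ← Finset.sum_div, ← Finset.mul_sum, hh]
    rw [Real.sq_sqrt (by positivity)]
    field_simp
  rw [e5] at e2
  set q := dQ n (fun j => s * h j / √n + β * dX n j) with hq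
  have e6 : min 1 (β ^ 2 * n ^ 2) / 80 - 2 / n * s ^ 2 ≤ q := by linarith
  have e7 : ‖dPhi n h s β‖ ≤ Real.exp (-q / 2) := by
    refine (sq_le_sq₀ (norm_nonneg _) (Real.exp_pos _).le).1 ?_
    rw [← Real.exp_nat_mul]
    unfold dPhi
    rw [e4]
    have := Real.add_one_le_exp (-q)
    rw [show ((2:ℕ):ℝ) * (-q / 2) = -q by push_cast; ring]
    linarith
  rw [norm_pow, ← Real.exp_add]
  calc _ ≤ Real.exp (-q/2) ^ n := pow_le_pow_left₀ (norm_nonneg _) e7 n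
    _ = Real.exp (n * (-q / 2)) := by rw [Real.exp_nat_mul]
    _ ≤ _ := by
      apply Real.exp_le_exp.2
      have : n * (min 1 (β ^ 2 * n ^ 2) / 80 - 2 / n * s ^ 2) ≤ n * q := by gcongr
      have e8 : n * (min 1 (β ^ 2 * n ^ 2) / 80 - 2 / n * s ^ 2) = n * min 1 (β ^ 2 * n ^ 2) / 80 - 2 * s ^ 2 := by
        field_simp
      linarith


structure dAdm (n : ℕ) (κ : ℝ) (h : ℕ → ℝ) : Prop where
  s0 : ∑ j ∈ Finset.Icc 1 n, h j = 0
  s1 : ∑ j ∈ Finset.Icc 1 n, h j * dX n j = 0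
  s2 : ∑ j ∈ Finset.Icc 1 n, h j ^ 2 = n
  bd : ∀ j ∈ Finset.Icc 1 n, |h j| ≤ κ * √n

lemma dInt_exp (k : ℤ) : ∫ β in (-Real.pi)..Real.pi, Complex.exp (((β * k : ℝ) : ℂ) * Complex.I) =
    if k = 0 then (2 * Real.pi : ℂ) else 0 := by
  split_ifs with h
  · subst h
    simp
    push_cast
    ring
  · have hc : ((k : ℂ) * Complex.I) ≠ 0 := by simp [h]
    have := integral_exp_mul_complex (a := -Real.pi) (b := Real.pi) hc
    have e1 : ∀ β : ℝ, Complex.exp (((β * k : ℝ) : ℂ) * Complex.I) = Complex.exp ((k : ℂ) * Complex.I * β) := by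
      intro β; congr 1; push_cast; ring
    simp only [e1]
    rw [this]
    have e2 : Complex.exp ((k : ℂ) * Complex.I * (Real.pi : ℝ)) = Complex.exp ((k : ℂ) * Complex.I * ((-Real.pi : ℝ) : ℂ)) := by
      rw [Complex.exp_eq_exp_iff_exists_int]
      exact ⟨k, by push_cast; ring⟩
    rw [e2]; simp

lemma dHalf (n : ℕ) : ((n * (n + 1) / 2 : ℕ) : ℝ) = n * (n + 1) / 2 := by
  rw [Nat.cast_div (Nat.even_mul_succ_self n).two_dvd (by norm_num)]; push_cast; ring

lemma dSumX_die (n : ℕ) (B : Fin n → ℕ) :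
    ∑ i, dX n (B i) = (((∑ i, B i : ℕ) : ℤ) - ((n * (n + 1) / 2 : ℕ) : ℤ) : ℤ) := by
  rw [Int.cast_sub, Int.cast_natCast, Int.cast_natCast, dHalf]
  simp [dX, Finset.sum_sub_distrib]
  ring

lemma dFourier (n : ℕ) (hn : 0 < n) (h : ℕ → ℝ) (s : ℝ) :
    (n : ℂ) ^ n * (∫ β in (-Real.pi)..Real.pi, dPhi n h s β ^ n) =
      2 * Real.pi * ∑ B ∈ dieFinset n, Complex.exp (((s * (∑ i, h (B i)) / √n : ℝ) : ℂ) * Complex.I) := by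
  have hn' : (n : ℂ) ≠ 0 := by exact_mod_cast hn.ne'
  have e1 : ∀ β : ℝ, (n : ℂ) ^ n * dPhi n h s β ^ n = ∑ B ∈ Fintype.piFinset fun _ : Fin n => Finset.Icc 1 n,
      Complex.exp (((s * (∑ i, h (B i)) / √n : ℝ) : ℂ) * Complex.I) *
      Complex.exp (((β * (((∑ i, B i : ℕ) : ℤ) - ((n * (n + 1) / 2 : ℕ) : ℤ) : ℤ) : ℝ) : ℂ) * Complex.I) := by
    intro β
    unfold dPhi dAvg
    rw [← mul_pow, ← mul_assoc, mul_inv_cancel₀ hn', one_mul]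
    have := Finset.prod_univ_sum (fun _ : Fin n => Finset.Icc 1 n)
      (fun _ j => Complex.exp (((s * h j / √n + β * dX n j : ℝ) : ℂ) * Complex.I))
    rw [Finset.prod_const, Finset.card_univ, Fintype.card_fin] at this
    rw [this]
    refine Finset.sum_congr rfl fun B _ => ?_
    rw [← Complex.exp_sum, ← Complex.exp_add, ← dSumX_die, ← Finset.sum_mul, ← add_mul, ← Complex.ofReal_add,
      ← Complex.ofReal_sum, Finset.sum_add_distrib, ← Finset.sum_div, ← Finset.mul_sum, ← Finset.mul_sum]
  rw [← intervalIntegral.integral_const_mul]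
  simp only [e1]
  rw [intervalIntegral.integral_finsetSum]
  · simp only [intervalIntegral.integral_const_mul, dInt_exp]
    unfold dieFinset
    rw [Finset.sum_filter, Finset.mul_sum]
    refine Finset.sum_congr rfl fun B _ => ?_
    have : ((((∑ i, B i : ℕ) : ℤ) - ((n * (n + 1) / 2 : ℕ) : ℤ) : ℤ) = 0) ↔ ∑ i, B i = n * (n + 1) / 2 := by
      rw [sub_eq_zero]; norm_cast
    simp only [this]
    split_ifs
    · ring
    · simp
  · intro B _
    apply Continuous.intervalIntegrable
    fun_prop

lemma dExp3 (θ : ℝ) (h : |θ| ≤ 1) :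
    ‖Complex.exp ((θ : ℂ) * Complex.I) - 1 - θ * Complex.I + θ ^ 2 / 2‖ ≤ |θ| ^ 3 := by
  have h1 : ‖(θ : ℂ) * Complex.I‖ = |θ| := by simp
  have := Complex.exp_bound (x := (θ : ℂ) * Complex.I) (by rw [h1]; exact h) (n := 3) (by norm_num)
  rw [h1] at this
  simp only [Finset.sum_range_succ, Finset.sum_range_zero] at this
  have e : Complex.exp ((θ : ℂ) * Complex.I) - 1 - θ * Complex.I + θ ^ 2 / 2 =
    Complex.exp (↑θ * Complex.I) -
        (0 + (↑θ * Complex.I) ^ 0 / ((Nat.factorial 0 : ℕ) : ℂ) + (↑θ * Complex.I) ^ 1 / ((Nat.factorial 1 : ℕ) : ℂ) + (↑θ * Complex.I) ^ 2 / ((Nat.factorial 2 : ℕ) : ℂ)) := by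
    simp [Nat.factorial, mul_pow]
    ring
  rw [e]
  refine this.trans ?_
  have : (0:ℝ) ≤ |θ| ^ 3 := by positivity
  norm_num [Nat.factorial]
  nlinarith

open Filter Topology in
lemma dPointwise (h : ℕ → ℕ → ℝ) (κ : ℕ → ℝ) (hκ : Tendsto κ atTop (𝓝 0))
    (hh : ∀ᶠ n in atTop, dAdm n (κ n) (h n)) (s t : ℝ) :
    Tendsto (fun n : ℕ => dPhi n (h n) s (t / (n * √n)) ^ n) atTop
      (𝓝 (Complex.exp (((-(s ^ 2 + t ^ 2 / 12) / 2 : ℝ) : ℂ)))) := by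
  refine Tendsto.congr (fun n => by rw [add_sub_cancel])
    (Complex.tendsto_one_add_pow_exp_of_tendsto (g := fun n => dPhi n (h n) s (t / (n * √n)) - 1) ?_)
  set θ : ℕ → ℕ → ℝ := fun n j => s * h n j / √n + t / (n * √n) * dX n j with hθ
  set v : ℕ → ℝ := fun n => s ^ 2 + t ^ 2 * (1 - 1 / (n:ℝ) ^ 2) / 12 with hv
  set m : ℕ → ℝ := fun n => |s| * κ n + |t| * (1 / √n) with hm
  have hsq : Tendsto (fun n : ℕ => 1 / √(n:ℝ)) atTop (𝓝 0) := by
    simp only [one_div]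
    exact tendsto_inv_atTop_zero.comp (Real.tendsto_sqrt_atTop.comp tendsto_natCast_atTop_atTop)
  have hmlim : Tendsto m atTop (𝓝 0) := by
    have := (hκ.const_mul |s|).add (hsq.const_mul |t|)
    simpa [hm] using this
  have hvlim : Tendsto v atTop (𝓝 (s ^ 2 + t ^ 2 / 12)) := by
    have : Tendsto (fun n : ℕ => 1 / (n:ℝ) ^ 2) atTop (𝓝 0) := by
      simpa using (tendsto_one_div_atTop_nhds_zero_nat (𝕜 := ℝ)).pow 2
    have := ((((this.const_sub 1).const_mul (t ^ 2)).div_const 12).const_add (s ^ 2))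
    simpa [hv] using this
  have hvc : Tendsto (fun n => (((-(v n) / 2 : ℝ)) : ℂ)) atTop (𝓝 (((-(s ^ 2 + t ^ 2 / 12) / 2 : ℝ) : ℂ))) :=
    (Complex.continuous_ofReal.tendsto _).comp ((hvlim.neg).div_const 2)
  have hdiff : Tendsto (fun n : ℕ => (n : ℂ) * (dPhi n (h n) s (t / (n * √n)) - 1) - (((-(v n) / 2 : ℝ)) : ℂ)) atTop (𝓝 0) := by
    have hb : Tendsto (fun n => m n * v n) atTop (𝓝 0) := by simpa using hmlim.mul hvlim
    refine squeeze_zero_norm' ?_ hb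
    filter_upwards [hh, eventually_ge_atTop 1, hmlim.eventually_le_const (show (0:ℝ) < 1 by norm_num)] with n hA hn hm1
    have hn0 : (0 : ℝ) < n := by exact_mod_cast hn
    have hr : 0 < √(n:ℝ) := Real.sqrt_pos.2 hn0
    have hrr : √(n:ℝ) * √(n:ℝ) = n := Real.mul_self_sqrt hn0.le
    have hr2 : √(n:ℝ) ^ 2 = n := Real.sq_sqrt hn0.le
    have hθm : ∀ j ∈ Finset.Icc 1 n, |θ n j| ≤ m n := by
      intro j hj
      calc |θ n j| ≤ |s * h n j / √n| + |t / (n * √n) * dX n j| := abs_add_le _ _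
        _ = |s| * (|h n j| / √n) + |t| * (|dX n j| / (n * √n)) := by
          rw [abs_div, abs_mul, abs_mul, abs_div, abs_of_pos hr, abs_of_pos (mul_pos hn0 hr)]; ring
        _ ≤ |s| * κ n + |t| * (1 / √n) := by
          have f1 : |h n j| / √n ≤ κ n := by rw [div_le_iff₀ hr]; exact hA.bd j hj
          have f2 : |dX n j| / (n * √n) ≤ 1 / √n := by
            rw [div_le_div_iff₀ (by positivity) hr]
            have := dX_abs hj
            nlinarith
          exact add_le_add (mul_le_mul_of_nonneg_left f1 (abs_nonneg _)) (mul_le_mul_of_nonneg_left f2 (abs_nonneg _))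
    have hθ0 : ∑ j ∈ Finset.Icc 1 n, θ n j = 0 := by
      simp only [hθ, Finset.sum_add_distrib, ← Finset.mul_sum, ← Finset.sum_div, hA.s0, dSum_X]
      simp
    have hθ2 : ∑ j ∈ Finset.Icc 1 n, θ n j ^ 2 = v n := by
      have : ∀ j, θ n j ^ 2 = s ^ 2 / n * h n j ^ 2 + (2 * s * t / (n * n)) * (h n j * dX n j) + t ^ 2 / (n ^ 2 * n) * dX n j ^ 2 := by
        intro j
        simp only [hθ]
        rw [add_sq, div_pow, mul_pow, hr2, mul_pow, div_pow, mul_pow, hr2]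
        have : 2 * (s * h n j / √↑n) * (t / (↑n * √↑n) * dX n j) = 2 * s * t * (h n j * dX n j) / (n * (√↑n * √↑n)) := by
          field_simp
        rw [this, hrr]
        ring
      simp only [this, Finset.sum_add_distrib, ← Finset.mul_sum, hA.s1, hA.s2, dSum_X2, hv]
      field_simp
      ring
    have key : (n : ℂ) * (dPhi n (h n) s (t / (n * √n)) - 1) - (((-(v n) / 2 : ℝ)) : ℂ) =
        ∑ j ∈ Finset.Icc 1 n, (Complex.exp ((θ n j : ℂ) * Complex.I) - 1 - θ n j * Complex.I + (θ n j : ℂ) ^ 2 / 2) := by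
      have c0 : ∑ j ∈ Finset.Icc 1 n, (θ n j : ℂ) = 0 := by exact_mod_cast hθ0
      have c2 : ∑ j ∈ Finset.Icc 1 n, (θ n j : ℂ) ^ 2 = v n := by exact_mod_cast hθ2
      rw [Finset.sum_add_distrib, Finset.sum_sub_distrib, Finset.sum_sub_distrib, ← Finset.sum_mul, c0,
        ← Finset.sum_div, c2]
      have hnc : (n : ℂ) ≠ 0 := by exact_mod_cast hn0.ne'
      unfold dPhi dAvg
      rw [mul_sub, ← mul_assoc, mul_inv_cancel₀ hnc]
      simp [hθ]
      ring
    rw [key, ← hθ2, Finset.mul_sum]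
    refine norm_sum_le_of_le _ fun j hj => ?_
    refine (dExp3 _ ((hθm j hj).trans hm1)).trans ?_
    rw [← sq_abs (θ n j), pow_succ' _ 2]
    exact mul_le_mul_of_nonneg_right (hθm j hj) (by positivity)
  have := hdiff.add hvc
  simpa using this

lemma dDom (n : ℕ) (hn : 4 ≤ n) (h : ℕ → ℝ) (hh : ∑ j ∈ Finset.Icc 1 n, h j ^ 2 = n) (s t : ℝ)
    (ht : |t| ≤ Real.pi * (n * √n)) :
    ‖dPhi n h s (t / (n * √n)) ^ n‖ ≤ Real.exp (s ^ 2) * 300000000 * (1 + t ^ 2)⁻¹ := by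
  have hn0 : (4 : ℝ) ≤ n := by exact_mod_cast hn
  have hr : 0 < √(n:ℝ) := Real.sqrt_pos.2 (by linarith)
  have hr2 : √(n:ℝ) ^ 2 = n := Real.sq_sqrt (by linarith)
  have hN : 0 < (n:ℝ) * √n := by positivity
  have e1 := dPhi_bound n hn h hh s (t / (n * √n)) (by rw [abs_div, abs_of_pos hN, div_le_iff₀ hN]; exact ht)
  refine e1.trans ?_
  rw [mul_assoc]
  refine mul_le_mul_of_nonneg_left ?_ (Real.exp_pos _).le
  have e2 : (n:ℝ) * min 1 ((t / (n * √n)) ^ 2 * n ^ 2) = min (n:ℝ) (t ^ 2) := by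
    rw [mul_min_of_nonneg _ _ (by linarith)]
    rw [div_pow, mul_pow, hr2]
    congr 1
    · ring
    · field_simp
  rw [e2, Real.exp_neg]
  set y := min (n:ℝ) (t ^ 2) / 160 with hy
  have hy0 : 0 ≤ y := by positivity
  have f1 : 1 ≤ Real.exp y := Real.one_le_exp hy0
  have f2 : y ≤ Real.exp y := by linarith [Real.add_one_le_exp y]
  have f3 : y ^ 3 / 6 ≤ Real.exp y := by
    have := Real.pow_div_factorial_le_exp y hy0 3
    norm_num [Nat.factorial] at this
    linarith
  have main : 1 + t ^ 2 ≤ 300000000 * Real.exp y := by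
    rcases le_total (n:ℝ) (t ^ 2) with hc | hc
    · rw [min_eq_left hc] at hy
      have g1 : t ^ 2 ≤ 10 * n ^ 3 := by
        have := pow_le_pow_left₀ (abs_nonneg t) ht 2
        rw [sq_abs, mul_pow, mul_pow, hr2] at this
        have hpi2 : Real.pi ^ 2 < 10 := by nlinarith [Real.pi_lt_d2, Real.pi_pos]
        have : Real.pi ^ 2 * (n ^ 2 * n) ≤ 10 * ((n:ℝ) ^ 2 * n) := by gcongr
        nlinarith
      have g2 : (n:ℝ) = 160 * y := by rw [hy]; ring
      rw [g2, mul_pow] at g1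
      linarith
    · rw [min_eq_right hc] at hy
      have g2 : t ^ 2 = 160 * y := by rw [hy]; ring
      linarith
  rw [inv_eq_one_div, ← div_eq_mul_inv, div_le_div_iff₀ (Real.exp_pos _) (by positivity)]
  linarith

noncomputable def dC0 : ℝ := ∫ t : ℝ, Real.exp (-(t ^ 2 / 12) / 2)

lemma dC0_pos : 0 < dC0 := by
  unfold dC0
  have : ∀ t : ℝ, Real.exp (-(t ^ 2 / 12) / 2) = Real.exp (-(1/24) * t ^ 2) := by
    intro t; ring_nf
  simp only [this]
  rw [integral_gaussian]
  positivity

open Filter Topology MeasureTheory in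
lemma dIntLim (h : ℕ → ℕ → ℝ) (κ : ℕ → ℝ) (hκ : Tendsto κ atTop (𝓝 0))
    (hh : ∀ᶠ n in atTop, dAdm n (κ n) (h n)) (s : ℝ) :
    Tendsto (fun n : ℕ => ((n * √n : ℝ) : ℂ) * ∫ β in (-Real.pi)..Real.pi, dPhi n (h n) s β ^ n) atTop
      (𝓝 (Real.exp (-s ^ 2 / 2) * dC0 : ℝ)) := by
  set F : ℕ → ℝ → ℂ := fun n => (Set.Ioc (-(Real.pi * (n * √n))) (Real.pi * (n * √n))).indicator
    (fun t => dPhi n (h n) s (t / (n * √n)) ^ n) with hF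
  have hcont : ∀ n, Continuous (fun t : ℝ => dPhi n (h n) s t) := by
    intro n; unfold dPhi dAvg; fun_prop
  have e1 : ∀ᶠ n : ℕ in atTop, (∫ t, F n t) = ((n * √n : ℝ) : ℂ) * ∫ β in (-Real.pi)..Real.pi, dPhi n (h n) s β ^ n := by
    filter_upwards [eventually_ge_atTop 1] with n hn
    have hn0 : (0 : ℝ) < n := by exact_mod_cast hn
    have hr : 0 < √(n:ℝ) := Real.sqrt_pos.2 hn0
    have hN : 0 < (n:ℝ) * √n := by positivity
    rw [hF, integral_indicator measurableSet_Ioc, ← intervalIntegral.integral_of_le (by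
      have := Real.pi_pos
      have : 0 < Real.pi * (n * √n) := by positivity
      linarith)]
    rw [intervalIntegral.integral_comp_div (fun β => dPhi n (h n) s β ^ n) hN.ne']
    rw [neg_div, mul_div_cancel_right₀ _ hN.ne']
    simp
  refine Tendsto.congr' e1 ?_
  have e2 : ((Real.exp (-s ^ 2 / 2) * dC0 : ℝ) : ℂ) = ∫ t : ℝ, Complex.exp (((-(s ^ 2 + t ^ 2 / 12) / 2 : ℝ) : ℂ)) := by
    simp only [← Complex.ofReal_exp]
    rw [integral_complex_ofReal, dC0, ← integral_const_mul]
    congr 2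
    ext t
    rw [← Real.exp_add]
    congr 1
    ring
  rw [e2]
  refine tendsto_integral_filter_of_dominated_convergence
    (fun t => Real.exp (s ^ 2) * 300000000 * (1 + t ^ 2)⁻¹) ?_ ?_ ?_ ?_
  · refine Eventually.of_forall fun n => ?_
    refine AEStronglyMeasurable.indicator ?_ measurableSet_Ioc
    apply Continuous.aestronglyMeasurable
    exact ((hcont n).comp (continuous_id.div_const _)).pow n
  · filter_upwards [eventually_ge_atTop 4, hh] with n hn hA
    refine Eventually.of_forall fun t => ?_
    by_cases ht : t ∈ Set.Ioc (-(Real.pi * (n * √n))) (Real.pi * (n * √n))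
    · simp only [hF]
      rw [Set.indicator_of_mem ht]
      exact dDom n hn (h n) hA.s2 s t (abs_le.2 ⟨ht.1.le, ht.2⟩)
    · simp only [hF]
      rw [Set.indicator_of_notMem ht]
      simp
      positivity
  · exact integrable_inv_one_add_sq.const_mul _
  · refine Eventually.of_forall fun t => ?_
    refine Tendsto.congr' ?_ (dPointwise h κ hκ hh s t)
    have : Tendsto (fun n : ℕ => Real.pi * (n * √(n:ℝ))) atTop atTop :=
      (tendsto_natCast_atTop_atTop.atTop_mul_atTop₀ (Real.tendsto_sqrt_atTop.comp tendsto_natCast_atTop_atTop)).const_mul_atTop Real.pi_pos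
    filter_upwards [this.eventually_gt_atTop |t|] with n hn
    simp only [hF]
    rw [Set.indicator_of_mem]
    exact ⟨by linarith [neg_abs_le t], by linarith [le_abs_self t]⟩

open Filter Topology in
lemma dSumLim (h : ℕ → ℕ → ℝ) (κ : ℕ → ℝ) (hκ : Tendsto κ atTop (𝓝 0))
    (hh : ∀ᶠ n in atTop, dAdm n (κ n) (h n)) (s : ℝ) :
    Tendsto (fun n : ℕ => ((2 * Real.pi * (n * √n) / n ^ n : ℝ) : ℂ) *
      ∑ B ∈ dieFinset n, Complex.exp (((s * (∑ i, h n (B i)) / √n : ℝ) : ℂ) * Complex.I)) atTop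
      (𝓝 (Real.exp (-s ^ 2 / 2) * dC0 : ℝ)) := by
  refine Tendsto.congr' ?_ (dIntLim h κ hκ hh s)
  filter_upwards [eventually_ge_atTop 1] with n hn
  have := dFourier n hn (h n) s
  have hn' : (n : ℂ) ^ n ≠ 0 := pow_ne_zero _ (by exact_mod_cast (by omega))
  push_cast at this ⊢
  rw [div_mul_eq_mul_div, eq_div_iff hn']
  linear_combination ((n:ℂ) * ((√n : ℝ) : ℂ)) * this


lemma dPolySum (A0 A1 A2 A3 A4 A5 A6 : ℝ) : ∀ m : ℕ,
    ∑ j ∈ Finset.Icc 1 m, (A6 * (j:ℝ) ^ 6 + A5 * (j:ℝ) ^ 5 + A4 * (j:ℝ) ^ 4 + A3 * (j:ℝ) ^ 3 + A2 * (j:ℝ) ^ 2 + A1 * j + A0) =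
      A6 * (m * (m + 1) * (2 * m + 1) * (3 * m ^ 4 + 6 * m ^ 3 - 3 * m + 1) / 42) +
      A5 * (m ^ 2 * (m + 1) ^ 2 * (2 * m ^ 2 + 2 * m - 1) / 12) +
      A4 * (m * (m + 1) * (2 * m + 1) * (3 * m ^ 2 + 3 * m - 1) / 30) +
      A3 * (m ^ 2 * (m + 1) ^ 2 / 4) + A2 * (m * (m + 1) * (2 * m + 1) / 6) + A1 * (m * (m + 1) / 2) + A0 * m := by
  intro m
  induction m with
  | zero => simp
  | succ k ih => rw [Finset.sum_Icc_succ_top (by omega), ih]; push_cast; ring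

noncomputable def dCa (n : ℕ) : ℝ := (3 * (n:ℝ) ^ 2 - 7) / 20

noncomputable def dCraw (n j : ℕ) : ℝ := dX n j ^ 3 - dCa n * dX n j

noncomputable def dRho (n : ℕ) : ℝ := √(((n:ℝ) ^ 2 - 1) * ((n:ℝ) ^ 2 - 4) * ((n:ℝ) ^ 2 - 9) / 2800)

noncomputable def dCub (n j : ℕ) : ℝ := dCraw n j / dRho n

lemma dCraw_s0 (n : ℕ) : ∑ j ∈ Finset.Icc 1 n, dCraw n j = 0 := by
  set c : ℝ := ((n:ℝ) + 1) / 2 with hc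
  have : ∀ j ∈ Finset.Icc 1 n, dCraw n j = 0 * (j:ℝ) ^ 6 + 0 * (j:ℝ) ^ 5 + 0 * (j:ℝ) ^ 4 + 1 * (j:ℝ) ^ 3 + (-3 * c) * (j:ℝ) ^ 2 + (3 * c ^ 2 - dCa n) * j + (dCa n * c - c ^ 3) := by
    intro j _; unfold dCraw dX; ring
  rw [Finset.sum_congr rfl this, dPolySum, hc, dCa]; ring

lemma dCraw_s1 (n : ℕ) : ∑ j ∈ Finset.Icc 1 n, dCraw n j * dX n j = 0 := by
  set c : ℝ := ((n:ℝ) + 1) / 2 with hc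
  have : ∀ j ∈ Finset.Icc 1 n, dCraw n j * dX n j = 0 * (j:ℝ) ^ 6 + 0 * (j:ℝ) ^ 5 + 1 * (j:ℝ) ^ 4 + (-4 * c) * (j:ℝ) ^ 3 + (6 * c ^ 2 - dCa n) * (j:ℝ) ^ 2 + (-4 * c ^ 3 + 2 * c * dCa n) * j + (c ^ 4 - dCa n * c ^ 2) := by
    intro j _; unfold dCraw dX; ring
  rw [Finset.sum_congr rfl this, dPolySum, hc, dCa]; ring

lemma dCraw_s2 (n : ℕ) : ∑ j ∈ Finset.Icc 1 n, dCraw n j ^ 2 =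
    n * (((n:ℝ) ^ 2 - 1) * ((n:ℝ) ^ 2 - 4) * ((n:ℝ) ^ 2 - 9) / 2800) := by
  set c : ℝ := ((n:ℝ) + 1) / 2 with hc
  set p : ℝ := -3 * c with hp
  set q : ℝ := 3 * c ^ 2 - dCa n with hq
  set r : ℝ := dCa n * c - c ^ 3 with hr
  have : ∀ j ∈ Finset.Icc 1 n, dCraw n j ^ 2 = 1 * (j:ℝ) ^ 6 + (2 * p) * (j:ℝ) ^ 5 + (p ^ 2 + 2 * q) * (j:ℝ) ^ 4 + (2 * r + 2 * p * q) * (j:ℝ) ^ 3 + (q ^ 2 + 2 * p * r) * (j:ℝ) ^ 2 + (2 * q * r) * j + r ^ 2 := by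
    intro j _; unfold dCraw dX; rw [hp, hq, hr]; ring
  rw [Finset.sum_congr rfl this, dPolySum, hp, hq, hr, hc, dCa]; ring

lemma dRho_ge (n : ℕ) (hn : 4 ≤ n) : (n:ℝ) ^ 3 / 100 ≤ dRho n := by
  have hn0 : (4 : ℝ) ≤ n := by exact_mod_cast hn
  unfold dRho
  apply Real.le_sqrt_of_sq_le
  have h1 : (15/16) * (n:ℝ) ^ 2 ≤ (n:ℝ) ^ 2 - 1 := by nlinarith
  have h2 : (3/4) * (n:ℝ) ^ 2 ≤ (n:ℝ) ^ 2 - 4 := by nlinarith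
  have h3 : (7/16) * (n:ℝ) ^ 2 ≤ (n:ℝ) ^ 2 - 9 := by nlinarith
  have h4 : ((15/16) * (n:ℝ) ^ 2) * ((3/4) * (n:ℝ) ^ 2) * ((7/16) * (n:ℝ) ^ 2) ≤ ((n:ℝ) ^ 2 - 1) * ((n:ℝ) ^ 2 - 4) * ((n:ℝ) ^ 2 - 9) := by
    have a1 : 0 ≤ (15/16) * (n:ℝ) ^ 2 := by positivity
    have a2 : 0 ≤ (3/4) * (n:ℝ) ^ 2 := by positivity
    have a3 : 0 ≤ (7/16) * (n:ℝ) ^ 2 := by positivity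
    exact mul_le_mul (mul_le_mul h1 h2 a2 (a1.trans h1)) h3 a3 (mul_nonneg (a1.trans h1) (a2.trans h2))
  have h5 : (0:ℝ) ≤ (n:ℝ) ^ 6 := by positivity
  nlinarith

lemma dCub_adm (n : ℕ) (hn : 4 ≤ n) : dAdm n (100 / √n) (dCub n) := by
  have hn0 : (4 : ℝ) ≤ n := by exact_mod_cast hn
  have hρ := dRho_ge n hn
  have hn3 : 0 < (n:ℝ) ^ 3 := by positivity
  have hρ0 : 0 < dRho n := by linarith [div_pos hn3 (show (0:ℝ) < 100 by norm_num)]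
  have hr : 0 < √(n:ℝ) := Real.sqrt_pos.2 (by linarith)
  refine ⟨?_, ?_, ?_, ?_⟩
  · simp only [dCub, ← Finset.sum_div, dCraw_s0, zero_div]
  · simp only [dCub, div_mul_eq_mul_div, ← Finset.sum_div, dCraw_s1, zero_div]
  · simp only [dCub, div_pow, ← Finset.sum_div, dCraw_s2]
    have : dRho n ^ 2 = ((n:ℝ) ^ 2 - 1) * ((n:ℝ) ^ 2 - 4) * ((n:ℝ) ^ 2 - 9) / 2800 := by
      unfold dRho
      rw [Real.sq_sqrt]
      have h1 : 0 ≤ (n:ℝ) ^ 2 - 1 := by nlinarith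
      have h2 : 0 ≤ (n:ℝ) ^ 2 - 4 := by nlinarith
      have h3 : 0 ≤ (n:ℝ) ^ 2 - 9 := by nlinarith
      positivity
    rw [← this, mul_div_cancel_right₀ _ (by positivity)]
  · intro j hj
    rw [div_mul_cancel₀ _ hr.ne', dCub, abs_div, abs_of_pos hρ0, div_le_iff₀ hρ0]
    have hx := dX_abs hj
    have ha : |dCa n| ≤ 3 * (n:ℝ) ^ 2 / 20 := by
      unfold dCa; rw [abs_le]; constructor <;> nlinarith
    have h2 : dX n j ^ 2 ≤ (n:ℝ) ^ 2 / 4 := by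
      rw [← sq_abs]
      have := pow_le_pow_left₀ (abs_nonneg _) hx 2
      linarith [this, show ((n:ℝ)/2)^2 = (n:ℝ)^2/4 by ring]
    have h3 : |dX n j ^ 2 - dCa n| ≤ (n:ℝ) ^ 2 := by
      have := abs_sub (dX n j ^ 2) (dCa n)
      rw [abs_of_nonneg (sq_nonneg (dX n j))] at this
      nlinarith
    have h1 : |dCraw n j| ≤ (n:ℝ) ^ 3 := by
      have : dCraw n j = dX n j * (dX n j ^ 2 - dCa n) := by unfold dCraw; ring
      rw [this, abs_mul]
      calc _ ≤ (n:ℝ) / 2 * (n:ℝ) ^ 2 := mul_le_mul hx h3 (abs_nonneg _) (by positivity)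
        _ ≤ _ := by nlinarith
    linarith

open MeasureTheory in
noncomputable def dLaw {α : Type*} (D : Finset α) (f : α → ℝ) : Measure ℝ :=
  ∑ B ∈ D, ((D.card : ENNReal))⁻¹ • Measure.dirac (f B)

open MeasureTheory in
lemma dLaw_prob {α : Type*} (D : Finset α) (hD : D.Nonempty) (f : α → ℝ) : IsProbabilityMeasure (dLaw D f) := by
  constructor
  unfold dLaw
  simp only [Measure.coe_finset_sum, Finset.sum_apply, Measure.smul_apply, measure_univ]
  simp
  exact ENNReal.mul_inv_cancel (by simpa using hD.ne_empty) (by simp)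

open MeasureTheory in
lemma dLaw_charFun {α : Type*} (D : Finset α) (f : α → ℝ) (t : ℝ) :
    charFun (dLaw D f) t = (D.card : ℂ)⁻¹ * ∑ B ∈ D, Complex.exp ((t * f B : ℝ) * Complex.I) := by
  rw [charFun_apply_real, dLaw, integral_finsetSum_measure, Finset.mul_sum]
  · refine Finset.sum_congr rfl fun B _ => ?_
    rw [integral_smul_measure, integral_dirac]
    simp
  · intro B hB
    have : D.card ≠ 0 := Finset.card_ne_zero_of_mem hB
    refine Integrable.smul_measure ?_ (by simpa using (Finset.card_ne_zero.1 this).ne_empty)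
    exact integrable_dirac (by simp)

open Classical MeasureTheory in
lemma dLaw_apply {α : Type*} (D : Finset α) (f : α → ℝ) (S : Set ℝ) (hS : MeasurableSet S) :
    (dLaw D f S).toReal = ((D.filter fun B => f B ∈ S).card : ℝ) / D.card := by
  unfold dLaw
  simp only [Measure.coe_finset_sum, Finset.sum_apply, Measure.smul_apply, Measure.dirac_apply' _ hS, smul_eq_mul]
  rw [← Finset.mul_sum]
  simp only [Set.indicator_apply, Pi.one_apply]
  rw [Finset.sum_boole, ENNReal.toReal_mul]
  simp
  ring

lemma dDie_nonempty (n : ℕ) : (dieFinset n).Nonempty := by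
  refine ⟨fun i => i + 1, ?_⟩
  unfold dieFinset
  simp only [Finset.mem_filter, Fintype.mem_piFinset, Finset.mem_Icc]
  refine ⟨fun i => ⟨by omega, by omega⟩, ?_⟩
  rw [Fin.sum_univ_eq_sum_range (fun i => i + 1) n]
  have := Finset.sum_range_id_mul_two (n + 1)
  rw [Finset.sum_range_succ'] at this
  simp only [add_tsub_cancel_right, add_zero] at this
  rw [mul_comm n]
  omega

open Filter Topology in
lemma dCountLim : Tendsto (fun n : ℕ => 2 * Real.pi * (n * √(n:ℝ)) / (n:ℝ) ^ n * ((dieFinset n).card : ℝ)) atTop (𝓝 dC0) := by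
  have hκ : Tendsto (fun n : ℕ => 100 / √(n:ℝ)) atTop (𝓝 0) :=
    tendsto_const_nhds.div_atTop (Real.tendsto_sqrt_atTop.comp tendsto_natCast_atTop_atTop)
  have := dSumLim dCub (fun n => 100 / √n) hκ (by filter_upwards [eventually_ge_atTop 4] with n hn using dCub_adm n hn) 0
  simp at this
  have h2 := (Complex.continuous_re.tendsto _).comp this
  simp only [Complex.ofReal_re] at h2
  refine h2.congr fun n => ?_
  simp only [Function.comp]
  rw [← Complex.ofReal_re (2 * Real.pi * (n * √(n:ℝ)) / (n:ℝ) ^ n * ((dieFinset n).card : ℝ))]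
  push_cast
  rfl

noncomputable def dF {n : ℕ} (h : ℕ → ℝ) (B : Fin n → ℕ) : ℝ := (∑ i, h (B i)) / √n

open Classical in
noncomputable def dPr (n : ℕ) (P : (Fin n → ℕ) → Prop) : ℝ :=
  ((dieFinset n).filter P).card / (dieFinset n).card

open Filter Topology MeasureTheory ProbabilityTheory in
lemma dWeak (h : ℕ → ℕ → ℝ) (κ : ℕ → ℝ) (hκ : Tendsto κ atTop (𝓝 0))
    (hh : ∀ᶠ n in atTop, dAdm n (κ n) (h n)) (S : Set ℝ) (hS : MeasurableSet S)
    (hfr : gaussianReal 0 1 (frontier S) = 0) :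
    Tendsto (fun n : ℕ => dPr n (fun B => dF (h n) B ∈ S)) atTop (𝓝 (gaussianReal 0 1 S).toReal) := by
  let μ : ℕ → ProbabilityMeasure ℝ := fun n => ⟨dLaw (dieFinset n) (dF (h n)), dLaw_prob _ (dDie_nonempty n) _⟩
  let μ0 : ProbabilityMeasure ℝ := ⟨gaussianReal 0 1, inferInstance⟩
  have hlim : Tendsto μ atTop (𝓝 μ0) := by
    apply ProbabilityMeasure.tendsto_of_tendsto_charFun
    intro t
    have e1 := dSumLim h κ hκ hh t
    have e2 : Tendsto (fun n : ℕ => ((2 * Real.pi * (n * √(n:ℝ)) / (n:ℝ) ^ n * ((dieFinset n).card : ℝ) : ℝ) : ℂ)) atTop (𝓝 (dC0 : ℂ)) :=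
      (Complex.continuous_ofReal.tendsto _).comp dCountLim
    have hC : (dC0 : ℂ) ≠ 0 := by exact_mod_cast dC0_pos.ne'
    have e3 := e1.div e2 hC
    have e4 : ((Real.exp (-t ^ 2 / 2) * dC0 : ℝ) : ℂ) / dC0 = charFun (gaussianReal 0 1) t := by
      rw [charFun_gaussianReal]
      push_cast
      rw [mul_div_cancel_right₀ _ hC]
      congr 1
      simp
      ring
    rw [e4] at e3
    refine e3.congr' ?_
    filter_upwards [eventually_ge_atTop 1] with n hn
    have hn0 : (0 : ℝ) < n := by exact_mod_cast hn
    have hr : 0 < √(n:ℝ) := Real.sqrt_pos.2 hn0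
    change _ = charFun (dLaw (dieFinset n) (dF (h n))) t
    rw [dLaw_charFun]
    have hne : (2 * Real.pi * (n * √(n:ℝ)) / (n:ℝ) ^ n) ≠ 0 := by
      have := Real.pi_pos
      positivity
    have hne' : ((2 * Real.pi * (n * √(n:ℝ)) / (n:ℝ) ^ n : ℝ) : ℂ) ≠ 0 := by exact_mod_cast hne
    simp only [Pi.div_apply]
    rw [Complex.ofReal_mul (2 * Real.pi * (n * √(n:ℝ)) / (n:ℝ) ^ n), mul_div_mul_left _ _ hne', div_eq_inv_mul]
    simp only [dF, mul_div_assoc]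
    simp
  have h1 := ProbabilityMeasure.tendsto_measure_of_null_frontier_of_tendsto' hlim (E := S) hfr
  have h2 := (ENNReal.tendsto_toReal (measure_ne_top (gaussianReal 0 1) S)).comp h1
  refine h2.congr fun n => ?_
  exact dLaw_apply _ _ S hS

lemma dAdm.mono {n : ℕ} {κ κ' : ℝ} {h : ℕ → ℝ} (H : dAdm n κ h) (hk : κ ≤ κ') : dAdm n κ' h :=
  ⟨H.s0, H.s1, H.s2, fun j hj => (H.bd j hj).trans (mul_le_mul_of_nonneg_right hk (Real.sqrt_nonneg _))⟩

open Filter Topology MeasureTheory ProbabilityTheory in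
lemma dUnif (κ : ℕ → ℝ) (hκ : Tendsto κ atTop (𝓝 0)) (S : Set ℝ) (hS : MeasurableSet S)
    (hfr : gaussianReal 0 1 (frontier S) = 0) (ε : ℝ) (hε : 0 < ε) :
    ∀ᶠ n in atTop, ∀ h, dAdm n (κ n) h →
      |dPr n (fun B => dF h B ∈ S) - (gaussianReal 0 1 S).toReal| < ε := by
  classical
  by_contra hcon
  rw [not_eventually] at hcon
  let Q : ℕ → (ℕ → ℝ) → Prop := fun n h => dAdm n (κ n) h ∧
      ε ≤ |dPr n (fun B => dF h B ∈ S) - (gaussianReal 0 1 S).toReal|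
  let h : ℕ → ℕ → ℝ := fun n => if hx : ∃ h, Q n h then hx.choose else dCub n
  have hκ0 : Tendsto (fun n : ℕ => 100 / √(n:ℝ)) atTop (𝓝 0) :=
    tendsto_const_nhds.div_atTop (Real.tendsto_sqrt_atTop.comp tendsto_natCast_atTop_atTop)
  have hκ' := hκ.max hκ0
  rw [max_self] at hκ'
  have hA : ∀ᶠ n in atTop, dAdm n (max (κ n) (100 / √(n:ℝ))) (h n) := by
    filter_upwards [eventually_ge_atTop 4] with n hn
    by_cases hx : ∃ h, Q n h
    · simp only [h, dif_pos hx]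
      exact hx.choose_spec.1.mono (le_max_left _ _)
    · simp only [h, dif_neg hx]
      exact (dCub_adm n hn).mono (le_max_right _ _)
  have := dWeak h _ hκ' hA S hS hfr
  have h2 := (Metric.tendsto_nhds.1 this) ε hε
  obtain ⟨n, hn1, hn2⟩ := (hcon.and_eventually h2).exists
  have hx : ∃ h, Q n h := by
    push Not at hn1
    obtain ⟨h', a, b⟩ := hn1
    exact ⟨h', a, b⟩
  have e1 : h n = hx.choose := by simp only [h, dif_pos hx]
  have e2 := hx.choose_spec.2
  rw [← e1] at e2
  rw [Real.dist_eq] at hn2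
  linarith

open MeasureTheory ProbabilityTheory in
lemma dGauss_half : (gaussianReal 0 1 (Set.Iio 0)).toReal = 1 / 2 ∧ (gaussianReal 0 1 (Set.Ioi 0)).toReal = 1 / 2 := by
  have : NullSingletonClass (gaussianReal 0 1) := nullSingletonClass_gaussianReal (by simp)
  have h1 : gaussianReal 0 1 (Set.Ioi 0) = gaussianReal 0 1 (Set.Iio 0) := by
    have := gaussianReal_map_neg (μ := 0) (v := 1)
    rw [neg_zero] at this
    conv_lhs => rw [← this]
    rw [Measure.map_apply measurable_neg measurableSet_Ioi]
    congr 1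
    ext x
    simp
  have h2 : (gaussianReal 0 1 (Set.Iio 0)).toReal + (gaussianReal 0 1 (Set.Ioi 0)).toReal = 1 := by
    have e := prob_add_prob_compl (μ := gaussianReal 0 1) (measurableSet_Iio (a := (0:ℝ)))
    rw [Set.compl_Iio, ← measure_congr (Ioi_ae_eq_Ici (μ := gaussianReal 0 1) (a := 0))] at e
    rw [← ENNReal.toReal_add (measure_ne_top _ _) (measure_ne_top _ _), e]
    simp
  rw [h1] at h2 ⊢
  constructor <;> linarith

open MeasureTheory ProbabilityTheory Filter Topology in
lemma dGauss_small (ε : ℝ) (hε : 0 < ε) : ∃ δ > 0, (gaussianReal 0 1 (Set.Icc (-δ) δ)).toReal < ε := by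
  have : NullSingletonClass (gaussianReal 0 1) := nullSingletonClass_gaussianReal (by simp)
  have := tendsto_measure_Icc_nhdsWithin_right' (gaussianReal 0 1) 0
  rw [measure_singleton] at this
  have h2 := (ENNReal.tendsto_toReal ENNReal.zero_ne_top).comp this
  have h3 := h2.eventually_lt_const (show ENNReal.toReal 0 < ε by simpa using hε)
  obtain ⟨δ, h4, h5⟩ := (h3.and self_mem_nhdsWithin).exists
  exact ⟨δ, h5, by simpa using h4⟩

open MeasureTheory ProbabilityTheory Filter Topology in
lemma dUnifHalf (κ : ℕ → ℝ) (hκ : Tendsto κ atTop (𝓝 0)) (ε : ℝ) (hε : 0 < ε) :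
    ∀ᶠ n in atTop, ∀ h, dAdm n (κ n) h →
      |dPr n (fun B => dF h B < 0) - 1 / 2| < ε ∧ |dPr n (fun B => 0 < dF h B) - 1 / 2| < ε := by
  have : NullSingletonClass (gaussianReal 0 1) := nullSingletonClass_gaussianReal (by simp)
  have h1 := dUnif κ hκ (Set.Iio 0) measurableSet_Iio (by rw [frontier_Iio]; exact measure_singleton _) ε hε
  have h2 := dUnif κ hκ (Set.Ioi 0) measurableSet_Ioi (by rw [frontier_Ioi]; exact measure_singleton _) ε hε
  rw [dGauss_half.1] at h1
  rw [dGauss_half.2] at h2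
  filter_upwards [h1, h2] with n a b h hh
  exact ⟨a h hh, b h hh⟩

open MeasureTheory ProbabilityTheory Filter Topology in
lemma dCubSmall (ε : ℝ) (hε : 0 < ε) : ∃ δ > 0, ∀ᶠ n : ℕ in atTop,
    dPr n (fun B => |dF (dCub n) B| ≤ δ) < ε := by
  have : NullSingletonClass (gaussianReal 0 1) := nullSingletonClass_gaussianReal (by simp)
  obtain ⟨δ, hδ, h⟩ := dGauss_small (ε / 2) (by linarith)
  refine ⟨δ, hδ, ?_⟩
  have hκ0 : Tendsto (fun n : ℕ => 100 / √(n:ℝ)) atTop (𝓝 0) :=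
    tendsto_const_nhds.div_atTop (Real.tendsto_sqrt_atTop.comp tendsto_natCast_atTop_atTop)
  have := dUnif _ hκ0 (Set.Icc (-δ) δ) measurableSet_Icc (by
    rw [frontier_Icc (by linarith)]
    exact (Set.toFinite _).measure_zero _) (ε / 2) (by linarith)
  filter_upwards [this, eventually_ge_atTop 4] with n hn h4
  have := hn _ (dCub_adm n h4)
  simp only [Set.mem_Icc, ← abs_le] at this
  linarith [(abs_lt.1 this).2]


noncomputable def dInd (a j : ℕ) : ℝ := (if a < j then 1 else 0) + (1 / 2) * (if a = j then 1 else 0)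

lemma dInd_bd (a j : ℕ) : 0 ≤ dInd a j ∧ dInd a j ≤ 1 := by
  unfold dInd
  by_cases h1 : a < j
  · have : a ≠ j := by omega
    simp [h1, this]
  · by_cases h2 : a = j
    · simp [h2]; norm_num
    · simp [h1, h2]

lemma dfA_eq {n : ℕ} (A : Fin n → ℕ) (j : ℕ) : fA A j = ∑ i, dInd (A i) j := by
  unfold fA dInd
  rw [Finset.sum_add_distrib, ← Finset.mul_sum, Finset.sum_boole, Finset.sum_boole]

lemma dInd_sum (n : ℕ) (w : ℕ → ℝ) (a : ℕ) (ha : a ∈ Finset.Icc 1 n) :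
    ∑ j ∈ Finset.Icc 1 n, w j * dInd a j =
      ∑ j ∈ Finset.Icc 1 n, w j - ∑ j ∈ Finset.Icc 1 a, w j + w a / 2 := by
  have h1 : ∀ j, w j * dInd a j = w j - (if j ≤ a then w j else 0) + (if a = j then w j / 2 else 0) := by
    intro j
    unfold dInd
    by_cases h1 : a < j
    · have h2 : a ≠ j := by omega
      have h3 : ¬ j ≤ a := by omega
      simp [h1, h2, h3]
    · have h3 : j ≤ a := by omega
      by_cases h2 : a = j
      · simp [h1, h2]; ring
      · simp [h1, h2, h3]
  simp only [h1, Finset.sum_add_distrib, Finset.sum_sub_distrib]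
  rw [Finset.sum_ite_eq, if_pos ha, ← Finset.sum_filter]
  congr 3
  ext j
  simp only [Finset.mem_filter, Finset.mem_Icc] at *
  omega

lemma dInd_sum' (n : ℕ) (j : ℕ) (hj : j ∈ Finset.Icc 1 n) :
    ∑ a ∈ Finset.Icc 1 n, dInd a j = (j : ℝ) - 1 / 2 := by
  have h1 : ∀ a, dInd a j = (if a ≤ j then 1 else 0) - (if j = a then (1/2 : ℝ) else 0) := by
    intro a
    unfold dInd
    by_cases h1 : a < j
    · have h2 : a ≠ j := by omega
      have h2' : j ≠ a := by omega
      have h3 : a ≤ j := by omega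
      simp [h1, h2, h3, h2']
    · by_cases h2 : a = j
      · simp [h2]; norm_num
      · have h3 : ¬ a ≤ j := by omega
        have h2' : j ≠ a := by omega
        simp [h1, h2, h3, h2']
  simp only [h1, Finset.sum_sub_distrib]
  rw [Finset.sum_ite_eq, if_pos hj, ← Finset.sum_filter]
  have : (Finset.Icc 1 n).filter (fun a => a ≤ j) = Finset.Icc 1 j := by
    ext a
    simp only [Finset.mem_filter, Finset.mem_Icc] at *
    omega
  rw [this]
  simp

lemma dDie_mem {n : ℕ} {A : Fin n → ℕ} (hA : A ∈ dieFinset n) :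
    (∀ i, A i ∈ Finset.Icc 1 n) ∧ ∑ i, A i = n * (n + 1) / 2 := by
  unfold dieFinset at hA
  simpa only [Finset.mem_filter, Fintype.mem_piFinset] using hA

lemma dDie_X {n : ℕ} {A : Fin n → ℕ} (hA : A ∈ dieFinset n) : ∑ i, dX n (A i) = 0 := by
  rw [dSumX_die, (dDie_mem hA).2]; simp

lemma dDie_sum {n : ℕ} {A : Fin n → ℕ} (hA : A ∈ dieFinset n) : ∑ i, (A i : ℝ) = n * (n + 1) / 2 := by
  rw [← dHalf, ← (dDie_mem hA).2]; push_cast; rfl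

lemma dg_sum0 {n : ℕ} {A : Fin n → ℕ} (hA : A ∈ dieFinset n) : ∑ j ∈ Finset.Icc 1 n, gA A j = 0 := by
  have h : ∀ m : ℕ, ∑ j ∈ Finset.Icc 1 m, (j : ℝ) = m * (m + 1) / 2 := by
    intro m
    induction m with
    | zero => simp
    | succ k ih => rw [Finset.sum_Icc_succ_top (by omega), ih]; push_cast; ring
  have e1 : ∑ j ∈ Finset.Icc 1 n, fA A j = ∑ i, ((n : ℝ) - A i + 1 / 2) := by
    simp only [dfA_eq]
    rw [Finset.sum_comm]
    refine Finset.sum_congr rfl fun i _ => ?_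
    have := dInd_sum n (fun _ => 1) (A i) ((dDie_mem hA).1 i)
    simpa using this
  simp only [gA, Finset.sum_add_distrib, Finset.sum_sub_distrib, e1, h, dDie_sum hA]
  simp
  ring

noncomputable def dW (n j : ℕ) : ℝ := 12 * dX n j ^ 2 - ((n:ℝ) ^ 2 - 1)

lemma dW_partial (n m : ℕ) : ∑ j ∈ Finset.Icc 1 m, dW n j =
    12 * (m * (m + 1) * (2 * m + 1) / 6 - (((n:ℝ) + 1) / 2) * m * (m + 1) + m * (((n:ℝ) + 1) / 2) ^ 2) - m * ((n:ℝ) ^ 2 - 1) := by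
  simp only [dW, dX, Finset.sum_sub_distrib, ← Finset.mul_sum, dSum_pow]
  simp
  ring

lemma dW_s1 (n : ℕ) : ∑ j ∈ Finset.Icc 1 n, dW n j * dX n j = 0 := by
  set c : ℝ := ((n:ℝ) + 1) / 2 with hc
  have : ∀ j ∈ Finset.Icc 1 n, dW n j * dX n j = 0 * (j:ℝ) ^ 6 + 0 * (j:ℝ) ^ 5 + 0 * (j:ℝ) ^ 4 + 12 * (j:ℝ) ^ 3 + (-36 * c) * (j:ℝ) ^ 2 + (36 * c ^ 2 - ((n:ℝ) ^ 2 - 1)) * j + (((n:ℝ) ^ 2 - 1) * c - 12 * c ^ 3) := by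
    intro j _; unfold dW dX; ring
  rw [Finset.sum_congr rfl this, dPolySum, hc]; ring

lemma dW_s0 (n : ℕ) : ∑ j ∈ Finset.Icc 1 n, dW n j = 0 := by
  rw [dW_partial]; ring

lemma dW_g {n : ℕ} {A : Fin n → ℕ} (hA : A ∈ dieFinset n) :
    ∑ j ∈ Finset.Icc 1 n, dW n j * gA A j = -4 * ∑ i, dX n (A i) ^ 3 := by
  have e1 : ∑ j ∈ Finset.Icc 1 n, dW n j * fA A j = ∑ i, (((n:ℝ) ^ 2 - 3) * dX n (A i) - 4 * dX n (A i) ^ 3) := by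
    simp only [dfA_eq, Finset.mul_sum]
    rw [Finset.sum_comm]
    refine Finset.sum_congr rfl fun i _ => ?_
    rw [dInd_sum n (dW n) (A i) ((dDie_mem hA).1 i), dW_s0, dW_partial]
    unfold dW dX
    ring
  have e2 : ∀ j, dW n j * gA A j = dW n j * fA A j - dW n j * dX n j - (n / 2 : ℝ) * dW n j := by
    intro j; unfold gA dX; ring
  simp only [e2, Finset.sum_sub_distrib, ← Finset.mul_sum, dW_s1, dW_s0, e1, dDie_X hA]
  ring

lemma dW_abs {n j : ℕ} (hj : j ∈ Finset.Icc 1 n) : dW n j ^ 2 ≤ 4 * (n:ℝ) ^ 4 := by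
  have hx := dX_abs hj
  have hn : (1:ℝ) ≤ n := by
    rw [Finset.mem_Icc] at hj
    exact_mod_cast hj.1.trans hj.2
  have h2 : dX n j ^ 2 ≤ (n:ℝ) ^ 2 / 4 := by
    rw [← sq_abs]
    have := pow_le_pow_left₀ (abs_nonneg _) hx 2
    linarith [this, show ((n:ℝ)/2)^2 = (n:ℝ)^2/4 by ring]
  have h0 := sq_nonneg (dX n j)
  have : |dW n j| ≤ 2 * (n:ℝ) ^ 2 + 1 - 1 := by
    by_cases hn1 : n = 1
    · subst hn1
      rw [Finset.mem_Icc] at hj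
      have : j = 1 := by omega
      subst this
      unfold dW dX; norm_num
    · unfold dW
      -- n ≥ 2, use the sharper bound on x
      have hj' := Finset.mem_Icc.1 hj
      have a1 : (1 : ℝ) ≤ j := by exact_mod_cast hj'.1
      have a2 : (j : ℝ) ≤ n := by exact_mod_cast hj'.2
      have h3 : |dX n j| ≤ ((n:ℝ) - 1) / 2 := by
        rw [abs_le]; unfold dX; constructor <;> linarith
      have h4 : dX n j ^ 2 ≤ ((n:ℝ) - 1) ^ 2 / 4 := by
        rw [← sq_abs]
        have := pow_le_pow_left₀ (abs_nonneg _) h3 2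
        linarith [this, show (((n:ℝ) - 1)/2)^2 = ((n:ℝ) - 1)^2/4 by ring]
      rw [abs_le]; constructor <;> nlinarith
  rw [← sq_abs]
  have := pow_le_pow_left₀ (abs_nonneg _) this 2
  nlinarith

lemma dBeats_sum {n : ℕ} (A B : Fin n → ℕ) (hB : B ∈ dieFinset n) :
    ∑ i, gA A (B i) =
      (((Finset.univ : Finset (Fin n × Fin n)).filter fun p => A p.1 < B p.2).card -
        ((Finset.univ : Finset (Fin n × Fin n)).filter fun p => B p.2 < A p.1).card : ℝ) / 2 := by
  have e1 : ∀ a b : ℕ, dInd a b = 1 / 2 + ((if a < b then 1 else 0) - (if b < a then 1 else 0)) / 2 := by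
    intro a b
    unfold dInd
    rcases lt_trichotomy a b with h | h | h
    · have h2 : ¬ b < a := by omega
      have h3 : a ≠ b := by omega
      simp [h, h2, h3]; norm_num
    · simp [h]
    · have h2 : ¬ a < b := by omega
      have h3 : a ≠ b := by omega
      simp [h, h2, h3]; norm_num
  have e2 : ∑ i, fA A (B i) = (n:ℝ) ^ 2 / 2 + (((Finset.univ : Finset (Fin n × Fin n)).filter fun p => A p.1 < B p.2).card -
        ((Finset.univ : Finset (Fin n × Fin n)).filter fun p => B p.2 < A p.1).card : ℝ) / 2 := by
    rw [← Finset.sum_boole, ← Finset.sum_boole, Fintype.sum_prod_type_right, Fintype.sum_prod_type_right]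
    simp only [dfA_eq, e1, Finset.sum_add_distrib, ← Finset.sum_div, Finset.sum_sub_distrib]
    simp
    ring
  simp only [gA, Finset.sum_add_distrib, Finset.sum_sub_distrib, e2, dDie_sum hB]
  simp
  ring

lemma dBeats_iff {n : ℕ} (A B : Fin n → ℕ) (hB : B ∈ dieFinset n) :
    (beats A B ↔ ∑ i, gA A (B i) < 0) ∧ (beats B A ↔ 0 < ∑ i, gA A (B i)) := by
  rw [dBeats_sum A B hB]
  have hsw : ∀ P : ℕ → ℕ → Prop, ∀ _ : DecidableRel P, ((Finset.univ : Finset (Fin n × Fin n)).filter fun p => P (A p.2) (B p.1)).card =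
      ((Finset.univ : Finset (Fin n × Fin n)).filter fun p => P (A p.1) (B p.2)).card := by
    intro P _
    refine Finset.card_bij (fun p _ => (p.2, p.1)) ?_ ?_ ?_
    · intro p hp; simpa using hp
    · rintro ⟨a, b⟩ _ ⟨c, d⟩ _ h; simp at h ⊢; tauto
    · rintro ⟨a, b⟩ h; exact ⟨(b, a), by simpa using h, rfl⟩
  constructor
  · unfold beats
    rw [gt_iff_lt, ← Nat.cast_lt (α := ℝ)]
    constructor <;> intro h <;> linarith
  · unfold beats
    have h1 := hsw (fun a b => a < b) inferInstance
    have h2 := hsw (fun a b => b < a) inferInstance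
    rw [gt_iff_lt, ← Nat.cast_lt (α := ℝ), h1, h2]
    constructor <;> intro h <;> linarith

/-- residual of the profile of A -/
noncomputable def dB {n : ℕ} (A : Fin n → ℕ) : ℝ :=
  (∑ j ∈ Finset.Icc 1 n, gA A j * dX n j) / (n * ((n : ℝ) ^ 2 - 1) / 12)

noncomputable def dRes {n : ℕ} (A : Fin n → ℕ) (j : ℕ) : ℝ := gA A j - dB A * dX n j

noncomputable def dSig {n : ℕ} (A : Fin n → ℕ) : ℝ := √((∑ j ∈ Finset.Icc 1 n, dRes A j ^ 2) / n)

lemma dRes_adm {n : ℕ} (hn : 4 ≤ n) {A : Fin n → ℕ} (hA : A ∈ dieFinset n) (δ : ℝ) (hδ : 0 < δ)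
    (hg : ∀ j ∈ Finset.Icc 1 n, |gA A j| ≤ √(√n) ^ 3) (hc : δ < |dF (dCub n) A|) :
    0 < dSig A ∧ dAdm n (250 / (δ * √(√n))) (fun j => dRes A j / dSig A) := by
  have hn0 : (4 : ℝ) ≤ n := by exact_mod_cast hn
  have hr : 0 < √(n:ℝ) := Real.sqrt_pos.2 (by linarith)
  have hr2 : √(n:ℝ) ^ 2 = n := Real.sq_sqrt (by linarith)
  have hu : 0 < √(√(n:ℝ)) := Real.sqrt_pos.2 hr
  have hu2 : √(√(n:ℝ)) ^ 2 = √n := Real.sq_sqrt hr.le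
  have hn21 : 0 < (n:ℝ) ^ 2 - 1 := by nlinarith
  have hρ := dRho_ge n hn
  have hn3 : 0 < (n:ℝ) ^ 3 := by positivity
  have hρ0 : 0 < dRho n := by linarith [div_pos hn3 (show (0:ℝ) < 100 by norm_num)]
  have s0 : ∑ j ∈ Finset.Icc 1 n, dRes A j = 0 := by
    simp only [dRes, Finset.sum_sub_distrib, ← Finset.mul_sum, dg_sum0 hA, dSum_X]; ring
  have s1 : ∑ j ∈ Finset.Icc 1 n, dRes A j * dX n j = 0 := by
    have : ∀ j, dRes A j * dX n j = gA A j * dX n j - dB A * dX n j ^ 2 := by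
      intro j; unfold dRes; ring
    simp only [this, Finset.sum_sub_distrib, ← Finset.mul_sum, dSum_X2, dB]
    field_simp
    ring
  have sw : ∑ j ∈ Finset.Icc 1 n, dW n j * dRes A j = -4 * (dRho n * (√n * dF (dCub n) A)) := by
    have : ∀ j, dW n j * dRes A j = dW n j * gA A j - dB A * (dW n j * dX n j) := by
      intro j; unfold dRes; ring
    simp only [this, Finset.sum_sub_distrib, ← Finset.mul_sum, dW_s1, dW_g hA]
    have e : dRho n * (√n * dF (dCub n) A) = ∑ i, dX n (A i) ^ 3 := by
      unfold dF dCub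
      rw [← Finset.sum_div]
      have : ∑ i, dCraw n (A i) = ∑ i, dX n (A i) ^ 3 := by
        simp only [dCraw, Finset.sum_sub_distrib, ← Finset.mul_sum, dDie_X hA]; ring
      rw [this]
      field_simp
    rw [e]; ring
  have cs := Finset.sum_mul_sq_le_sq_mul_sq (Finset.Icc 1 n) (dW n) (dRes A)
  have hw : ∑ j ∈ Finset.Icc 1 n, dW n j ^ 2 ≤ n * (4 * (n:ℝ) ^ 4) := by
    calc _ ≤ ∑ j ∈ Finset.Icc 1 n, 4 * (n:ℝ) ^ 4 := Finset.sum_le_sum fun j hj => dW_abs hj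
      _ = _ := by simp
  set R := ∑ j ∈ Finset.Icc 1 n, dRes A j ^ 2 with hR
  have hR0 : 0 ≤ R := Finset.sum_nonneg fun j _ => sq_nonneg _
  have hRge : δ ^ 2 * n ^ 2 / 2500 ≤ R := by
    rw [sw] at cs
    have c1 : (-4 * (dRho n * (√n * dF (dCub n) A))) ^ 2 = 16 * dRho n ^ 2 * n * |dF (dCub n) A| ^ 2 := by
      rw [sq_abs]
      calc _ = 16 * dRho n ^ 2 * (√(n:ℝ) ^ 2) * dF (dCub n) A ^ 2 := by ring
        _ = _ := by rw [hr2]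
    rw [c1] at cs
    have c2 : 16 * ((n:ℝ) ^ 3 / 100) ^ 2 * n * δ ^ 2 ≤ 16 * dRho n ^ 2 * n * |dF (dCub n) A| ^ 2 := by
      gcongr
    have c3 := c2.trans (cs.trans (mul_le_mul_of_nonneg_right hw hR0))
    have c4 : (n:ℝ) ^ 5 * (δ ^ 2 * n ^ 2 / 2500) ≤ (n:ℝ) ^ 5 * R := by nlinarith
    exact le_of_mul_le_mul_left c4 (by positivity)
  have hσ : δ * √n / 50 ≤ dSig A := by
    unfold dSig
    apply Real.le_sqrt_of_sq_le
    rw [← hR, le_div_iff₀ (by linarith), div_pow, mul_pow, hr2]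
    linarith
  have hσ0 : 0 < dSig A := lt_of_lt_of_le (by positivity) hσ
  have hσ2 : dSig A ^ 2 = R / n := by
    unfold dSig; rw [Real.sq_sqrt (by positivity)]
  have hRpos : 0 < R := lt_of_lt_of_le (by positivity) hRge
  refine ⟨hσ0, ?_, ?_, ?_, ?_⟩
  · rw [← Finset.sum_div, s0, zero_div]
  · simp only [div_mul_eq_mul_div, ← Finset.sum_div, s1, zero_div]
  · simp only [div_pow, ← Finset.sum_div]
    rw [← hR, hσ2]
    field_simp
  · intro j hj
    set G := √(√(n:ℝ)) ^ 3 with hG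
    have hG0 : 0 < G := by positivity
    have hb : |dB A| ≤ G * (n * (n / 2)) / (n * ((n : ℝ) ^ 2 - 1) / 12) := by
      unfold dB
      rw [abs_div, abs_of_pos (show 0 < n * ((n : ℝ) ^ 2 - 1) / 12 by positivity)]
      gcongr
      calc |∑ j ∈ Finset.Icc 1 n, gA A j * dX n j| ≤ ∑ j ∈ Finset.Icc 1 n, |gA A j * dX n j| := Finset.abs_sum_le_sum_abs _ _
        _ ≤ ∑ j ∈ Finset.Icc 1 n, G * (n / 2) := by
          refine Finset.sum_le_sum fun k hk => ?_
          rw [abs_mul]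
          exact mul_le_mul (hg k hk) (dX_abs hk) (abs_nonneg _) hG0.le
        _ = _ := by simp; ring
    have hbx : |dB A * dX n j| ≤ 4 * G := by
      rw [abs_mul]
      calc _ ≤ G * (n * (n / 2)) / (n * ((n : ℝ) ^ 2 - 1) / 12) * (n / 2) :=
            mul_le_mul hb (dX_abs hj) (abs_nonneg _) (by positivity)
        _ ≤ 4 * G := by
          rw [div_mul_eq_mul_div, div_le_iff₀ (by positivity)]
          have : 0 ≤ G * n * ((n:ℝ) ^ 2 - 4) := by
            have : 0 ≤ (n:ℝ) ^ 2 - 4 := by nlinarith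
            positivity
          nlinarith
    have hres : |dRes A j| ≤ 5 * G := by
      unfold dRes
      have := abs_sub (gA A j) (dB A * dX n j)
      linarith [hg j hj]
    rw [abs_div, abs_of_pos hσ0, div_le_iff₀ hσ0]
    refine hres.trans ?_
    calc 5 * G = 250 / (δ * √√(n:ℝ)) * √n * (δ * √n / 50) := by
          have e1 : 250 / (δ * √√(n:ℝ)) * √n * (δ * √n / 50) = 5 * (√n) ^ 2 / √√(n:ℝ) := by
            field_simp; norm_num
          rw [e1, eq_div_iff hu.ne', hG]
          calc 5 * √√(n:ℝ) ^ 3 * √√(n:ℝ) = 5 * (√√(n:ℝ) ^ 2) ^ 2 := by ring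
            _ = _ := by rw [hu2]
      _ ≤ _ := mul_le_mul_of_nonneg_left hσ (by positivity)

lemma dRes_F {n : ℕ} (A : Fin n → ℕ) (B : Fin n → ℕ) (hB : B ∈ dieFinset n) :
    dF (fun j => dRes A j / dSig A) B = (∑ i, gA A (B i)) / (dSig A * √n) := by
  unfold dF
  rw [← Finset.sum_div, div_div]
  congr 1
  simp only [dRes, Finset.sum_sub_distrib, ← Finset.mul_sum, dDie_X hB]
  ring

lemma dPr_congr {n : ℕ} {P Q : (Fin n → ℕ) → Prop} (h : ∀ B ∈ dieFinset n, (P B ↔ Q B)) : dPr n P = dPr n Q := by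
  classical
  unfold dPr
  congr 2
  exact congrArg _ (Finset.filter_congr h)

lemma dPr_res {n : ℕ} (hn : 4 ≤ n) (A : Fin n → ℕ) (hs : 0 < dSig A) :
    dPr n (fun B => beats A B) = dPr n (fun B => dF (fun j => dRes A j / dSig A) B < 0) ∧
    dPr n (fun B => beats B A) = dPr n (fun B => 0 < dF (fun j => dRes A j / dSig A) B) := by
  have hn0 : (4 : ℝ) ≤ n := by exact_mod_cast hn
  have hr : 0 < √(n:ℝ) := Real.sqrt_pos.2 (by linarith)
  have hp : 0 < dSig A * √n := by positivity
  constructor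
  · refine dPr_congr fun B hB => ?_
    rw [dRes_F A B hB, (dBeats_iff A B hB).1, div_lt_iff₀ hp, zero_mul]
  · refine dPr_congr fun B hB => ?_
    rw [dRes_F A B hB, (dBeats_iff A B hB).2, lt_div_iff₀ hp, zero_mul]


lemma dExp_le {z : ℝ} (hz : |z| ≤ 1) : Real.exp z ≤ 1 + z + z ^ 2 := by
  have := Real.abs_exp_sub_one_sub_id_le hz
  linarith [(abs_le.1 this).2]

open Classical in
lemma dChern {n : ℕ} (hn : 1 ≤ n) (y : ℕ → ℝ) (h0 : ∑ a ∈ Finset.Icc 1 n, y a = 0)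
    (hy : ∀ a ∈ Finset.Icc 1 n, |y a| ≤ 1) :
    (((Fintype.piFinset fun _ : Fin n => Finset.Icc 1 n).filter
      fun A => √(√(n:ℝ)) ^ 3 < ∑ i, y (A i)).card : ℝ) ≤ (n:ℝ) ^ n * Real.exp (-(√n / 4)) := by
  have hn0 : (1 : ℝ) ≤ n := by exact_mod_cast hn
  have hr : 1 ≤ √(n:ℝ) := by rw [Real.one_le_sqrt]; exact hn0
  have hr2 : √(n:ℝ) ^ 2 = n := Real.sq_sqrt (by linarith)
  have hu : 1 ≤ √(√(n:ℝ)) := by rw [Real.one_le_sqrt]; exact hr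
  have hu2 : √(√(n:ℝ)) ^ 2 = √n := Real.sq_sqrt (by linarith)
  set u := √(√(n:ℝ)) with hud
  have hu4 : (n:ℝ) = u ^ 4 := by rw [← hr2, ← hu2]; ring
  set l : ℝ := 1 / (2 * u) with hl
  have hl0 : 0 < l := by positivity
  have hl1 : l ≤ 1 := by rw [hl, div_le_one (by positivity)]; linarith
  have hlu : l * u = 1 / 2 := by rw [hl]; field_simp
  have hS : ∑ a ∈ Finset.Icc 1 n, Real.exp (l * y a) ≤ n * Real.exp (l ^ 2) := by
    calc _ ≤ ∑ a ∈ Finset.Icc 1 n, (1 + l * y a + l ^ 2) := by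
          refine Finset.sum_le_sum fun a ha => ?_
          have h1 := hy a ha
          have h2 : |l * y a| ≤ 1 := by
            rw [abs_mul, abs_of_pos hl0]
            exact mul_le_one₀ hl1 (abs_nonneg _) h1
          refine (dExp_le h2).trans ?_
          have : y a ^ 2 ≤ 1 := by rw [sq_le_one_iff_abs_le_one]; exact h1
          have := mul_le_mul_of_nonneg_left this (sq_nonneg l)
          nlinarith
      _ = n * (1 + l ^ 2) := by
          simp only [Finset.sum_add_distrib, ← Finset.mul_sum, h0]
          simp; ring
      _ ≤ _ := by
          gcongr
          linarith [Real.add_one_le_exp (l ^ 2)]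
  have hP : ∑ A ∈ (Fintype.piFinset fun _ : Fin n => Finset.Icc 1 n), Real.exp (l * ∑ i, y (A i)) =
      (∑ a ∈ Finset.Icc 1 n, Real.exp (l * y a)) ^ n := by
    have := Finset.prod_univ_sum (fun _ : Fin n => Finset.Icc 1 n) (fun _ a => Real.exp (l * y a))
    simp only [Finset.prod_const, Finset.card_univ, Fintype.card_fin] at this
    rw [this]
    refine Finset.sum_congr rfl fun A _ => ?_
    rw [Finset.mul_sum, Real.exp_sum]
  set Bd := (Fintype.piFinset fun _ : Fin n => Finset.Icc 1 n).filter
      fun A => u ^ 3 < ∑ i, y (A i) with hBd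
  have hM : (Bd.card : ℝ) * Real.exp (l * u ^ 3) ≤ (n * Real.exp (l ^ 2)) ^ n := by
    calc (Bd.card : ℝ) * Real.exp (l * u ^ 3) = ∑ A ∈ Bd, Real.exp (l * u ^ 3) := by simp
      _ ≤ ∑ A ∈ Bd, Real.exp (l * ∑ i, y (A i)) := by
          refine Finset.sum_le_sum fun A hA => ?_
          have := (Finset.mem_filter.1 hA).2
          gcongr
      _ ≤ ∑ A ∈ (Fintype.piFinset fun _ : Fin n => Finset.Icc 1 n), Real.exp (l * ∑ i, y (A i)) :=
          Finset.sum_le_sum_of_subset_of_nonneg (Finset.filter_subset _ _) fun _ _ _ => (Real.exp_pos _).le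
      _ = _ := hP
      _ ≤ _ := by
          exact pow_le_pow_left₀ (Finset.sum_nonneg fun _ _ => (Real.exp_pos _).le) hS n
  have e1 : (n * Real.exp (l ^ 2)) ^ n = (n:ℝ) ^ n * Real.exp (√n / 4) := by
    rw [mul_pow, ← Real.exp_nat_mul]
    congr 2
    rw [← hu2]
    calc (n:ℝ) * l ^ 2 = u ^ 4 * l ^ 2 := by rw [← hu4]
      _ = (l * u) ^ 2 * u ^ 2 := by ring
      _ = _ := by rw [hlu]; ring
  have e2 : l * u ^ 3 = √n / 2 := by
    rw [← hu2]
    calc l * u ^ 3 = (l * u) * u ^ 2 := by ring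
      _ = _ := by rw [hlu]; ring
  rw [e1, e2] at hM
  rw [← le_div_iff₀ (Real.exp_pos _)] at hM
  refine hM.trans (le_of_eq ?_)
  rw [mul_div_assoc, ← Real.exp_sub]
  congr 2; ring

lemma dg_eq {n : ℕ} (hn : 1 ≤ n) (A : Fin n → ℕ) (j : ℕ) :
    gA A j = ∑ i, (dInd (A i) j - ((j:ℝ) - 1 / 2) / n) := by
  have : (n:ℝ) ≠ 0 := by positivity
  rw [Finset.sum_sub_distrib, ← dfA_eq]
  simp [gA]
  field_simp
  ring

open Classical in
lemma dBadCard {n : ℕ} (hn : 1 ≤ n) :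
    (((dieFinset n).filter (fun A => ∃ j ∈ Finset.Icc 1 n, √(√(n:ℝ)) ^ 3 < |gA A j|)).card : ℝ) ≤
      2 * n * ((n:ℝ) ^ n * Real.exp (-(√n / 4))) := by
  have hn0 : (1 : ℝ) ≤ n := by exact_mod_cast hn
  let y : ℕ → ℕ → ℝ := fun j a => dInd a j - ((j:ℝ) - 1 / 2) / n
  have hy0 : ∀ j ∈ Finset.Icc 1 n, ∑ a ∈ Finset.Icc 1 n, y j a = 0 := by
    intro j hj
    simp only [y, Finset.sum_sub_distrib, dInd_sum' n j hj]
    simp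
    field_simp
    ring
  have hy1 : ∀ j ∈ Finset.Icc 1 n, ∀ a ∈ Finset.Icc 1 n, |y j a| ≤ 1 := by
    intro j hj a _
    have hj' := Finset.mem_Icc.1 hj
    have a1 : (1 : ℝ) ≤ j := by exact_mod_cast hj'.1
    have a2 : (j : ℝ) ≤ n := by exact_mod_cast hj'.2
    have b1 : 0 ≤ ((j:ℝ) - 1 / 2) / n := div_nonneg (by linarith) (by linarith)
    have b2 : ((j:ℝ) - 1 / 2) / n ≤ 1 := by rw [div_le_one (by linarith)]; linarith
    have := dInd_bd a j
    simp only [y]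
    rw [abs_le]; constructor <;> linarith [this.1, this.2]
  let S : (ℕ → ℝ) → Finset (Fin n → ℕ) := fun y => (Fintype.piFinset fun _ : Fin n => Finset.Icc 1 n).filter
      fun A => √(√(n:ℝ)) ^ 3 < ∑ i, y (A i)
  have hsub : (dieFinset n).filter (fun A => ∃ j ∈ Finset.Icc 1 n, √(√(n:ℝ)) ^ 3 < |gA A j|) ⊆
      (Finset.Icc 1 n).biUnion (fun j => S (y j) ∪ S (fun a => - y j a)) := by
    intro A hA
    obtain ⟨hA, j, hj, h⟩ := Finset.mem_filter.1 hA
    have hA' : A ∈ Fintype.piFinset fun _ : Fin n => Finset.Icc 1 n := (Finset.mem_filter.1 hA).1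
    rw [Finset.mem_biUnion]
    refine ⟨j, hj, ?_⟩
    rw [dg_eq hn] at h
    rw [Finset.mem_union]
    rcases lt_abs.1 h with h | h
    · left; exact Finset.mem_filter.2 ⟨hA', h⟩
    · right; refine Finset.mem_filter.2 ⟨hA', ?_⟩
      simpa only [Finset.sum_neg_distrib, y] using h
  have hc := (Finset.card_le_card hsub).trans Finset.card_biUnion_le
  calc _ ≤ ((∑ j ∈ Finset.Icc 1 n, (S (y j) ∪ S (fun a => - y j a)).card : ℕ) : ℝ) := by exact_mod_cast hc
    _ = ∑ j ∈ Finset.Icc 1 n, ((S (y j) ∪ S (fun a => - y j a)).card : ℝ) := by push_cast; rfl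
    _ ≤ ∑ j ∈ Finset.Icc 1 n, 2 * ((n:ℝ) ^ n * Real.exp (-(√n / 4))) := by
        refine Finset.sum_le_sum fun j hj => ?_
        have h1 := dChern hn (y j) (hy0 j hj) (hy1 j hj)
        have h2 := dChern hn (fun a => - y j a) (by simp [hy0 j hj]) (fun a ha => by simpa using hy1 j hj a ha)
        have h3 : ((S (y j) ∪ S (fun a => - y j a)).card : ℝ) ≤ (S (y j)).card + (S (fun a => - y j a)).card := by
          exact_mod_cast Finset.card_union_le _ _
        have h1' : ((S (y j)).card : ℝ) ≤ (n:ℝ) ^ n * Real.exp (-(√n / 4)) := h1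
        have h2' : ((S (fun a => - y j a)).card : ℝ) ≤ (n:ℝ) ^ n * Real.exp (-(√n / 4)) := h2
        linarith
    _ = _ := by simp; ring

lemma dPr_mul {n : ℕ} (P : (Fin n → ℕ) → Prop) [DecidablePred P] :
    dPr n P * (dieFinset n).card = ((dieFinset n).filter P).card := by
  have hN : ((dieFinset n).card : ℝ) ≠ 0 := by exact_mod_cast (dDie_nonempty n).card_pos.ne'
  unfold dPr
  rw [div_mul_cancel₀ _ hN]
  congr!

lemma dPr_nonneg (n : ℕ) (P : (Fin n → ℕ) → Prop) : 0 ≤ dPr n P := by unfold dPr; positivity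

lemma dPr_or {n : ℕ} (P Q R : (Fin n → ℕ) → Prop) (h : ∀ A ∈ dieFinset n, P A → Q A ∨ R A) :
    dPr n P ≤ dPr n Q + dPr n R := by
  classical
  have hN : (0:ℝ) < (dieFinset n).card := by exact_mod_cast (dDie_nonempty n).card_pos
  refine le_of_mul_le_mul_right ?_ hN
  rw [add_mul, dPr_mul, dPr_mul, dPr_mul]
  rw [← Nat.cast_add, Nat.cast_le]
  refine le_trans (Finset.card_le_card ?_) (Finset.card_union_le _ _)
  intro A hA
  obtain ⟨hA, hP⟩ := Finset.mem_filter.1 hA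
  rw [Finset.mem_union, Finset.mem_filter, Finset.mem_filter]
  rcases h A hA hP with h | h
  · exact Or.inl ⟨hA, h⟩
  · exact Or.inr ⟨hA, h⟩

open Classical Filter Topology in
lemma dConc : Tendsto (fun n : ℕ => dPr n (fun A => ∃ j ∈ Finset.Icc 1 n, √(√(n:ℝ)) ^ 3 < |gA A j|)) atTop (𝓝 0) := by
  have hv : Tendsto (fun n : ℕ => √(n:ℝ) / 4) atTop atTop :=
    (Real.tendsto_sqrt_atTop.comp tendsto_natCast_atTop_atTop).atTop_div_const (by norm_num)
  have h1 := ((Real.tendsto_pow_mul_exp_neg_atTop_nhds_zero 5).comp hv).const_mul (4 * Real.pi * 1024)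
  have h2 := h1.div dCountLim dC0_pos.ne'
  rw [mul_zero, zero_div] at h2
  refine squeeze_zero' (Eventually.of_forall fun n => ?_) ?_ h2
  · exact dPr_nonneg _ _
  · filter_upwards [eventually_ge_atTop 1] with n hn
    have hn0 : (1 : ℝ) ≤ n := by exact_mod_cast hn
    have hr : 0 < √(n:ℝ) := Real.sqrt_pos.2 (by linarith)
    have hr2 : √(n:ℝ) ^ 2 = n := Real.sq_sqrt (by linarith)
    have hN : (0:ℝ) < (dieFinset n).card := by exact_mod_cast (dDie_nonempty n).card_pos
    have hb := dBadCard hn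
    set K : ℝ := 2 * Real.pi * (n * √(n:ℝ)) / (n:ℝ) ^ n with hK
    have hK0 : 0 < K := by have := Real.pi_pos; positivity
    rw [← dPr_mul] at hb
    simp only [Pi.div_apply, Function.comp]
    rw [le_div_iff₀ (by positivity)]
    have : 4 * Real.pi * 1024 * ((√(n:ℝ) / 4) ^ 5 * Real.exp (-(√(n:ℝ) / 4))) =
        K * (2 * n * ((n:ℝ) ^ n * Real.exp (-(√n / 4)))) := by
      have e : (√(n:ℝ) / 4) ^ 5 = (n:ℝ) ^ 2 * √n / 1024 := by
        calc (√(n:ℝ) / 4) ^ 5 = (√(n:ℝ) ^ 2) ^ 2 * √n / 1024 := by ring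
          _ = _ := by rw [hr2]
      rw [e, hK]
      field_simp
      norm_num
    rw [this]
    have := mul_le_mul_of_nonneg_left hb hK0.le
    linarith

open Filter Topology in
lemma dGood (ε : ℝ) (hε : 0 < ε) : ∀ᶠ n : ℕ in atTop,
    dPr n (fun A => ¬ (|dPr n (fun B => beats A B) - 1 / 2| < ε ∧ |dPr n (fun B => beats B A) - 1 / 2| < ε)) < ε := by
  obtain ⟨δ, hδ, h1⟩ := dCubSmall (ε / 2) (by linarith)
  have h2 := dConc.eventually_lt_const (show 0 < ε / 2 by linarith)
  have hκ : Tendsto (fun n : ℕ => 250 / (δ * √(√(n:ℝ)))) atTop (𝓝 0) := by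
    refine tendsto_const_nhds.div_atTop (Tendsto.const_mul_atTop hδ ?_)
    exact Real.tendsto_sqrt_atTop.comp (Real.tendsto_sqrt_atTop.comp tendsto_natCast_atTop_atTop)
  have h3 := dUnifHalf _ hκ ε hε
  filter_upwards [h1, h2, h3, eventually_ge_atTop 4] with n h1 h2 h3 hn
  refine lt_of_le_of_lt (b := dPr n (fun B => |dF (dCub n) B| ≤ δ) + dPr n (fun A => ∃ j ∈ Finset.Icc 1 n, √(√(n:ℝ)) ^ 3 < |gA A j|)) ?_ (by linarith)
  refine dPr_or _ _ _ fun A hA h => ?_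
  by_contra hcon
  push Not at hcon
  obtain ⟨c1, c2⟩ := hcon
  obtain ⟨hs, had⟩ := dRes_adm hn hA δ hδ c2 c1
  have := h3 _ had
  rw [← (dPr_res hn A hs).1, ← (dPr_res hn A hs).2] at this
  exact h this


noncomputable def dChi {n : ℕ} (A B : Fin n → ℕ) : ℝ := if beats A B then 1 else 0

lemma dChi_bd {n : ℕ} (A B : Fin n → ℕ) : 0 ≤ dChi A B ∧ dChi A B ≤ 1 := by
  unfold dChi; split_ifs <;> norm_num

lemma dChi_anti {n : ℕ} (A B : Fin n → ℕ) (hB : B ∈ dieFinset n) : dChi A B + dChi B A ≤ 1 := by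
  unfold dChi
  rw [if_congr (dBeats_iff A B hB).1 rfl rfl, if_congr (dBeats_iff A B hB).2 rfl rfl]
  split_ifs with h1 h2
  · linarith
  all_goals norm_num

lemma dChi_p {n : ℕ} (A : Fin n → ℕ) :
    ∑ B ∈ dieFinset n, dChi A B = (dieFinset n).card * dPr n (fun B => beats A B) := by
  rw [mul_comm, dPr_mul]; simp [dChi]

lemma dChi_q {n : ℕ} (A : Fin n → ℕ) :
    ∑ B ∈ dieFinset n, dChi B A = (dieFinset n).card * dPr n (fun B => beats B A) := by
  rw [mul_comm, dPr_mul]; simp [dChi]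

lemma dPr_le_one (n : ℕ) (P : (Fin n → ℕ) → Prop) : dPr n P ≤ 1 := by
  classical
  have hN : (0:ℝ) < (dieFinset n).card := by exact_mod_cast (dDie_nonempty n).card_pos
  refine le_of_mul_le_mul_right ?_ hN
  rw [dPr_mul, one_mul, Nat.cast_le]
  exact Finset.card_filter_le _ _

lemma dAvgBd {n : ℕ} (G : (Fin n → ℕ) → Prop) (F : (Fin n → ℕ) → ℝ) (c ε : ℝ) (hε : 0 < ε)
    (hG : dPr n (fun A => ¬ G A) < ε) (h1 : ∀ A, |F A - c| ≤ 1) (h2 : ∀ A, G A → |F A - c| ≤ 2 * ε) :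
    |∑ A ∈ dieFinset n, F A - (dieFinset n).card * c| ≤ 3 * ε * (dieFinset n).card := by
  classical
  have hN : (0:ℝ) < (dieFinset n).card := by exact_mod_cast (dDie_nonempty n).card_pos
  have e : ∑ A ∈ dieFinset n, F A - (dieFinset n).card * c = ∑ A ∈ dieFinset n, (F A - c) := by
    simp [Finset.sum_sub_distrib]
  rw [e]
  have hb : ∑ A ∈ dieFinset n, (if ¬ G A then (1:ℝ) else 0) = dPr n (fun A => ¬ G A) * (dieFinset n).card := by
    rw [dPr_mul, Finset.sum_boole]
  calc _ ≤ ∑ A ∈ dieFinset n, |F A - c| := Finset.abs_sum_le_sum_abs _ _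
    _ ≤ ∑ A ∈ dieFinset n, (2 * ε + if ¬ G A then (1:ℝ) else 0) := by
        refine Finset.sum_le_sum fun A _ => ?_
        by_cases h : G A
        · simpa [h] using h2 A h
        · have := h1 A
          simp only [h, not_false_eq_true, if_true]
          linarith
    _ = 2 * ε * (dieFinset n).card + dPr n (fun A => ¬ G A) * (dieFinset n).card := by
        rw [Finset.sum_add_distrib, hb]; simp; ring
    _ ≤ _ := by nlinarith

lemma dDen_eq (n : ℕ) : ((((dieFinset n ×ˢ dieFinset n ×ˢ dieFinset n).filter fun t =>
            beats t.1 t.2.1 ∧ beats t.2.1 t.2.2).card : ℕ) : ℝ) =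
    (dieFinset n).card ^ 2 * ∑ B ∈ dieFinset n, dPr n (fun A => beats A B) * dPr n (fun C => beats B C) := by
  rw [Finset.card_filter]
  push_cast
  rw [Finset.sum_product]
  simp only [Finset.sum_product]
  rw [Finset.sum_comm, Finset.mul_sum]
  refine Finset.sum_congr rfl fun B _ => ?_
  calc _ = ∑ A ∈ dieFinset n, ∑ C ∈ dieFinset n, dChi A B * dChi B C := by
        refine Finset.sum_congr rfl fun A _ => Finset.sum_congr rfl fun C _ => ?_
        unfold dChi
        by_cases h1 : beats A B <;> by_cases h2 : beats B C <;> simp [h1, h2]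
    _ = _ := by
        simp only [← Finset.mul_sum, ← Finset.sum_mul, dChi_p, dChi_q]; ring

lemma dNum_eq (n : ℕ) : ((((dieFinset n ×ˢ dieFinset n ×ˢ dieFinset n).filter fun t =>
            beats t.1 t.2.1 ∧ beats t.2.1 t.2.2 ∧ beats t.1 t.2.2).card : ℕ) : ℝ) =
    ∑ A ∈ dieFinset n, ∑ B ∈ dieFinset n, ∑ C ∈ dieFinset n, dChi A B * dChi B C * dChi A C := by
  rw [Finset.card_filter]
  push_cast
  rw [Finset.sum_product]
  simp only [Finset.sum_product]
  refine Finset.sum_congr rfl fun A _ => Finset.sum_congr rfl fun B _ => Finset.sum_congr rfl fun C _ => ?_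
  unfold dChi
  by_cases h1 : beats A B <;> by_cases h2 : beats B C <;> by_cases h3 : beats A C <;> simp [h1, h2, h3]

lemma dNum_bd (n : ℕ) (N T P S : ℝ) (hN : N = (dieFinset n).card)
    (hT : T = ∑ A ∈ dieFinset n, ∑ B ∈ dieFinset n, ∑ C ∈ dieFinset n, dChi A B * dChi B C * dChi A C)
    (hP : P = ∑ A ∈ dieFinset n, dPr n (fun B => beats A B))
    (hS : S = ∑ A ∈ dieFinset n, dPr n (fun B => beats A B) ^ 2) :
    2 * T ≤ N ^ 2 * S ∧ N ^ 2 * S ≤ 2 * T + N * (N ^ 2 - 2 * (N * P)) := by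
  have hT2 : T = ∑ A ∈ dieFinset n, ∑ B ∈ dieFinset n, ∑ C ∈ dieFinset n, dChi A B * dChi C B * dChi A C := by
    rw [hT]
    refine Finset.sum_congr rfl fun A _ => ?_
    rw [Finset.sum_comm]
    refine Finset.sum_congr rfl fun C _ => Finset.sum_congr rfl fun B _ => by ring
  have hS2 : N ^ 2 * S = ∑ A ∈ dieFinset n, ∑ B ∈ dieFinset n, ∑ C ∈ dieFinset n, dChi A B * dChi A C := by
    simp only [← Finset.mul_sum, ← Finset.sum_mul, dChi_p]
    rw [hS, Finset.mul_sum, hN]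
    exact Finset.sum_congr rfl fun A _ => by ring
  have h2T : 2 * T = ∑ A ∈ dieFinset n, ∑ B ∈ dieFinset n, ∑ C ∈ dieFinset n, dChi A B * dChi A C * (dChi B C + dChi C B) := by
    rw [two_mul]
    nth_rewrite 1 [hT]
    rw [hT2]
    simp only [← Finset.sum_add_distrib]
    exact Finset.sum_congr rfl fun A _ => Finset.sum_congr rfl fun B _ => Finset.sum_congr rfl fun C _ => by ring
  have hties : N * (N ^ 2 - 2 * (N * P)) = ∑ A ∈ dieFinset n, ∑ B ∈ dieFinset n, ∑ C ∈ dieFinset n, (1 - (dChi B C + dChi C B)) := by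
    have e1 : ∑ B ∈ dieFinset n, ∑ C ∈ dieFinset n, dChi B C = N * P := by
      simp only [dChi_p, ← Finset.mul_sum]; rw [hN, hP]
    have e2 : ∑ B ∈ dieFinset n, ∑ C ∈ dieFinset n, dChi C B = N * P := by
      rw [Finset.sum_comm, e1]
    simp only [Finset.sum_sub_distrib, Finset.sum_add_distrib, e1, e2]
    simp [← hN]
    ring
  constructor
  · rw [h2T, hS2]
    refine Finset.sum_le_sum fun A _ => Finset.sum_le_sum fun B _ => Finset.sum_le_sum fun C hC => ?_
    exact mul_le_of_le_one_right (mul_nonneg (dChi_bd _ _).1 (dChi_bd _ _).1) (dChi_anti B C hC)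
  · rw [h2T, hS2, hties]
    simp only [← Finset.sum_add_distrib]
    refine Finset.sum_le_sum fun A _ => Finset.sum_le_sum fun B _ => Finset.sum_le_sum fun C hC => ?_
    have h1 := dChi_anti B C hC
    have h2 : dChi A B * dChi A C ≤ 1 := mul_le_one₀ (dChi_bd _ _).2 (dChi_bd _ _).1 (dChi_bd _ _).2
    nlinarith

lemma dFinal {n : ℕ} {ε : ℝ} (hε : 0 < ε)
    (hG : dPr n (fun A => ¬ (|dPr n (fun B => beats A B) - 1 / 2| < ε ∧ |dPr n (fun B => beats B A) - 1 / 2| < ε)) < ε) :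
    |((((dieFinset n ×ˢ dieFinset n ×ˢ dieFinset n).filter fun t =>
            beats t.1 t.2.1 ∧ beats t.2.1 t.2.2 ∧ beats t.1 t.2.2).card : ℕ) : ℝ) / (dieFinset n).card ^ 3 - 1 / 8| ≤ 5 * ε ∧
    |((((dieFinset n ×ˢ dieFinset n ×ˢ dieFinset n).filter fun t =>
            beats t.1 t.2.1 ∧ beats t.2.1 t.2.2).card : ℕ) : ℝ) / (dieFinset n).card ^ 3 - 1 / 4| ≤ 5 * ε := by
  have hN : (0:ℝ) < (dieFinset n).card := by exact_mod_cast (dDie_nonempty n).card_pos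
  have p0 := fun A : Fin n → ℕ => dPr_nonneg n (fun B => beats A B)
  have p1 := fun A : Fin n → ℕ => dPr_le_one n (fun B => beats A B)
  have q0 := fun A : Fin n → ℕ => dPr_nonneg n (fun B => beats B A)
  have q1 := fun A : Fin n → ℕ => dPr_le_one n (fun B => beats B A)
  have a1 := dAvgBd _ (fun A => dPr n (fun B => beats A B)) (1 / 2) ε hε hG
    (fun A => by rw [abs_le]; constructor <;> linarith [p0 A, p1 A]) (fun A h => by linarith [h.1])
  have a2 := dAvgBd _ (fun A => dPr n (fun B => beats A B) ^ 2) (1 / 4) ε hε hG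
    (fun A => by rw [abs_le]; constructor <;> nlinarith [p0 A, p1 A])
    (fun A h => by
      have := abs_lt.1 h.1
      rw [abs_le]; constructor <;> nlinarith [p0 A, p1 A])
  have a3 := dAvgBd _ (fun A => dPr n (fun B => beats B A) * dPr n (fun B => beats A B)) (1 / 4) ε hε hG
    (fun A => by
      have h1 := mul_nonneg (q0 A) (p0 A)
      have h2 := mul_le_one₀ (q1 A) (p0 A) (p1 A)
      rw [abs_le]; constructor <;> linarith)
    (fun A h => by
      have h1 := abs_lt.1 h.1
      have h2 := abs_lt.1 h.2
      rw [abs_le]; constructor <;> nlinarith [p0 A, p1 A, q0 A, q1 A])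
  have b := dNum_bd n _ _ _ _ rfl rfl rfl rfl
  rw [← dNum_eq] at b
  rw [dDen_eq]
  set N : ℝ := ((dieFinset n).card : ℝ) with hNd
  set T : ℝ := ((((dieFinset n ×ˢ dieFinset n ×ˢ dieFinset n).filter fun t =>
            beats t.1 t.2.1 ∧ beats t.2.1 t.2.2 ∧ beats t.1 t.2.2).card : ℕ) : ℝ)
  set P : ℝ := ∑ A ∈ dieFinset n, dPr n (fun B => beats A B)
  set S : ℝ := ∑ A ∈ dieFinset n, dPr n (fun B => beats A B) ^ 2
  set R : ℝ := ∑ B ∈ dieFinset n, dPr n (fun A => beats A B) * dPr n (fun C => beats B C)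
  clear_value N T P S R
  obtain ⟨b1, b2⟩ := b
  rw [abs_le] at a1 a2 a3
  have hN3 : 0 < N ^ 3 := by positivity
  have hN2 : 0 < N ^ 2 := by positivity
  have m2a := mul_le_mul_of_nonneg_left a2.1 hN2.le
  have m2b := mul_le_mul_of_nonneg_left a2.2 hN2.le
  have m1a := mul_le_mul_of_nonneg_left a1.1 hN2.le
  have m3a := mul_le_mul_of_nonneg_left a3.1 hN2.le
  have m3b := mul_le_mul_of_nonneg_left a3.2 hN2.le
  have hεN : 0 < ε * N ^ 3 := by positivity
  constructor
  · rw [abs_le, le_sub_iff_add_le, sub_le_iff_le_add, le_div_iff₀ hN3, div_le_iff₀ hN3]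
    constructor <;> linarith
  · rw [abs_le, le_sub_iff_add_le, sub_le_iff_le_add, le_div_iff₀ hN3, div_le_iff₀ hN3]
    constructor <;> linarith

theorem conditional_transitivity_tendsto_half :
    Filter.Tendsto
      (fun n : ℕ =>
        (((dieFinset n ×ˢ dieFinset n ×ˢ dieFinset n).filter fun t =>
            beats t.1 t.2.1 ∧ beats t.2.1 t.2.2 ∧ beats t.1 t.2.2).card : ℝ) /
          (((dieFinset n ×ˢ dieFinset n ×ˢ dieFinset n).filter fun t =>
            beats t.1 t.2.1 ∧ beats t.2.1 t.2.2).card : ℝ))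
      Filter.atTop (nhds (1 / 2)) := by
  have h1 : Filter.Tendsto (fun n : ℕ => (((dieFinset n ×ˢ dieFinset n ×ˢ dieFinset n).filter fun t =>
            beats t.1 t.2.1 ∧ beats t.2.1 t.2.2 ∧ beats t.1 t.2.2).card : ℝ) / (dieFinset n).card ^ 3)
      Filter.atTop (nhds (1 / 8)) := by
    rw [Metric.tendsto_nhds]
    intro η hη
    filter_upwards [dGood (η / 10) (by linarith)] with n hn
    have := (dFinal (by linarith) hn).1
    rw [Real.dist_eq]
    linarith
  have h2 : Filter.Tendsto (fun n : ℕ => (((dieFinset n ×ˢ dieFinset n ×ˢ dieFinset n).filter fun t =>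
            beats t.1 t.2.1 ∧ beats t.2.1 t.2.2).card : ℝ) / (dieFinset n).card ^ 3)
      Filter.atTop (nhds (1 / 4)) := by
    rw [Metric.tendsto_nhds]
    intro η hη
    filter_upwards [dGood (η / 10) (by linarith)] with n hn
    have := (dFinal (by linarith) hn).2
    rw [Real.dist_eq]
    linarith
  have h3 := h1.div h2 (by norm_num)
  rw [show (1 / 8 : ℝ) / (1 / 4) = 1 / 2 by norm_num] at h3
  refine h3.congr fun n => ?_
  have hN : ((dieFinset n).card : ℝ) ≠ 0 := by exact_mod_cast (dDie_nonempty n).card_pos.ne'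
  simp only [Pi.div_apply]
  exact div_div_div_cancel_right₀ (pow_ne_zero 3 hN) _ _
end

section
/- For each n, let T_n be a directed graph on a vertex set of size n with no loops and at most one directed edge between any pair of distinct vertices, and suppose the number of edges of T_n is (1−o(1))·binom(n,2). Then the following two statements are equivalent: (1) the proportion of triples of distinct vertices that are intransitive tends to 1/4 as n → ∞; (2) for every ε > 0, the proportion of vertices x with |d_+(x) − n/2| ≤ εn tends to 1 as n → ∞. -/
open Finset

lemma aux_pt (a b c a' b' c' : ℝ) (ha : a = 0 ∨ a = 1) (hb : b = 0 ∨ b = 1) (hc : c = 0 ∨ c = 1)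
    (ha' : a' = 0 ∨ a' = 1) (hb' : b' = 0 ∨ b' = 1) (hc' : c' = 0 ∨ c' = 1)
    (h1 : a * a' = 0) (h2 : b * b' = 0) (h3 : c * c' = 0) :
    |(a * b * c + a' * b' * c') - (1 / 4) * (1 - (2 * b' - 1) * (2 * c - 1)
      - (2 * c' - 1) * (2 * a - 1) - (2 * a' - 1) * (2 * b - 1))| ≤
      (1 - a - a') + (1 - b - b') + (1 - c - c') := by
  rcases ha with rfl | rfl <;> rcases ha' with rfl | rfl <;> (try (exfalso; linarith)) <;>
  rcases hb with rfl | rfl <;> rcases hb' with rfl | rfl <;> (try (exfalso; linarith)) <;>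
  rcases hc with rfl | rfl <;> rcases hc' with rfl | rfl <;> (try (exfalso; linarith)) <;>
  rw [abs_le] <;> constructor <;> norm_num

lemma aux_sum (n : ℕ) (a : Fin n → Fin n → ℝ) (h01 : ∀ x y, a x y = 0 ∨ a x y = 1)
    (hanti : ∀ x y, a x y * a y x = 0) :
    |(∑ x, ∑ y, ∑ z, (a x y * a y z * a z x + a y x * a z y * a x z)) - (n : ℝ) ^ 3 / 4
      + 3 * ∑ x, ((∑ y, a x y) - (n : ℝ) / 2) ^ 2| ≤
      3 * n * ((n : ℝ) ^ 2 - 2 * ∑ x, ∑ y, a x y) := by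
  have hD : ∀ x, ∑ y, (2 * a x y - 1) = 2 * (∑ y, a x y) - n := by
    intro x; simp [Finset.sum_sub_distrib, Finset.mul_sum]
  have hsq : ∀ x, ∑ y, ∑ z, (2 * a x y - 1) * (2 * a x z - 1)
      = 4 * ((∑ y, a x y) - (n : ℝ) / 2) ^ 2 := by
    intro x
    rw [← Finset.sum_mul_sum, hD]; ring
  have m1 : ∑ x, ∑ y, ∑ z, (2 * a x z - 1) * (2 * a x y - 1)
      = 4 * ∑ x, ((∑ y, a x y) - (n : ℝ) / 2) ^ 2 := by
    rw [Finset.mul_sum]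
    refine Finset.sum_congr rfl fun x _ => ?_
    rw [← hsq x]
    exact Finset.sum_comm
  have m2 : ∑ x, ∑ y, ∑ z, (2 * a y x - 1) * (2 * a y z - 1)
      = 4 * ∑ x, ((∑ y, a x y) - (n : ℝ) / 2) ^ 2 := by
    rw [Finset.mul_sum, Finset.sum_comm]
    exact Finset.sum_congr rfl fun x _ => hsq x
  have m3 : ∑ x, ∑ y, ∑ z, (2 * a z y - 1) * (2 * a z x - 1)
      = 4 * ∑ x, ((∑ y, a x y) - (n : ℝ) / 2) ^ 2 := by
    rw [Finset.mul_sum]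
    calc _ = ∑ x, ∑ z, ∑ y, (2 * a z y - 1) * (2 * a z x - 1) :=
          Finset.sum_congr rfl fun x _ => Finset.sum_comm
      _ = ∑ z, ∑ x, ∑ y, (2 * a z y - 1) * (2 * a z x - 1) := Finset.sum_comm
      _ = _ := by
          refine Finset.sum_congr rfl fun x _ => ?_
          rw [← hsq x]; exact Finset.sum_comm
  have hone : ∑ _x : Fin n, ∑ _y : Fin n, ∑ _z : Fin n, (1 : ℝ) = (n : ℝ) ^ 3 := by
    simp; ring
  have hmain : (∑ x, ∑ y, ∑ z, (a x y * a y z * a z x + a y x * a z y * a x z)) - (n : ℝ) ^ 3 / 4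
      + 3 * ∑ x, ((∑ y, a x y) - (n : ℝ) / 2) ^ 2
      = ∑ x, ∑ y, ∑ z, ((a x y * a y z * a z x + a y x * a z y * a x z)
        - (1 / 4) * (1 - (2 * a z y - 1) * (2 * a z x - 1)
      - (2 * a x z - 1) * (2 * a x y - 1) - (2 * a y x - 1) * (2 * a y z - 1))) := by
    simp only [Finset.sum_sub_distrib, ← Finset.mul_sum _ _ (1 / 4 : ℝ)]
    rw [m1, m2, m3, hone]; ring
  have hsw : ∑ x, ∑ y, a y x = ∑ x, ∑ y, a x y := Finset.sum_comm
  have hG : ∑ x, ∑ y, (1 - a x y - a y x) = (n : ℝ) ^ 2 - 2 * ∑ x, ∑ y, a x y := by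
    simp only [Finset.sum_sub_distrib]
    rw [hsw]; simp; ring
  have g1 : ∑ x, ∑ y, ∑ _z : Fin n, (1 - a x y - a y x)
      = n * ((n : ℝ) ^ 2 - 2 * ∑ x, ∑ y, a x y) := by
    rw [← hG]
    simp only [Finset.sum_const, Finset.card_univ, Fintype.card_fin, nsmul_eq_mul, Finset.mul_sum]
  have g2 : ∑ _x : Fin n, ∑ y, ∑ z, (1 - a y z - a z y)
      = n * ((n : ℝ) ^ 2 - 2 * ∑ x, ∑ y, a x y) := by
    rw [hG, Finset.sum_const]; simp only [Finset.card_univ, Fintype.card_fin, nsmul_eq_mul]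
  have g3 : ∑ x, ∑ _y : Fin n, ∑ z, (1 - a z x - a x z)
      = n * ((n : ℝ) ^ 2 - 2 * ∑ x, ∑ y, a x y) := by
    rw [Finset.sum_comm, Finset.sum_const, Finset.sum_comm, hG]; simp
  rw [hmain]
  calc _ ≤ ∑ x, ∑ y, ∑ z, ((1 - a x y - a y x) + (1 - a y z - a z y) + (1 - a z x - a x z)) := by
        refine (Finset.abs_sum_le_sum_abs _ _).trans (Finset.sum_le_sum fun x _ => ?_)
        refine (Finset.abs_sum_le_sum_abs _ _).trans (Finset.sum_le_sum fun y _ => ?_)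
        refine (Finset.abs_sum_le_sum_abs _ _).trans (Finset.sum_le_sum fun z _ => ?_)
        exact aux_pt _ _ _ _ _ _ (h01 _ _) (h01 _ _) (h01 _ _) (h01 _ _) (h01 _ _) (h01 _ _)
          (hanti _ _) (hanti _ _) (hanti _ _)
    _ = _ := by
        simp only [Finset.sum_add_distrib]
        rw [g1, g2, g3]; ring

lemma aux_fin (n : ℕ) (T : Finset (Fin n × Fin n))
    (hloop : ∀ x : Fin n, (x, x) ∉ T)
    (hanti : ∀ x y : Fin n, ¬((x, y) ∈ T ∧ (y, x) ∈ T)) :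
    |(((Finset.univ : Finset (Fin n × Fin n × Fin n)).filter fun t =>
              t.1 ≠ t.2.1 ∧ t.1 ≠ t.2.2 ∧ t.2.1 ≠ t.2.2 ∧
                (((t.1, t.2.1) ∈ T ∧ (t.2.1, t.2.2) ∈ T ∧ (t.2.2, t.1) ∈ T) ∨
                  ((t.1, t.2.2) ∈ T ∧ (t.2.2, t.2.1) ∈ T ∧ (t.2.1, t.1) ∈ T))).card : ℝ)
       - (n : ℝ) ^ 3 / 4
      + 3 * ∑ x, (((Finset.univ.filter fun y => (x, y) ∈ T).card : ℝ) - (n : ℝ) / 2) ^ 2| ≤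
      3 * n * ((n : ℝ) ^ 2 - 2 * T.card) := by
  have key := aux_sum n (fun x y => if (x, y) ∈ T then 1 else 0)
    (fun x y => by by_cases h : (x, y) ∈ T <;> simp [h])
    (fun x y => by
      have := hanti x y
      by_cases h : (x, y) ∈ T <;> by_cases h' : (y, x) ∈ T <;> simp_all)
  have e1 : ∀ x, ((Finset.univ.filter fun y => (x, y) ∈ T).card : ℝ)
      = ∑ y, (if (x, y) ∈ T then (1 : ℝ) else 0) := by
    intro x; simp
  have e2 : (T.card : ℝ) = ∑ x, ∑ y, (if (x, y) ∈ T then (1 : ℝ) else 0) := by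
    rw [← Fintype.sum_prod_type' (f := fun x y => if (x, y) ∈ T then (1 : ℝ) else 0)]
    simp
  simp only [e1, e2]
  convert key using 4
  rw [Finset.card_filter]
  push_cast
  rw [Fintype.sum_prod_type]
  refine Finset.sum_congr rfl fun x _ => ?_
  rw [Fintype.sum_prod_type]
  refine Finset.sum_congr rfl fun y _ => Finset.sum_congr rfl fun z _ => ?_
  have hx := hloop x
  have hy := hloop y
  have hz := hloop z
  have h1 := hanti x y
  have h2 := hanti y z
  have h3 := hanti z x
  have n1 : (x, y) ∈ T → x ≠ y := by rintro h rfl; exact hx h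
  have n1' : (y, x) ∈ T → x ≠ y := by rintro h rfl; exact hx h
  have n2 : (y, z) ∈ T → y ≠ z := by rintro h rfl; exact hy h
  have n2' : (z, y) ∈ T → y ≠ z := by rintro h rfl; exact hy h
  have n3 : (z, x) ∈ T → x ≠ z := by rintro h rfl; exact hx h
  have n3' : (x, z) ∈ T → x ≠ z := by rintro h rfl; exact hx h
  clear key e1 e2 hx hy hz
  by_cases p1 : (x, y) ∈ T <;> by_cases p1' : (y, x) ∈ T <;>
  by_cases p2 : (y, z) ∈ T <;> by_cases p2' : (z, y) ∈ T <;>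
  by_cases p3 : (z, x) ∈ T <;> by_cases p3' : (x, z) ∈ T <;> simp_all

lemma aux_V (n : ℕ) (hn : 0 < n) (d : Fin n → ℝ) (h0 : ∀ x, 0 ≤ d x) (h1 : ∀ x, d x ≤ n)
    (ε : ℝ) (hε : 0 < ε) :
    ε ^ 2 * (1 - ((univ.filter fun x => |d x - (n : ℝ) / 2| ≤ ε * n).card : ℝ) / n)
      ≤ (∑ x, (d x - (n : ℝ) / 2) ^ 2) / (n : ℝ) ^ 3 ∧
    (∑ x, (d x - (n : ℝ) / 2) ^ 2) / (n : ℝ) ^ 3 ≤ ε ^ 2 +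
      (1 - ((univ.filter fun x => |d x - (n : ℝ) / 2| ≤ ε * n).card : ℝ) / n) := by
  have hn' : (0 : ℝ) < n := by exact_mod_cast hn
  have hc : ((univ.filter fun x => |d x - (n : ℝ) / 2| ≤ ε * n).card : ℝ)
      = ∑ x, (if |d x - (n : ℝ) / 2| ≤ ε * n then (1 : ℝ) else 0) := by simp
  set p := ((univ.filter fun x => |d x - (n : ℝ) / 2| ≤ ε * n).card : ℝ) with hp
  have L : ∑ x, ε ^ 2 * (n : ℝ) ^ 2 * (1 - (if |d x - (n : ℝ) / 2| ≤ ε * n then (1 : ℝ) else 0))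
      ≤ ∑ x, (d x - (n : ℝ) / 2) ^ 2 := by
    refine Finset.sum_le_sum fun x _ => ?_
    split_ifs with h
    · simp; positivity
    · push Not at h
      rw [← sq_abs (d x - n / 2)]
      have : 0 ≤ ε * n := by positivity
      nlinarith
  have U : ∑ x, (d x - (n : ℝ) / 2) ^ 2 ≤ ∑ x, (ε ^ 2 * (n : ℝ) ^ 2 +
      (n : ℝ) ^ 2 * (1 - (if |d x - (n : ℝ) / 2| ≤ ε * n then (1 : ℝ) else 0))) := by
    refine Finset.sum_le_sum fun x _ => ?_
    split_ifs with h
    · rw [← sq_abs (d x - n / 2)]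
      have : 0 ≤ |d x - n / 2| := abs_nonneg _
      nlinarith
    · have : 0 ≤ ε ^ 2 * (n : ℝ) ^ 2 := by positivity
      nlinarith [h0 x, h1 x]
  rw [← Finset.mul_sum, Finset.sum_sub_distrib, ← hc] at L
  rw [Finset.sum_add_distrib, ← Finset.mul_sum univ _ ((n : ℝ) ^ 2), Finset.sum_sub_distrib, ← hc] at U
  simp only [Finset.sum_const, Finset.card_univ, Fintype.card_fin, nsmul_eq_mul, mul_one] at L U
  constructor
  · rw [le_div_iff₀ (by positivity)]
    refine le_trans (le_of_eq ?_) L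
    field_simp
  · rw [div_le_iff₀ (by positivity)]
    refine U.trans (le_of_eq ?_)
    field_simp

open Filter Topology in
lemma aux_lim (C t : ℕ → ℝ) (d : (n : ℕ) → Fin n → ℝ) (h0 : ∀ n x, 0 ≤ d n x)
    (h1 : ∀ n x, d n x ≤ n)
    (hm : ∀ n : ℕ, |C n - (n : ℝ) ^ 3 / 4 + 3 * ∑ x, (d n x - (n : ℝ) / 2) ^ 2| ≤
      3 * n * ((n : ℝ) ^ 2 - 2 * t n))
    (ht : Tendsto (fun n : ℕ => t n / (n.choose 2 : ℝ)) atTop (𝓝 1)) :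
    Tendsto (fun n : ℕ => C n / ((n : ℝ) * ((n : ℝ) - 1) * ((n : ℝ) - 2))) atTop (𝓝 (1 / 4)) ↔
    ∀ ε : ℝ, 0 < ε → Tendsto (fun n : ℕ =>
      ((univ.filter fun x => |d n x - (n : ℝ) / 2| ≤ ε * n).card : ℝ) / (n : ℝ)) atTop (𝓝 1) := by
  have hinv : Tendsto (fun n : ℕ => (1 : ℝ) / n) atTop (𝓝 0) := tendsto_one_div_atTop_nhds_zero_nat
  have hg : Tendsto (fun n : ℕ => 3 * (1 - t n / (n.choose 2 : ℝ) * (1 - 1 / (n : ℝ)))) atTop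
      (𝓝 0) := by
    have := ((ht.mul (hinv.const_sub 1)).const_sub 1).const_mul 3
    simpa using this
  have hr : Tendsto (fun n : ℕ => (1 - 1 / (n : ℝ)) * (1 - 2 * (1 / (n : ℝ)))) atTop (𝓝 1) := by
    have := (hinv.const_sub 1).mul ((hinv.const_mul 2).const_sub 1)
    simpa using this
  set v : ℕ → ℝ := fun n => (∑ x, (d n x - (n : ℝ) / 2) ^ 2) / (n : ℝ) ^ 3 with hv
  have hv0 : ∀ n, 0 ≤ v n := fun n => by simp only [hv]; positivity
  have hdiff : Tendsto (fun n : ℕ => C n / (n : ℝ) ^ 3 - 1 / 4 + 3 * v n) atTop (𝓝 0) := by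
    refine squeeze_zero_norm' ?_ hg
    filter_upwards [eventually_ge_atTop 2] with n hn
    have hn' : (2 : ℝ) ≤ n := by exact_mod_cast hn
    have hp : (0 : ℝ) < n := by linarith
    have hp1 : (n : ℝ) - 1 ≠ 0 := by linarith
    have hE : C n / (n : ℝ) ^ 3 - 1 / 4 + 3 * v n =
      (C n - (n : ℝ) ^ 3 / 4 + 3 * ∑ x, (d n x - (n : ℝ) / 2) ^ 2) / (n : ℝ) ^ 3 := by
      simp only [hv]
      generalize ∑ x, (d n x - (n : ℝ) / 2) ^ 2 = S
      field_simp
    rw [hE, Real.norm_eq_abs, abs_div, abs_of_pos (show (0 : ℝ) < (n : ℝ) ^ 3 by positivity),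
      div_le_iff₀ (by positivity)]
    refine (hm n).trans (le_of_eq ?_)
    rw [Nat.cast_choose_two]
    field_simp
  have s1 : Tendsto (fun n : ℕ => C n / ((n : ℝ) * ((n : ℝ) - 1) * ((n : ℝ) - 2))) atTop
      (𝓝 (1 / 4)) ↔ Tendsto (fun n : ℕ => C n / (n : ℝ) ^ 3) atTop (𝓝 (1 / 4)) := by
    constructor
    · intro h
      have := h.mul hr
      rw [mul_one] at this
      refine this.congr' ?_
      filter_upwards [eventually_ge_atTop 3] with n hn
      have hn' : (3 : ℝ) ≤ n := by exact_mod_cast hn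
      have hp : (n : ℝ) ≠ 0 := by linarith
      have hp1 : (n : ℝ) - 1 ≠ 0 := by linarith
      have hp2 : (n : ℝ) - 2 ≠ 0 := by linarith
      field_simp
    · intro h
      have := h.div hr one_ne_zero
      rw [div_one] at this
      refine this.congr' ?_
      filter_upwards [eventually_ge_atTop 3] with n hn
      have hn' : (3 : ℝ) ≤ n := by exact_mod_cast hn
      have hp : (n : ℝ) ≠ 0 := by linarith
      have hp1 : (n : ℝ) - 1 ≠ 0 := by linarith
      have hp2 : (n : ℝ) - 2 ≠ 0 := by linarith
      have q1 : 1 - 1 / (n : ℝ) = (n - 1) / n := by field_simp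
      have q2 : 1 - 2 * (1 / (n : ℝ)) = (n - 2) / n := by field_simp
      change C n / (n : ℝ) ^ 3 / ((1 - 1 / (n : ℝ)) * (1 - 2 * (1 / (n : ℝ)))) = _
      rw [q1, q2]
      field_simp
  have s2 : Tendsto (fun n : ℕ => C n / (n : ℝ) ^ 3) atTop (𝓝 (1 / 4)) ↔
      Tendsto v atTop (𝓝 0) := by
    constructor
    · intro h
      have := (hdiff.sub (h.sub_const (1 / 4))).const_mul (1 / 3)
      simp only [sub_self, mul_zero] at this
      exact this.congr fun n => by ring
    · intro h
      have := (hdiff.sub (h.const_mul 3)).add_const (1 / 4)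
      simp only [sub_self, mul_zero, zero_add] at this
      exact this.congr fun n => by ring
  rw [s1, s2]
  constructor
  · intro h ε hε
    have hh : Tendsto (fun n : ℕ => 1 - v n / ε ^ 2) atTop (𝓝 1) := by
      simpa using (h.div_const (ε ^ 2)).const_sub 1
    refine tendsto_of_tendsto_of_tendsto_of_le_of_le' hh tendsto_const_nhds ?_ ?_
    · filter_upwards [eventually_gt_atTop 0] with n hn
      have := (aux_V n hn (d n) (h0 n) (h1 n) ε hε).1
      rw [mul_comm, ← le_div_iff₀ (by positivity)] at this
      simp only [hv]; linarith
    · filter_upwards [eventually_gt_atTop 0] with n hn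
      have hn' : (0 : ℝ) < n := by exact_mod_cast hn
      rw [div_le_one hn']
      have := Finset.card_filter_le (univ : Finset (Fin n)) (fun x => |d n x - (n : ℝ) / 2| ≤ ε * n)
      simp only [Finset.card_univ, Fintype.card_fin] at this
      exact_mod_cast this
  · intro h
    rw [Metric.tendsto_atTop']
    intro δ hδ
    have hs : 0 < Real.sqrt (δ / 2) := Real.sqrt_pos.2 (by linarith)
    have h2 := h _ hs
    have h3 := (h2.const_sub 1).eventually (gt_mem_nhds (show (1 - 1 : ℝ) < δ / 2 by linarith))
    obtain ⟨N, hN⟩ := eventually_atTop.1 h3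
    refine ⟨N, fun n hn => ?_⟩
    have := (aux_V n (by omega) (d n) (h0 n) (h1 n) _ hs).2
    rw [Real.sq_sqrt (by linarith)] at this
    have h4 := hN n hn.le
    rw [Real.dist_eq, sub_zero, abs_of_nonneg (hv0 n)]
    simp only [hv]; linarith

/-- for a sequence of directed graphs `T n` on `n` vertices with no loops,
no pair of opposite edges, and `(1-o(1))·C(n,2)` edges, the proportion of triples of
distinct vertices that are intransitive (i.e. span a directed 3-cycle) tends to 1/4
if and only if all but a vanishing proportion of vertices have out-degree `(1/2+o(1))·n`. -/
theorem intransitive_quarter_iff_outdegrees_half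
    (T : (n : ℕ) → Finset (Fin n × Fin n))
    (hloop : ∀ n, ∀ x : Fin n, (x, x) ∉ T n)
    (hanti : ∀ n, ∀ x y : Fin n, ¬((x, y) ∈ T n ∧ (y, x) ∈ T n))
    (hedges : Filter.Tendsto (fun n : ℕ => ((T n).card : ℝ) / (n.choose 2 : ℝ))
      Filter.atTop (nhds 1)) :
    (Filter.Tendsto
        (fun n : ℕ =>
          (((Finset.univ : Finset (Fin n × Fin n × Fin n)).filter fun t =>
              t.1 ≠ t.2.1 ∧ t.1 ≠ t.2.2 ∧ t.2.1 ≠ t.2.2 ∧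
                (((t.1, t.2.1) ∈ T n ∧ (t.2.1, t.2.2) ∈ T n ∧ (t.2.2, t.1) ∈ T n) ∨
                  ((t.1, t.2.2) ∈ T n ∧ (t.2.2, t.2.1) ∈ T n ∧ (t.2.1, t.1) ∈ T n))).card : ℝ) /
            ((n : ℝ) * ((n : ℝ) - 1) * ((n : ℝ) - 2)))
        Filter.atTop (nhds (1 / 4))) ↔
      (∀ ε : ℝ, 0 < ε →
        Filter.Tendsto
          (fun n : ℕ =>
            (((Finset.univ : Finset (Fin n)).filter fun x =>
                |((Finset.univ.filter fun y => (x, y) ∈ T n).card : ℝ) - (n : ℝ) / 2|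
                  ≤ ε * n).card : ℝ) / (n : ℝ))
          Filter.atTop (nhds 1)) := by
  exact aux_lim _ (fun n => ((T n).card : ℝ))
    (fun n x => ((Finset.univ.filter fun y => (x, y) ∈ T n).card : ℝ))
    (fun n x => Nat.cast_nonneg _)
    (fun n x => by
      have := Finset.card_filter_le (univ : Finset (Fin n)) (fun y => (x, y) ∈ T n)
      simp only [Finset.card_univ, Fintype.card_fin] at this
      exact_mod_cast this)
    (fun n => aux_fin n (T n) (hloop n) (hanti n)) hedges
end
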